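/- There exist a real polynomial f of degree 3 and a real polynomial g of degree 7, both mapping [0,1] into itself with f(0) = g(0) = 0, each having exactly two critical points in (0,1) (those of f of multiplicity 2, those of g of local degree 4), each with negative Schwarzian derivative at every point of [0,1] outside its critical points, together with an increasing homeomorphism h : [0,1] → [0,1] satisfying h ∘ f = g ∘ h on [0,1], such that f satisfies the Recurrent Collet–Eckmann condition while g does not: every recurrent critical point c of f satisfies |(f^n)'(f(c))| > C·λ^n for all n ≥ 0 for some constants C > 0, λ > 1, whereas g has a recurrent critical point c̃ (c̃ ∈ ω(c̃)) for which no such constants exist. In particular, the Recurrent Collet–Eckmann condition is not invariant under topological conjugacy for real polynomials on the interval with negative Schwarzian derivative. -/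

import Mathlib

open Set Metric

noncomputable section

/-- The critical point `c` is recurrent: `c` belongs to the set of accumulation points of its
forward orbit `(f^n c)_{n ≥ 1}`. -/
def Recurrent (f : ℝ → ℝ) (c : ℝ) : Prop :=
  ∀ ε > (0:ℝ), ∀ N : ℕ, ∃ n : ℕ, N ≤ n ∧ 1 ≤ n ∧ |f^[n] c - c| < ε

/-- The Collet–Eckmann condition at the critical point `c`. -/
def ColletEckmann (f : ℝ → ℝ) (c : ℝ) : Prop :=
  ∃ C > (0:ℝ), ∃ lam > (1:ℝ), ∀ n : ℕ, C * lam ^ n < |deriv (f^[n]) (f c)|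

/-- The Schwarzian derivative `f'''/f' - (3/2) (f''/f')²`. -/
def schwarzian (f : ℝ → ℝ) (x : ℝ) : ℝ :=
  iteratedDeriv 3 f x / deriv f x - 3/2 * (iteratedDeriv 2 f x / deriv f x) ^ 2

namespace RCE

/-! ### Part 1 : the kneading sequence -/

/-- Number of symbols `1` among the first `n`. -/
def ones (s : ℕ → Fin 3) (n : ℕ) : ℕ := ∑ i ∈ Finset.range n, if s i = 1 then 1 else 0

/-- Allowed pairs of consecutive symbols outside of the returns. -/
def okp (a b : Fin 3) : Prop :=
  (a = 2 ∧ b = 2) ∨ (a = 2 ∧ b = 1) ∨ (a = 1 ∧ b = 1) ∨ (a = 1 ∧ b = 0) ∨ (a = 0 ∧ b = 0) ∨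
    (a = 0 ∧ b = 1)

/-- Properties of a return of depth `A` at position `i`. -/
structure RetAt (s : ℕ → Fin 3) (w : ℕ → ℕ) (i A : ℕ) : Prop where
  h1 : s i = 1
  h2 : s (i + 1) = 2
  agr : ∀ t < A, s (i + 1 + t) = s t ∧ w (i + 1 + t) = w t
  e0 : s (i + 1 + A) = 0
  e1 : s (i + 2 + A) = 1
  k0 : s A = 1
  k1 : s (A + 1) = 1
  le : A + 1 ≤ i
  ev : Even (ones s A)
  nest : ∀ t < A, 0 < w t → t + 1 + w t < A

structure Stg (M q n : ℕ) (s : ℕ → Fin 3) (w : ℕ → ℕ) : Prop where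
  hn : M + 2 ≤ n
  two : ∀ i < M, s i = 2
  one : s M = 1
  last : s (n - 1) = 1
  nr : ∀ i, i + 1 < n → w i = 0 → okp (s i) (s (i + 1))
  lastw : w (n - 1) = 0
  ret : ∀ i A, i < n → w i = A + 1 → i + 2 + A < n ∧ RetAt s w i A
  qX : ∀ i, i + 2 ≤ n → q * (∑ j ∈ Finset.range (i + 2), w j) ≤ i
  zero : ∀ m < n, ∃ i, m ≤ i ∧ i < n ∧ 4 * (i - m) ≤ 3 * m + 4 ∧ s i ≠ 0
  ev : Even (ones s n)

def nxt (n j : ℕ) (s : ℕ → Fin 3) (i : ℕ) : Fin 3 :=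
  if i < n then s i
  else if i < n + 4 * j + 1 then 1
  else if i < n + 7 * j + 1 then 0
  else if i = n + 7 * j + 1 then 1
  else if i < 2 * n + 7 * j + 2 then s (i - (n + 7 * j + 2))
  else if i = 2 * n + 7 * j + 2 then 0
  else 1

def nxtw (n j : ℕ) (w : ℕ → ℕ) (i : ℕ) : ℕ :=
  if i < n then w i
  else if i < n + 7 * j + 1 then 0
  else if i = n + 7 * j + 1 then n + 1
  else if i < 2 * n + 7 * j + 2 then w (i - (n + 7 * j + 2))
  else 0

section
variable {n j : ℕ} {s : ℕ → Fin 3} {w : ℕ → ℕ} {i : ℕ}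

lemma nxt_a (h : i < n) : nxt n j s i = s i := by simp [nxt, h]
lemma nxt_b (h : n ≤ i) (h' : i < n + 4 * j + 1) : nxt n j s i = 1 := by
  unfold nxt; split_ifs <;> first | rfl | omega
lemma nxt_c (h : n + 4 * j + 1 ≤ i) (h' : i < n + 7 * j + 1) : nxt n j s i = 0 := by
  unfold nxt; split_ifs <;> first | rfl | omega
lemma nxt_d (h : i = n + 7 * j + 1) : nxt n j s i = 1 := by
  unfold nxt; split_ifs <;> first | rfl | omega
lemma nxt_e (t : ℕ) (ht : t < n) : nxt n j s (n + 7 * j + 2 + t) = s t := by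
  unfold nxt; split_ifs <;> first | omega | (congr 1; omega)
lemma nxt_f (h : i = 2 * n + 7 * j + 2) : nxt n j s i = 0 := by
  unfold nxt; split_ifs <;> first | rfl | omega
lemma nxt_g (h : 2 * n + 7 * j + 3 ≤ i) : nxt n j s i = 1 := by
  unfold nxt; split_ifs <;> first | rfl | omega
lemma nxtw_a (h : i < n) : nxtw n j w i = w i := by simp [nxtw, h]
lemma nxtw_b (h : n ≤ i) (h' : i < n + 7 * j + 1) : nxtw n j w i = 0 := by
  unfold nxtw; split_ifs <;> first | rfl | omega
lemma nxtw_d (h : i = n + 7 * j + 1) : nxtw n j w i = n + 1 := by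
  unfold nxtw; split_ifs <;> first | rfl | omega
lemma nxtw_e (t : ℕ) (ht : t < n) : nxtw n j w (n + 7 * j + 2 + t) = w t := by
  unfold nxtw; split_ifs <;> first | omega | (congr 1; omega)
lemma nxtw_f (h : 2 * n + 7 * j + 2 ≤ i) : nxtw n j w i = 0 := by
  unfold nxtw; split_ifs <;> first | rfl | omega

/-- Position trichotomy used throughout. -/
lemma pos_cases (n j i : ℕ) : i < n ∨ (n ≤ i ∧ i < n + 4 * j + 1) ∨
    (n + 4 * j + 1 ≤ i ∧ i < n + 7 * j + 1) ∨ i = n + 7 * j + 1 ∨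
    (∃ t < n, i = n + 7 * j + 2 + t) ∨ i = 2 * n + 7 * j + 2 ∨ 2 * n + 7 * j + 3 ≤ i := by
  by_cases h : n + 7 * j + 2 ≤ i ∧ i < 2 * n + 7 * j + 2
  · right; right; right; right; left
    exact ⟨i - (n + 7 * j + 2), by omega, by omega⟩
  · omega

lemma ones_congr {s s' : ℕ → Fin 3} {n : ℕ} (h : ∀ i < n, s i = s' i) : ones s n = ones s' n := by
  unfold ones
  refine Finset.sum_congr rfl fun i hi => ?_
  rw [h i (Finset.mem_range.1 hi)]

lemma ones_succ (s : ℕ → Fin 3) (n : ℕ) : ones s (n + 1) = ones s n + if s n = 1 then 1 else 0 := by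
  simp only [ones, Finset.sum_range_succ]

lemma ones_add (s : ℕ → Fin 3) (n m : ℕ) :
    ones s (n + m) = ones s n + ones (fun i => s (n + i)) m := by
  simp only [ones, Finset.sum_range_add]

lemma ones_const_one {s : ℕ → Fin 3} {m : ℕ} (h : ∀ i < m, s i = 1) : ones s m = m := by
  rw [ones_congr (s' := fun _ => 1) (by simpa using h)]; simp [ones]
lemma ones_const_zero {s : ℕ → Fin 3} {m : ℕ} (h : ∀ i < m, s i = 0) : ones s m = 0 := by
  rw [ones_congr (s' := fun _ => 0) (by simpa using h)]; simp [ones]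

lemma nxt_ones : ones (nxt n j s) (2 * n + 7 * j + 5) = 2 * ones s n + 4 * j + 4 := by
  have e : 2 * n + 7 * j + 5 = n + (4 * j + 1) + 3 * j + 1 + n + 1 + 1 + 1 := by ring
  rw [e, ones_succ, ones_succ, ones_succ, ones_add, ones_succ, ones_add, ones_add]
  rw [nxt_d (i := n + (4 * j + 1) + 3 * j) (by ring),
    nxt_f (i := n + (4 * j + 1) + 3 * j + 1 + n) (by ring),
    nxt_g (i := n + (4 * j + 1) + 3 * j + 1 + n + 1) (by omega),
    nxt_g (i := n + (4 * j + 1) + 3 * j + 1 + n + 1 + 1) (by omega)]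
  rw [ones_congr (s' := s) (fun i hi => nxt_a hi)]
  rw [ones_const_one (fun i hi => nxt_b (by omega) (by omega))]
  rw [ones_const_zero (fun i hi => nxt_c (by omega) (by omega))]
  rw [ones_congr (s := fun i => nxt n j s (n + (4 * j + 1) + 3 * j + 1 + i)) (s' := s)
    (fun i hi => by
      have := nxt_e (n := n) (j := j) (s := s) i hi
      rw [← this]; congr 1; ring)]
  simp; ring

lemma sumw_le_mono (w : ℕ → ℕ) {a b : ℕ} (h : a ≤ b) :
    ∑ j ∈ Finset.range a, w j ≤ ∑ j ∈ Finset.range b, w j :=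
  Finset.sum_le_sum_of_subset (Finset.range_mono h)

lemma sum_congr_lt {w w' : ℕ → ℕ} {n : ℕ} (h : ∀ i < n, w i = w' i) :
    ∑ j ∈ Finset.range n, w j = ∑ j ∈ Finset.range n, w' j :=
  Finset.sum_congr rfl fun i hi => h i (Finset.mem_range.1 hi)

lemma nxtw_sum1 (m : ℕ) (hm : m ≤ n + 7 * j + 1) :
    ∑ i ∈ Finset.range m, nxtw n j w i ≤ ∑ i ∈ Finset.range n, w i := by
  have e : n + 7 * j + 1 = n + (7 * j + 1) := by ring
  refine (sumw_le_mono _ hm).trans ?_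
  rw [e, Finset.sum_range_add, sum_congr_lt (fun i hi => nxtw_a hi),
    sum_congr_lt (w' := fun _ => 0) (n := 7 * j + 1) (fun i hi => nxtw_b (by omega) (by omega))]
  simp

lemma nxtw_sum2 (m : ℕ) (hm : m ≤ 2 * n + 7 * j + 5) :
    ∑ i ∈ Finset.range m, nxtw n j w i ≤ 2 * (∑ i ∈ Finset.range n, w i) + (n + 1) := by
  refine (sumw_le_mono _ hm).trans ?_
  have e : 2 * n + 7 * j + 5 = n + 7 * j + 1 + 1 + n + 3 := by ring
  rw [e, Finset.sum_range_add, Finset.sum_range_add _ _ n, Finset.sum_range_succ]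
  have h1 := nxtw_sum1 (n := n) (j := j) (w := w) _ le_rfl
  rw [sum_congr_lt (w := fun i => nxtw n j w (n + 7 * j + 1 + 1 + i)) (w' := w)
    (fun i hi => nxtw_e i hi),
    sum_congr_lt (w' := fun _ => 0) (n := 3) (fun i hi => nxtw_f (by omega)), nxtw_d rfl]
  simp only [Finset.sum_const_zero]
  omega

end

lemma RetAt.congr {s s' : ℕ → Fin 3} {w w' : ℕ → ℕ} {i A n : ℕ} (h : RetAt s w i A)
    (hi : i + 2 + A < n) (hs : ∀ t < n, s' t = s t) (hw : ∀ t < n, w' t = w t) :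
    RetAt s' w' i A := by
  have hle := h.le
  constructor
  · rw [hs _ (by omega), h.h1]
  · rw [hs _ (by omega), h.h2]
  · intro t ht
    rw [hs _ (by omega), hs _ (by omega), hw _ (by omega), hw _ (by omega)]
    exact h.agr t ht
  · rw [hs _ (by omega), h.e0]
  · rw [hs _ (by omega), h.e1]
  · rw [hs _ (by omega), h.k0]
  · rw [hs _ (by omega), h.k1]
  · exact h.le
  · rw [ones_congr (s' := s) (fun t ht => hs t (by omega))]; exact h.ev
  · intro t ht
    rw [hw _ (by omega)]; exact h.nest t ht

lemma RetAt.shift {s s' : ℕ → Fin 3} {w w' : ℕ → ℕ} {i A n m : ℕ} (h : RetAt s w i A)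
    (hi : i + 2 + A < n) (hs : ∀ t < n, s' t = s t) (hw : ∀ t < n, w' t = w t)
    (hs2 : ∀ t < n, s' (m + t) = s t) (hw2 : ∀ t < n, w' (m + t) = w t) :
    RetAt s' w' (m + i) A := by
  have hle := h.le
  constructor
  · rw [hs2 _ (by omega), h.h1]
  · rw [add_assoc, hs2 _ (by omega), h.h2]
  · intro t ht
    rw [show m + i + 1 + t = m + (i + 1 + t) by ring, hs2 _ (by omega), hs _ (by omega),
      hw2 _ (by omega), hw _ (by omega)]
    exact h.agr t ht
  · rw [show m + i + 1 + A = m + (i + 1 + A) by ring, hs2 _ (by omega), h.e0]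
  · rw [show m + i + 2 + A = m + (i + 2 + A) by ring, hs2 _ (by omega), h.e1]
  · rw [hs _ (by omega), h.k0]
  · rw [hs _ (by omega), h.k1]
  · omega
  · rw [ones_congr (s' := s) (fun t ht => hs t (by omega))]; exact h.ev
  · intro t ht
    rw [hw _ (by omega)]; exact h.nest t ht

lemma Stg.next {M q n j : ℕ} {s : ℕ → Fin 3} {w : ℕ → ℕ} (hM : 1 ≤ M) (h : Stg M q n s w)
    (hj : 1 ≤ j) (hjq : q * (2 * (∑ i ∈ Finset.range n, w i) + (n + 1)) ≤ j) :
    Stg M q (2 * n + 7 * j + 5) (nxt n j s) (nxtw n j w) := by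
  have hn := h.hn
  have hs : ∀ t < n, nxt n j s t = s t := fun t ht => nxt_a ht
  have hw : ∀ t < n, nxtw n j w t = w t := fun t ht => nxtw_a ht
  have hs2 : ∀ t < n, nxt n j s (n + 7 * j + 2 + t) = s t := fun t ht => nxt_e t ht
  have hw2 : ∀ t < n, nxtw n j w (n + 7 * j + 2 + t) = w t := fun t ht => nxtw_e t ht
  constructor
  · omega
  · intro i hi; rw [nxt_a (by omega)]; exact h.two i hi
  · rw [nxt_a (by omega)]; exact h.one
  · rw [nxt_g (by omega)]
  · intro i hi hwi
    rcases pos_cases n j i with h1 | h1 | h1 | h1 | ⟨t, ht, rfl⟩ | h1 | h1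
    · rw [hw _ h1] at hwi
      by_cases h2 : i + 1 < n
      · rw [hs _ h1, hs _ h2]; exact h.nr i h2 hwi
      · have : i = n - 1 := by omega
        rw [hs _ h1, nxt_b (by omega) (by omega), this, h.last]; simp [okp]
    · rw [nxt_b h1.1 h1.2]
      by_cases h2 : i + 1 < n + 4 * j + 1
      · rw [nxt_b (by omega) h2]; simp [okp]
      · rw [nxt_c (by omega) (by omega)]; simp [okp]
    · rw [nxt_c h1.1 h1.2]
      by_cases h2 : i + 1 < n + 7 * j + 1
      · rw [nxt_c (by omega) h2]; simp [okp]
      · rw [nxt_d (by omega)]; simp [okp]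
    · rw [nxtw_d h1] at hwi; omega
    · rw [hw2 _ ht] at hwi
      by_cases h2 : t + 1 < n
      · rw [hs2 _ ht, add_assoc, hs2 _ h2]; exact h.nr t h2 hwi
      · have : t = n - 1 := by omega
        rw [hs2 _ ht, nxt_f (by omega), this, h.last]; simp [okp]
    · rw [nxt_f h1, nxt_g (by omega)]; simp [okp]
    · rw [nxt_g h1, nxt_g (by omega)]; simp [okp]
  · rw [nxtw_f (by omega)]
  · intro i A hi hwi
    rcases pos_cases n j i with h1 | h1 | h1 | h1 | ⟨t, ht, rfl⟩ | h1 | h1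
    · rw [hw _ h1] at hwi
      obtain ⟨h2, h3⟩ := h.ret i A h1 hwi
      exact ⟨by omega, h3.congr h2 hs hw⟩
    · rw [nxtw_b (by omega) (by omega)] at hwi; omega
    · rw [nxtw_b (by omega) (by omega)] at hwi; omega
    · rw [nxtw_d h1] at hwi
      have hA : A = n := by omega
      subst hA
      refine ⟨by omega, ?_⟩
      constructor
      · exact nxt_d h1
      · rw [h1, show A + 7 * j + 1 + 1 = A + 7 * j + 2 + 0 by ring, hs2 _ (by omega)]
        exact h.two 0 (by omega)
      · intro t ht
        rw [h1, show A + 7 * j + 1 + 1 + t = A + 7 * j + 2 + t by ring, hs2 _ ht, hw2 _ ht,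
          hs _ ht, hw _ ht]
        exact ⟨rfl, rfl⟩
      · exact nxt_f (by omega)
      · exact nxt_g (by omega)
      · exact nxt_b (by omega) (by omega)
      · exact nxt_b (by omega) (by omega)
      · omega
      · rw [ones_congr (s' := s) (fun t ht => hs t (by omega))]; exact h.ev
      · intro t ht
        rw [hw _ ht]
        intro h0
        obtain ⟨h2, -⟩ := h.ret t (w t - 1) ht (by omega)
        omega
    · rw [hw2 _ ht] at hwi
      obtain ⟨h2, h3⟩ := h.ret t A ht hwi
      exact ⟨by omega, h3.shift h2 hs hw hs2 hw2⟩
    · rw [nxtw_f (by omega)] at hwi; omega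
    · rw [nxtw_f (by omega)] at hwi; omega
  · intro i hi
    by_cases h1 : i + 2 ≤ n
    · rw [sum_congr_lt (w' := w) (fun t ht => hw t (by omega))]; exact h.qX i h1
    · by_cases h2 : i + 2 ≤ n + 7 * j + 1
      · have h3 := nxtw_sum1 (w := w) (i + 2) h2
        have h4 := h.qX (n - 2) (by omega)
        rw [show n - 2 + 2 = n by omega] at h4
        calc _ ≤ _ := Nat.mul_le_mul_left q h3
          _ ≤ _ := h4
          _ ≤ i := by omega
      · have h3 := nxtw_sum2 (w := w) (i + 2) hi
        calc _ ≤ _ := Nat.mul_le_mul_left q h3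
          _ ≤ _ := hjq
          _ ≤ i := by omega
  · intro m hm
    rcases pos_cases n j m with h1 | h1 | h1 | h1 | ⟨t, ht, rfl⟩ | h1 | h1
    · obtain ⟨i, h2, h3, h4, h5⟩ := h.zero m h1
      exact ⟨i, h2, by omega, h4, by rwa [hs _ h3]⟩
    · exact ⟨m, le_rfl, hm, by omega, by rw [nxt_b h1.1 h1.2]; simp⟩
    · exact ⟨n + 7 * j + 1, by omega, by omega, by omega, by rw [nxt_d rfl]; simp⟩
    · exact ⟨m, le_rfl, hm, by omega, by rw [nxt_d h1]; simp⟩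
    · obtain ⟨i, h2, h3, h4, h5⟩ := h.zero t ht
      exact ⟨n + 7 * j + 2 + i, by omega, by omega, by omega, by rwa [hs2 _ h3]⟩
    · exact ⟨m + 1, by omega, by omega, by omega, by rw [nxt_g (by omega)]; simp⟩
    · exact ⟨m, le_rfl, hm, by omega, by rw [nxt_g (by omega)]; simp⟩
  · rw [nxt_ones]
    obtain ⟨u, hu⟩ := h.ev
    exact ⟨2 * u + 2 * j + 2, by omega⟩

/-- The kneading data. -/
structure Kn (M q : ℕ) (κ : ℕ → Fin 3) (w : ℕ → ℕ) : Prop where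
  two : ∀ i < M, κ i = 2
  one : κ M = 1
  nr : ∀ i, w i = 0 → okp (κ i) (κ (i + 1))
  ret : ∀ i A, w i = A + 1 → RetAt κ w i A
  qX : ∀ i, q * (∑ j ∈ Finset.range (i + 2), w j) ≤ i
  zero : ∀ m, ∃ i, m ≤ i ∧ 4 * (i - m) ≤ 3 * m + 4 ∧ κ i ≠ 0
  deep : ∀ N, ∃ i A, N ≤ A ∧ w i = A + 1
  blk : ∀ b, ∃ n j, b * (n + 1) ≤ j ∧ 1 ≤ j ∧ (∀ i, n ≤ i → i < n + 4 * j + 1 → κ i = 1) ∧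
    (∀ i, n + 4 * j + 1 ≤ i → i < n + 7 * j + 1 → κ i = 0)
  cut : ∀ N, ∃ n ≥ N, ∀ i < n, ∀ A, w i = A + 1 → i + 2 + A < n

structure StD where
  n : ℕ
  s : ℕ → Fin 3
  w : ℕ → ℕ

def StD.j (q k : ℕ) (d : StD) : ℕ :=
  (q + k) * (2 * (∑ i ∈ Finset.range d.n, d.w i) + (d.n + 1)) + 1

def stages (M q : ℕ) : ℕ → StD
  | 0 => ⟨M + 2, fun i => if i < M then 2 else 1, fun _ => 0⟩
  | k + 1 =>
    let d := stages M q k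
    ⟨2 * d.n + 7 * d.j q k + 5, nxt d.n (d.j q k) d.s, nxtw d.n (d.j q k) d.w⟩

lemma stages_stg {M q : ℕ} (hM : 1 ≤ M) (k : ℕ) :
    Stg M q (stages M q k).n (stages M q k).s (stages M q k).w := by
  induction k with
  | zero =>
    simp only [stages]
    constructor
    · exact le_rfl
    · intro i hi; simp [hi]
    · simp
    · simp
    · intro i hi _
      by_cases h1 : i < M <;> by_cases h2 : i + 1 < M <;> simp [h1, h2, okp]
      omega
    · rfl
    · intro i A _ h; simp at h
    · simp
    · intro m hm
      exact ⟨m, le_rfl, hm, by omega, by by_cases h1 : m < M <;> simp [h1]⟩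
    · rw [ones_add, show ones (fun i => if i < M then (2 : Fin 3) else 1) M = 0 by
        rw [ones_congr (s' := fun _ => 2) (by intro i hi; simp [hi])]; simp [ones]]
      rw [ones_const_one (by intro i hi; simp)]
      exact ⟨1, rfl⟩
  | succ k ih =>
    simp only [stages]
    refine ih.next hM ?_ ?_
    · unfold StD.j; omega
    · unfold StD.j
      refine le_trans (Nat.mul_le_mul_right _ (Nat.le_add_right q k)) (Nat.le_succ _)

lemma exists_kn (M q : ℕ) (hM : 1 ≤ M) : ∃ κ w, Kn M q κ w := by
  set D := stages M q with hD
  have hst := fun k => stages_stg (q := q) hM k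
  have hn1 : ∀ k, k < (D k).n := by
    intro k
    induction k with
    | zero => simp [hD, stages]
    | succ k ih => simp only [hD, stages] at ih ⊢; omega
  have hnm : ∀ k, (D k).n ≤ (D (k + 1)).n := by
    intro k; simp only [hD, stages]; omega
  have hmono : Monotone fun k => (D k).n := monotone_nat_of_le_succ hnm
  have hs : ∀ k m, k ≤ m → ∀ i < (D k).n, (D m).s i = (D k).s i ∧ (D m).w i = (D k).w i := by
    intro k m hkm
    induction m, hkm using Nat.le_induction with
    | base => intro i hi; exact ⟨rfl, rfl⟩
    | succ m hm ih =>
      intro i hi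
      have hi' : i < (D m).n := lt_of_lt_of_le hi (hmono hm)
      rw [← (ih i hi).1, ← (ih i hi).2]
      exact ⟨nxt_a hi', nxtw_a hi'⟩
  let κ : ℕ → Fin 3 := fun i => (D i).s i
  let w : ℕ → ℕ := fun i => (D i).w i
  have hκ : ∀ k, ∀ i < (D k).n, κ i = (D k).s i := by
    intro k i hi
    rcases le_total k i with h | h
    · exact (hs k i h i hi).1
    · exact (hs i k h i (hn1 i)).1.symm
  have hw : ∀ k, ∀ i < (D k).n, w i = (D k).w i := by
    intro k i hi
    rcases le_total k i with h | h
    · exact (hs k i h i hi).2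
    · exact (hs i k h i (hn1 i)).2.symm
  have hnM : ∀ k, M + 2 ≤ (D k).n := fun k => (hst k).hn
  have hret : ∀ k, ∀ i A, i < (D k).n → w i = A + 1 → i + 2 + A < (D k).n ∧ RetAt κ w i A := by
    intro k i A hi h
    obtain ⟨h1, h2⟩ := (hst k).ret i A hi (by rw [← hw k i hi]; exact h)
    exact ⟨h1, h2.congr h1 (hκ k) (hw k)⟩
  refine ⟨κ, w, ?_⟩
  constructor
  · intro i hi
    rw [hκ 0 i (by have := hnM 0; omega)]; exact (hst 0).two i hi
  · rw [hκ 0 M (by have := hnM 0; omega)]; exact (hst 0).one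
  · intro i h
    have h1 := hn1 (i + 1)
    rw [hκ (i + 1) i (by omega), hκ (i + 1) (i + 1) h1]
    exact (hst (i + 1)).nr i h1 (by rw [← hw (i + 1) i (by omega)]; exact h)
  · intro i A h
    exact (hret i i A (hn1 i) h).2
  · intro i
    have h1 := hn1 (i + 2)
    rw [sum_congr_lt (fun t ht => hw (i + 2) t (by omega))]
    exact (hst (i + 2)).qX i h1.le
  · intro m
    obtain ⟨i, h1, h2, h3, h4⟩ := (hst m).zero m (hn1 m)
    exact ⟨i, h1, h3, by rwa [hκ m i h2]⟩
  · intro N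
    have h1 := hn1 N
    refine ⟨(D N).n + 7 * (D N).j q N + 1, (D N).n, h1.le, ?_⟩
    rw [hw (N + 1) _ (by simp only [hD, stages]; omega)]
    exact nxtw_d rfl
  · intro b
    refine ⟨(D b).n, (D b).j q b, ?_, ?_, ?_, ?_⟩
    · unfold StD.j
      have : b * ((D b).n + 1) ≤
          (q + b) * (2 * (∑ i ∈ Finset.range (D b).n, (D b).w i) + ((D b).n + 1)) :=
        Nat.mul_le_mul (by omega) (by omega)
      omega
    · unfold StD.j; omega
    · intro i h1 h2
      rw [hκ (b + 1) i (by simp only [hD, stages] at h1 h2 ⊢; omega)]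
      exact nxt_b h1 h2
    · intro i h1 h2
      rw [hκ (b + 1) i (by simp only [hD, stages] at h1 h2 ⊢; omega)]
      exact nxt_c h1 h2
  · intro N
    exact ⟨(D N).n, (hn1 N).le, fun i hi A h => (hret N i A hi h).1⟩

end RCE

namespace RCE

/-! ### Part 2 : bimodal maps, itineraries and conjugacy -/

structure Top where
  F : ℝ → ℝ
  l : ℝ
  c : ℝ
  d : ℝ
  r : ℝ
  v : ℝ
  lc : l < c
  cd : c < d
  dr : d < r
  cont : ContinuousOn F (Icc l r)
  m0 : StrictMonoOn F (Icc l c)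
  m1 : StrictAntiOn F (Icc c d)
  m2 : StrictMonoOn F (Icc d r)
  Fl : F l = l
  Fc : F c = v
  Fd : F d = l
  Fr : F r = r
  vr : v ≤ r

def sh (s : ℕ → Fin 3) : ℕ → Fin 3 := fun i => s (i + 1)

def shn (n : ℕ) (s : ℕ → Fin 3) : ℕ → Fin 3 := fun i => s (n + i)

/-- Signed lexicographic order with first difference at `D`. -/
def sgnlt : ℕ → (ℕ → Fin 3) → (ℕ → Fin 3) → Prop
  | 0, s, t => s 0 < t 0
  | D + 1, s, t => s 0 = t 0 ∧ if s 0 = 1 then sgnlt D (sh t) (sh s) else sgnlt D (sh s) (sh t)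

lemma sgnlt_total : ∀ (D : ℕ) (s t : ℕ → Fin 3), (∀ i < D, s i = t i) → s D ≠ t D →
    sgnlt D s t ∨ sgnlt D t s
  | 0, s, t, _, h => by
    simp only [sgnlt]; exact lt_or_gt_of_ne h
  | D + 1, s, t, h, h' => by
    have h0 := h 0 (by omega)
    have := sgnlt_total D (sh s) (sh t) (fun i hi => h (i + 1) (by omega)) h'
    simp only [sgnlt, h0, true_and]
    by_cases h1 : t 0 = 1
    · simp only [h1, if_true]; exact this.symm
    · simp only [h1, if_false]; exact this

lemma sgnlt_agree : ∀ (D : ℕ) (s t : ℕ → Fin 3), sgnlt D s t → (∀ i < D, s i = t i) ∧ s D ≠ t D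
  | 0, s, t, h => by
    simp only [sgnlt] at h; exact ⟨by simp, h.ne⟩
  | D + 1, s, t, h => by
    simp only [sgnlt] at h
    obtain ⟨h0, h1⟩ := h
    have key : (∀ i < D, sh s i = sh t i) ∧ sh s D ≠ sh t D := by
      split_ifs at h1
      · obtain ⟨a, b⟩ := sgnlt_agree D _ _ h1
        exact ⟨fun i hi => (a i hi).symm, b.symm⟩
      · exact sgnlt_agree D _ _ h1
    refine ⟨?_, key.2⟩
    rintro (_ | i) hi
    · exact h0
    · exact key.1 i (by omega)

lemma exists_departure {s t : ℕ → Fin 3} (h : s ≠ t) : ∃ D, (∀ i < D, s i = t i) ∧ s D ≠ t D := by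
  classical
  have h' : ∃ D, s D ≠ t D := by
    by_contra hc; push Not at hc; exact h (funext hc)
  refine ⟨Nat.find h', fun i hi => ?_, Nat.find_spec h'⟩
  have := Nat.find_min h' hi
  simpa using this

namespace Top
variable (T : Top)

def lap (a : Fin 3) : Set ℝ :=
  if a = 0 then Icc T.l T.c else if a = 1 then Icc T.c T.d else Icc T.d T.r

@[simp] lemma lap0 : T.lap 0 = Icc T.l T.c := by simp [lap]
@[simp] lemma lap1 : T.lap 1 = Icc T.c T.d := by simp [lap]
@[simp] lemma lap2 : T.lap 2 = Icc T.d T.r := by simp [lap]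

lemma fin3 (a : Fin 3) : a = 0 ∨ a = 1 ∨ a = 2 := by
  fin_cases a <;> simp

lemma lap_sub (a : Fin 3) : T.lap a ⊆ Icc T.l T.r := by
  have h1 := T.lc; have h2 := T.cd; have h3 := T.dr
  rcases fin3 a with rfl | rfl | rfl
  · rw [lap0]; exact Icc_subset_Icc le_rfl (by linarith)
  · rw [lap1]; exact Icc_subset_Icc (by linarith) (by linarith)
  · rw [lap2]; exact Icc_subset_Icc (by linarith) le_rfl

lemma lap_closed (a : Fin 3) : IsClosed (T.lap a) := by
  rcases fin3 a with rfl | rfl | rfl <;> simp [isClosed_Icc]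

lemma lap_lt {a b : Fin 3} (h : a < b) {x y : ℝ} (hx : x ∈ T.lap a) (hy : y ∈ T.lap b) : x ≤ y := by
  have h2 := T.cd
  rcases fin3 a with rfl | rfl | rfl <;> rcases fin3 b with rfl | rfl | rfl <;>
    simp at h hx hy <;> first | linarith [hx.1, hx.2, hy.1, hy.2] | simp_all

lemma lap_cover {x : ℝ} (hx : x ∈ Icc T.l T.r) : ∃ a, x ∈ T.lap a := by
  by_cases h1 : x ≤ T.c
  · exact ⟨0, by rw [lap0]; exact ⟨hx.1, h1⟩⟩
  · by_cases h2 : x ≤ T.d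
    · exact ⟨1, by rw [lap1]; exact ⟨by linarith, h2⟩⟩
    · exact ⟨2, by rw [lap2]; exact ⟨by linarith, hx.2⟩⟩

lemma lap_inj (a : Fin 3) : InjOn T.F (T.lap a) := by
  rcases fin3 a with rfl | rfl | rfl
  · rw [lap0]; exact T.m0.injOn
  · rw [lap1]; exact T.m1.injOn
  · rw [lap2]; exact T.m2.injOn

lemma l_mem0 : T.l ∈ T.lap 0 := by rw [lap0]; exact ⟨le_rfl, T.lc.le⟩
lemma lap_nonempty (a : Fin 3) : (T.lap a).Nonempty := by
  rcases fin3 a with rfl | rfl | rfl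
  · exact ⟨T.l, T.l_mem0⟩
  · exact ⟨T.c, by rw [lap1]; exact ⟨le_rfl, T.cd.le⟩⟩
  · exact ⟨T.d, by rw [lap2]; exact ⟨le_rfl, T.dr.le⟩⟩

/-- top value of a lap -/
lemma maps_le {a : Fin 3} (ha : a ≠ 2) {x : ℝ} (hx : x ∈ T.lap a) : T.l ≤ T.F x ∧ T.F x ≤ T.v := by
  rcases fin3 a with rfl | rfl | rfl
  · rw [lap0] at hx
    have h1 := T.m0.monotoneOn (left_mem_Icc.2 T.lc.le) hx hx.1
    have h2 := T.m0.monotoneOn hx (right_mem_Icc.2 T.lc.le) hx.2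
    rw [T.Fl] at h1; rw [T.Fc] at h2; exact ⟨h1, h2⟩
  · rw [lap1] at hx
    have h1 := T.m1.antitoneOn (left_mem_Icc.2 T.cd.le) hx hx.1
    have h2 := T.m1.antitoneOn hx (right_mem_Icc.2 T.cd.le) hx.2
    rw [T.Fc] at h1; rw [T.Fd] at h2; exact ⟨h2, h1⟩
  · exact absurd rfl ha

lemma maps2 {x : ℝ} (hx : x ∈ T.lap 2) : T.l ≤ T.F x ∧ T.F x ≤ T.r := by
  rw [lap2] at hx
  have h1 := T.m2.monotoneOn (left_mem_Icc.2 T.dr.le) hx hx.1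
  have h2 := T.m2.monotoneOn hx (right_mem_Icc.2 T.dr.le) hx.2
  rw [T.Fd] at h1; rw [T.Fr] at h2; exact ⟨h1, h2⟩

lemma maps {x : ℝ} (hx : x ∈ Icc T.l T.r) : T.F x ∈ Icc T.l T.r := by
  obtain ⟨a, ha⟩ := T.lap_cover hx
  by_cases h : a = 2
  · subst h; exact T.maps2 ha
  · obtain ⟨h1, h2⟩ := T.maps_le h ha
    exact ⟨h1, h2.trans T.vr⟩

lemma maps_iter {x : ℝ} (hx : x ∈ Icc T.l T.r) (n : ℕ) : T.F^[n] x ∈ Icc T.l T.r := by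
  induction n with
  | zero => exact hx
  | succ n ih => rw [Function.iterate_succ_apply']; exact T.maps ih

lemma cont_iter (n : ℕ) : ContinuousOn (T.F^[n]) (Icc T.l T.r) := by
  induction n with
  | zero => exact continuousOn_id
  | succ n ih =>
    rw [Function.iterate_succ']
    exact T.cont.comp ih (fun x hx => T.maps_iter hx n)

lemma l_lt_v : T.l < T.v := by
  have := T.m0 (left_mem_Icc.2 T.lc.le) (right_mem_Icc.2 T.lc.le) T.lc
  rwa [T.Fl, T.Fc] at this

lemma v_mem : T.v ∈ Icc T.l T.r := ⟨T.l_lt_v.le, T.vr⟩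

lemma surj_lap (a : Fin 3) {z : ℝ} (hz : T.l ≤ z) (hz2 : z ≤ if a = 2 then T.r else T.v) :
    ∃ x ∈ T.lap a, T.F x = z := by
  rcases fin3 a with rfl | rfl | rfl
  · have := intermediate_value_Icc T.lc.le (T.cont.mono (by simpa using T.lap_sub 0))
    rw [T.Fl, T.Fc] at this
    obtain ⟨x, hx, h⟩ := this ⟨hz, by simpa using hz2⟩
    exact ⟨x, by simpa using hx, h⟩
  · have := intermediate_value_Icc' T.cd.le (T.cont.mono (by simpa using T.lap_sub 1))
    rw [T.Fd, T.Fc] at this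
    obtain ⟨x, hx, h⟩ := this ⟨hz, by simpa using hz2⟩
    exact ⟨x, by simpa using hx, h⟩
  · have := intermediate_value_Icc T.dr.le (T.cont.mono (by simpa using T.lap_sub 2))
    rw [T.Fd, T.Fr] at this
    obtain ⟨x, hx, h⟩ := this ⟨hz, by simpa using hz2⟩
    exact ⟨x, by simpa using hx, h⟩

/-- clamped chain -/
def Ch (s : ℕ → Fin 3) (n : ℕ) (y : ℕ → ℝ) : Prop :=
  (∀ i ≤ n, y i ∈ T.lap (s i)) ∧
    ∀ i < n, T.F (y i) = if s i = 2 then y (i + 1) else min (y (i + 1)) T.v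

/-- itinerary -/
def Orb (s : ℕ → Fin 3) (x : ℝ) : Prop := ∀ i, T.F^[i] x ∈ T.lap (s i)

variable {T}

lemma Orb.mem {s x} (h : T.Orb s x) : x ∈ Icc T.l T.r := T.lap_sub _ (h 0)

lemma Orb.shift {s x} (h : T.Orb s x) : T.Orb (sh s) (T.F x) := by
  intro i
  have := h (i + 1)
  rwa [Function.iterate_succ_apply] at this

lemma Orb.shiftn {s x} (h : T.Orb s x) (n : ℕ) : T.Orb (shn n s) (T.F^[n] x) := by
  intro i
  have := h (n + i)
  rwa [add_comm n i, Function.iterate_add_apply, add_comm i n] at this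

lemma orb_exists {x} (hx : x ∈ Icc T.l T.r) : ∃ s, T.Orb s x := by
  choose s hs using fun i => T.lap_cover (T.maps_iter hx i)
  exact ⟨s, hs⟩

lemma Orb.ch {s x} (h : T.Orb s x) (n : ℕ) : T.Ch s n (fun i => T.F^[i] x) := by
  refine ⟨fun i _ => h i, fun i _ => ?_⟩
  simp only [Function.iterate_succ_apply']
  split_ifs with h2
  · rfl
  · rw [min_eq_left (T.maps_le h2 (h i)).2]

lemma Ch.shift {s n y} (h : T.Ch s (n + 1) y) : T.Ch (sh s) n (fun i => y (i + 1)) :=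
  ⟨fun i hi => h.1 (i + 1) (by omega), fun i hi => h.2 (i + 1) (by omega)⟩

lemma Ch.shiftn {s n y} (m : ℕ) (h : T.Ch s (m + n) y) : T.Ch (shn m s) n (fun i => y (m + i)) :=
  ⟨fun i hi => h.1 (m + i) (by omega), fun i hi => h.2 (m + i) (by omega)⟩

lemma le_of_image {a : Fin 3} {x y : ℝ} (hx : x ∈ T.lap a) (hy : y ∈ T.lap a)
    (h : if a = 1 then T.F y ≤ T.F x else T.F x ≤ T.F y) : x ≤ y := by
  rcases fin3 a with rfl | rfl | rfl
  · rw [lap0] at hx hy; exact (T.m0.le_iff_le hx hy).1 (by simpa using h)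
  · rw [lap1] at hx hy; exact (T.m1.le_iff_ge hy hx).1 (by simpa using h)
  · rw [lap2] at hx hy; exact (T.m2.le_iff_le hx hy).1 (by simpa using h)

lemma ch_le (D : ℕ) : ∀ {s t : ℕ → Fin 3} {n n' : ℕ} {y z : ℕ → ℝ}, T.Ch s n y → T.Ch t n' z →
    D ≤ n → D ≤ n' → sgnlt D s t → y 0 ≤ z 0 := by
  induction D with
  | zero =>
    intro s t n n' y z hy hz _ _ h
    exact T.lap_lt h (hy.1 0 (by omega)) (hz.1 0 (by omega))
  | succ D ih =>
    intro s t n n' y z hy hz hn hn' h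
    obtain ⟨n, rfl⟩ : ∃ k, n = k + 1 := ⟨n - 1, by omega⟩
    obtain ⟨n', rfl⟩ : ∃ k, n' = k + 1 := ⟨n' - 1, by omega⟩
    simp only [sgnlt] at h
    obtain ⟨h0, h1⟩ := h
    have hy0 := hy.1 0 (by omega)
    have hz0 := hz.1 0 (by omega)
    have hFy := hy.2 0 (by omega)
    have hFz := hz.2 0 (by omega)
    rw [← h0] at hz0 hFz
    refine le_of_image hy0 hz0 ?_
    rw [hFy, hFz]
    by_cases hs : s 0 = 1
    · simp only [hs, if_true] at h1 ⊢
      have := ih hz.shift hy.shift (by omega) (by omega) h1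
      simp only [zero_add] at this ⊢
      rw [if_neg (by simp), if_neg (by simp)]
      exact min_le_min_right _ this
    · simp only [hs, if_false] at h1 ⊢
      have := ih hy.shift hz.shift (by omega) (by omega) h1
      simp only [zero_add] at this ⊢
      split_ifs
      · exact this
      · exact min_le_min_right _ this

lemma orb_le {D s t x y} (hx : T.Orb s x) (hy : T.Orb t y) (h : sgnlt D s t) : x ≤ y :=
  ch_le D (hx.ch D) (hy.ch D) le_rfl le_rfl h

variable (T) in
def Expansive : Prop := ∀ s x y, T.Orb s x → T.Orb s y → x = y

variable (T) in
/-- the critical value has itinerary `κ` and never hits a critical point -/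
structure Knd (κ : ℕ → Fin 3) : Prop where
  orb : T.Orb κ T.v
  nc : ∀ i, T.F^[i] T.v ≠ T.c
  nd : ∀ i, T.F^[i] T.v ≠ T.d

lemma lap_unique {a b : Fin 3} {x : ℝ} (ha : x ∈ T.lap a) (hb : x ∈ T.lap b) (hab : a < b) :
    (x = T.c ∧ a = 0 ∧ b = 1) ∨ (x = T.d ∧ a = 1 ∧ b = 2) := by
  have h2 := T.cd
  rcases fin3 a with rfl | rfl | rfl <;> rcases fin3 b with rfl | rfl | rfl <;>
    simp at ha hb hab
  · exact Or.inl ⟨le_antisymm ha.2 hb.1, rfl, rfl⟩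
  · linarith [ha.2, hb.1]
  · exact Or.inr ⟨le_antisymm ha.2 hb.1, rfl, rfl⟩

lemma Knd.unique {κ s} (h : T.Knd κ) (hs : T.Orb s T.v) : s = κ := by
  funext i
  by_contra hne
  rcases lt_or_gt_of_ne hne with hlt | hlt
  · rcases lap_unique (hs i) (h.orb i) hlt with ⟨h1, -⟩ | ⟨h1, -⟩
    · exact h.nc i h1
    · exact h.nd i h1
  · rcases lap_unique (h.orb i) (hs i) hlt with ⟨h1, -⟩ | ⟨h1, -⟩
    · exact h.nc i h1
    · exact h.nd i h1

lemma iter_l (i : ℕ) : T.F^[i] T.l = T.l := by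
  induction i with
  | zero => rfl
  | succ i ih => rw [Function.iterate_succ_apply, T.Fl, ih]

lemma orb_l : T.Orb (fun _ => 0) T.l := by
  intro i; rw [iter_l]; exact T.l_mem0

lemma l_unique {s} (hs : T.Orb s T.l) : s = fun _ => 0 := by
  funext i
  by_contra hne
  have h0 := hs i
  rw [iter_l] at h0
  rcases lap_unique T.l_mem0 h0 (Fin.pos_of_ne_zero hne) with ⟨h1, -⟩ | ⟨h1, -⟩
  · linarith [T.lc]
  · linarith [T.lc, T.cd]

/-- points that agree up to `D` and are equal at time `D` are equal -/
lemma eq_of_eq_at : ∀ (D : ℕ) {s t x y}, T.Orb s x → T.Orb t y → (∀ i < D, s i = t i) →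
    T.F^[D] x = T.F^[D] y → x = y
  | 0, s, t, x, y, _, _, _, h => h
  | D + 1, s, t, x, y, hx, hy, ha, h => by
    have h1 := eq_of_eq_at D hx.shift hy.shift (fun i hi => ha (i + 1) (by omega)) h
    have h0 := hy 0
    rw [← ha 0 (by omega)] at h0
    exact T.lap_inj _ (hx 0) h0 h1

def Adm (κ s : ℕ → Fin 3) : Prop := ∀ i, s i ≠ 2 → ∀ D, ¬ sgnlt D κ (shn (i + 1) s)

lemma Knd.adm {κ s x} (h : T.Knd κ) (hs : T.Orb s x) : Adm κ s := by
  intro i hi D hD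
  have h1 : T.F^[i + 1] x ≤ T.v := by
    rw [Function.iterate_succ_apply']; exact (T.maps_le hi (hs i)).2
  have h2 := orb_le h.orb (hs.shiftn (i + 1)) hD
  have h3 : T.F^[i + 1] x = T.v := le_antisymm h1 h2
  have h4 := hs.shiftn (i + 1)
  rw [h3] at h4
  have := h.unique h4
  rw [this] at hD
  exact (sgnlt_agree D _ _ hD).2 rfl

variable (T) in
lemma ch_exists (n : ℕ) : ∀ s, ∃ y, T.Ch s n y := by
  induction n with
  | zero =>
    intro s
    obtain ⟨x, hx⟩ := T.lap_nonempty (s 0)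
    refine ⟨fun _ => x, ?_, ?_⟩
    · intro i hi; obtain rfl : i = 0 := by omega
      exact hx
    · intro i hi; omega
  | succ n ih =>
    intro s
    obtain ⟨y, hy⟩ := ih (sh s)
    have hy0 := T.lap_sub _ (hy.1 0 (by omega))
    obtain ⟨x, hx, hFx⟩ := T.surj_lap (s 0)
      (z := if s 0 = 2 then y 0 else min (y 0) T.v)
      (by split_ifs
          · exact hy0.1
          · exact le_min hy0.1 T.l_lt_v.le)
      (by split_ifs
          · exact hy0.2
          · exact min_le_right _ _)
    refine ⟨fun i => Nat.casesOn i x y, ?_, ?_⟩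
    · rintro (_ | i) hi
      · exact hx
      · exact hy.1 i (by omega)
    · rintro (_ | i) hi
      · exact hFx
      · exact hy.2 i (by omega)

/-- finite realization -/
lemma fin_real {κ s} (h : T.Knd κ) (hs : Adm κ s) (n : ℕ) :
    ∃ x ∈ Icc T.l T.r, ∀ i ≤ n, T.F^[i] x ∈ T.lap (s i) := by
  classical
  obtain ⟨y, hy⟩ := T.ch_exists n s
  refine ⟨y 0, T.lap_sub _ (hy.1 0 (by omega)), ?_⟩
  -- orbit follows the chain until the first clamp
  have key : ∀ m ≤ n, (∀ i < m, s i ≠ 2 → y (i + 1) ≤ T.v) → T.F^[m] (y 0) = y m := by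
    intro m
    induction m with
    | zero => intro _ _; rfl
    | succ m ih =>
      intro hm hc
      rw [Function.iterate_succ_apply', ih (by omega) (fun i hi => hc i (by omega)),
        hy.2 m (by omega)]
      split_ifs with h2
      · rfl
      · exact min_eq_left (hc m (by omega) h2)
  by_cases hex : ∃ i, i < n ∧ s i ≠ 2 ∧ T.v < y (i + 1)
  · obtain ⟨h1, h2, h3⟩ := Nat.find_spec hex
    set i0 := Nat.find hex
    have hmin : ∀ i < i0, s i ≠ 2 → y (i + 1) ≤ T.v := by
      intro i hi hsi
      by_contra hcon
      exact Nat.find_min hex hi ⟨by omega, hsi, not_le.1 hcon⟩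
    have hv : T.F^[i0 + 1] (y 0) = T.v := by
      rw [Function.iterate_succ_apply', key i0 (by omega) hmin, hy.2 i0 h1, if_neg h2,
        min_eq_right h3.le]
    have hag : ∀ t, i0 + 1 + t ≤ n → s (i0 + 1 + t) = κ t := by
      by_contra hcon
      push Not at hcon
      let D := Nat.find hcon
      obtain ⟨hD1, hD2⟩ := Nat.find_spec hcon
      have hD3 : ∀ t < D, s (i0 + 1 + t) = κ t := by
        intro t ht
        by_contra hc
        exact Nat.find_min hcon ht ⟨by omega, hc⟩
      rcases sgnlt_total D (shn (i0 + 1) s) κ hD3 hD2 with hl | hl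
      · have e : i0 + 1 + (n - (i0 + 1)) = n := by omega
        have hc1 := Ch.shiftn (T := T) (s := s) (n := n - (i0 + 1)) (y := y) (i0 + 1)
          (by rw [e]; exact hy)
        have := ch_le D hc1 (h.orb.ch D) (by omega) le_rfl hl
        simp at this
        linarith
      · exact hs i0 h2 D hl
    intro i hi
    by_cases hii : i ≤ i0
    · rw [key i hi (fun k hk => hmin k (by omega))]; exact hy.1 i hi
    · obtain ⟨t, rfl⟩ : ∃ t, i = i0 + 1 + t := ⟨i - (i0 + 1), by omega⟩
      rw [hag t hi, add_comm (i0 + 1) t, Function.iterate_add_apply, hv]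
      exact h.orb t
  · push Not at hex
    intro i hi
    rw [key i hi (fun k hk h2 => hex k (by omega) h2)]
    exact hy.1 i hi

lemma realize {κ s} (h : T.Knd κ) (hs : Adm κ s) : ∃ x, T.Orb s x := by
  let J : ℕ → Set ℝ := fun n => {x ∈ Icc T.l T.r | ∀ i ≤ n, T.F^[i] x ∈ T.lap (s i)}
  have hJc : ∀ n, IsClosed (J n) := by
    intro n
    have : J n = ⋂ i ∈ Iic n, Icc T.l T.r ∩ (T.F^[i]) ⁻¹' (T.lap (s i)) := by
      ext x
      simp only [J, mem_setOf_eq, mem_iInter, mem_inter_iff, mem_preimage, mem_Iic]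
      constructor
      · rintro ⟨a, b⟩ i hi; exact ⟨a, b i hi⟩
      · intro a; exact ⟨(a 0 (by omega)).1, fun i hi => (a i hi).2⟩
    rw [this]
    refine isClosed_biInter fun i _ => ?_
    exact (T.cont_iter i).preimage_isClosed_of_isClosed isClosed_Icc (T.lap_closed _)
  have hne : (⋂ n, J n).Nonempty := by
    refine IsCompact.nonempty_iInter_of_sequence_nonempty_isCompact_isClosed J ?_ ?_ ?_ hJc
    · intro n x hx; exact ⟨hx.1, fun i hi => hx.2 i (by omega)⟩
    · intro n
      obtain ⟨x, hx, hx2⟩ := fin_real h hs n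
      exact ⟨x, hx, hx2⟩
    · exact isCompact_Icc.of_isClosed_subset (hJc 0) (fun x hx => hx.1)
  obtain ⟨x, hx⟩ := hne
  rw [mem_iInter] at hx
  exact ⟨x, fun i => (hx i).2 i le_rfl⟩

lemma eq_c_of {a : Fin 3} (ha : a = 0 ∨ a = 1) {x} (hx : x ∈ T.lap a) (h : T.F x = T.v) : x = T.c := by
  have hc : T.c ∈ T.lap a := by
    rcases ha with rfl | rfl
    · rw [lap0]; exact ⟨T.lc.le, le_rfl⟩
    · rw [lap1]; exact ⟨le_rfl, T.cd.le⟩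
  exact T.lap_inj a hx hc (by rw [h, T.Fc])

lemma eq_d_of {a : Fin 3} (ha : a = 1 ∨ a = 2) {x} (hx : x ∈ T.lap a) (h : T.F x = T.l) : x = T.d := by
  have hc : T.d ∈ T.lap a := by
    rcases ha with rfl | rfl
    · rw [lap1]; exact ⟨T.cd.le, le_rfl⟩
    · rw [lap2]; exact ⟨le_rfl, T.dr.le⟩
  exact T.lap_inj a hx hc (by rw [h, T.Fd])

/-- order transport -/
lemma transport {T' : Top} {κ} (h : T.Knd κ) (h' : T'.Knd κ) (hE : T.Expansive)
    {s t x x2 y y2} (hx : T.Orb s x) (hx2 : T.Orb t x2) (hy : T'.Orb s y) (hy2 : T'.Orb t y2)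
    (hlt : x < x2) : y < y2 := by
  have hst : s ≠ t := by
    rintro rfl; exact hlt.ne (hE s x x2 hx hx2)
  obtain ⟨D, hD1, hD2⟩ := exists_departure hst
  have hle : y ≤ y2 := by
    rcases sgnlt_total D s t hD1 hD2 with hl | hl
    · exact orb_le hy hy2 hl
    · exact absurd (orb_le hx2 hx hl) (not_le.2 hlt)
  refine lt_of_le_of_ne hle ?_
  rintro rfl
  apply hlt.ne
  refine eq_of_eq_at D hx hx2 hD1 ?_
  have hss := (hy.shiftn D).shift
  have htt := (hy2.shiftn D).shift
  have hsx := (hx.shiftn D).shift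
  have htx := (hx2.shiftn D).shift
  have main : (T'.F^[D] y = T'.c ∧ (s D = 0 ∨ s D = 1) ∧ (t D = 0 ∨ t D = 1)) ∨
      (T'.F^[D] y = T'.d ∧ (s D = 1 ∨ s D = 2) ∧ (t D = 1 ∨ t D = 2)) := by
    rcases lt_or_gt_of_ne hD2 with hl | hl
    · rcases lap_unique (hy D) (hy2 D) hl with ⟨a, b, c⟩ | ⟨a, b, c⟩
      · exact Or.inl ⟨a, Or.inl b, Or.inr c⟩
      · exact Or.inr ⟨a, Or.inl b, Or.inr c⟩
    · rcases lap_unique (hy2 D) (hy D) hl with ⟨a, b, c⟩ | ⟨a, b, c⟩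
      · exact Or.inl ⟨a, Or.inr c, Or.inl b⟩
      · exact Or.inr ⟨a, Or.inr c, Or.inl b⟩
  rcases main with ⟨a, b, c⟩ | ⟨a, b, c⟩
  · rw [a, T'.Fc] at hss htt
    rw [h'.unique hss] at hsx
    rw [h'.unique htt] at htx
    rw [eq_c_of b (hx D) (hE _ _ _ hsx h.orb), eq_c_of c (hx2 D) (hE _ _ _ htx h.orb)]
  · rw [a, T'.Fd] at hss htt
    rw [l_unique hss] at hsx
    rw [l_unique htt] at htx
    rw [eq_d_of b (hx D) (hE _ _ _ hsx orb_l), eq_d_of c (hx2 D) (hE _ _ _ htx orb_l)]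

theorem conj {T' : Top} {κ} (h : T.Knd κ) (h' : T'.Knd κ) (hE : T.Expansive)
    (hE' : T'.Expansive) : ∃ φ : ℝ → ℝ, StrictMonoOn φ (Icc T.l T.r) ∧
      φ '' Icc T.l T.r = Icc T'.l T'.r ∧ ∀ x ∈ Icc T.l T.r, φ (T.F x) = T'.F (φ x) := by
  have ex : ∀ x, ∃ y, x ∈ Icc T.l T.r → ∃ s, T.Orb s x ∧ T'.Orb s y := by
    intro x
    by_cases hx : x ∈ Icc T.l T.r
    · obtain ⟨s, hs⟩ := orb_exists hx
      obtain ⟨y, hy⟩ := realize h' (h.adm hs)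
      exact ⟨y, fun _ => ⟨s, hs, hy⟩⟩
    · exact ⟨0, fun h => absurd h hx⟩
  choose φ hφ using ex
  have uniq : ∀ x s y, T.Orb s x → T'.Orb s y → φ x = y := by
    intro x s y hx hy
    obtain ⟨t, ht, ht'⟩ := hφ x hx.mem
    rcases lt_trichotomy (φ x) y with hl | hl | hl
    · exact absurd (transport h' h hE' ht' hy ht hx hl) (lt_irrefl _)
    · exact hl
    · exact absurd (transport h' h hE' hy ht' hx ht hl) (lt_irrefl _)
  refine ⟨φ, ?_, ?_, ?_⟩
  · intro x hx x2 hx2 hlt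
    obtain ⟨s, hs, hs'⟩ := hφ x hx
    obtain ⟨t, ht, ht'⟩ := hφ x2 hx2
    exact transport h h' hE hs ht hs' ht' hlt
  · apply Subset.antisymm
    · rintro _ ⟨x, hx, rfl⟩
      obtain ⟨s, hs, hs'⟩ := hφ x hx
      exact hs'.mem
    · intro y hy
      obtain ⟨s, hs⟩ := orb_exists hy
      obtain ⟨x, hx⟩ := realize h (h'.adm hs)
      exact ⟨x, hx.mem, uniq x s y hx hs⟩
  · intro x hx
    obtain ⟨s, hs, hs'⟩ := hφ x hx
    exact uniq _ _ _ hs.shift hs'.shift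

end Top
end RCE

namespace RCE

/-! ### Part 3 : expansiveness from an adapted metric -/

structure Met (T : Top) where
  Φ : ℝ → ℝ
  lo : Fin 3 → Fin 3 → ℝ
  hi : Fin 3 → Fin 3 → ℝ
  m : ℝ
  Mx : ℝ
  E : ℝ
  c0 : ℝ
  a : ℝ
  σ0 : ℝ
  Tot : ℝ
  mono : StrictMonoOn Φ (Icc T.l T.r)
  LO : ∀ i j x y, ¬(i ≠ 2 ∧ j = 2) → x ∈ T.lap i → y ∈ T.lap i → T.F x ∈ T.lap j →
    T.F y ∈ T.lap j → lo i j * |Φ x - Φ y| ≤ |Φ (T.F x) - Φ (T.F y)|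
  HI : ∀ i j x y, okp i j → x ∈ T.lap i → y ∈ T.lap i → T.F x ∈ T.lap j →
    T.F y ∈ T.lap j → |Φ (T.F x) - Φ (T.F y)| ≤ hi i j * |Φ x - Φ y|
  GLip : ∀ i x y, x ∈ T.lap i → y ∈ T.lap i → |Φ (T.F x) - Φ (T.F y)| ≤ Mx * |Φ x - Φ y|
  RET : ∀ i x y τ, i ≠ 2 → x ∈ T.lap i → y ∈ T.lap i → T.F x ∈ T.lap 2 → T.F y ∈ T.lap 2 →
    0 ≤ τ → τ ≤ Φ T.v - Φ (T.F x) → τ ≤ Φ T.v - Φ (T.F y) →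
    min m (E * τ ^ a) * |Φ x - Φ y| ≤ |Φ (T.F x) - Φ (T.F y)|
  TOT : ∀ i x y, i ≠ 2 → x ∈ T.lap i → y ∈ T.lap i → T.F x ∈ T.lap 2 → T.F y ∈ T.lap 2 →
    |Φ x - Φ y| ≤ Tot
  g1 : c0 ≤ Φ T.c - Φ T.l
  g2 : c0 ≤ Φ T.d - Φ T.c
  g3 : 3 * c0 ≤ Φ T.v - Φ T.d
  g4 : ∀ x, x ∈ Icc T.l T.d → T.F x ≤ T.d → c0 ≤ |Φ x - Φ T.c|
  m1 : 1 < m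
  lo_m : ∀ i j, ¬(i ≠ 2 ∧ j = 2) → m ≤ lo i j
  hi1 : ∀ i j, okp i j → 1 ≤ hi i j
  lohi : ∀ i j, okp i j → σ0 ^ 2 * hi i j ^ a ≤ lo i j
  σ1 : 1 < σ0
  a0 : 0 < a
  a1 : a ≤ 1
  c0p : 0 < c0
  c01 : c0 ≤ 1
  Mx1 : 1 ≤ Mx
  Tot1 : 1 ≤ Tot
  hE : m * Mx ^ 3 * Tot / c0 ^ 2 ≤ E

namespace Met
variable {T : Top} (μ : Met T)

def C2 : ℝ := μ.σ0 ^ 2 * μ.Mx / μ.c0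

lemma Mxp : 0 < μ.Mx := lt_of_lt_of_le one_pos μ.Mx1

lemma Mx_le_C2 : μ.Mx ≤ μ.C2 := by
  have h1 := μ.σ1; have h2 := μ.c0p; have h3 := μ.c01; have h4 := μ.Mx1
  unfold C2
  rw [le_div_iff₀ h2]
  have : 1 ≤ μ.σ0 ^ 2 := one_le_pow₀ h1.le
  nlinarith

lemma C2_1 : 1 ≤ μ.C2 := μ.Mx1.trans μ.Mx_le_C2
lemma C2p : 0 < μ.C2 := lt_of_lt_of_le one_pos μ.C2_1

lemma Ebig : μ.m * μ.Mx ^ 3 * μ.Tot ≤ μ.E * μ.c0 ^ 2 := by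
  have := μ.hE
  rwa [div_le_iff₀ (by have := μ.c0p; positivity)] at this

lemma E1 : 1 ≤ μ.E := by
  have h := μ.Ebig
  have h1 := μ.m1; have h2 := μ.c0p; have h3 := μ.c01; have h4 := μ.Mx1; have h5 := μ.Tot1
  have h6 : 1 ≤ μ.Mx ^ 3 := one_le_pow₀ h4
  have h7 : μ.c0 ^ 2 ≤ 1 := pow_le_one₀ h2.le h3
  have h8 : 1 ≤ μ.m * μ.Mx ^ 3 := by nlinarith
  have h9 : 1 ≤ μ.m * μ.Mx ^ 3 * μ.Tot := by nlinarith
  by_contra hc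
  push Not at hc
  have : μ.E * μ.c0 ^ 2 < 1 := by
    have : 0 < μ.c0 ^ 2 := by positivity
    nlinarith
  linarith

lemma monoL {x y : ℝ} (hx : x ∈ Icc T.l T.r) (hy : y ∈ Icc T.l T.r) (h : x ≤ y) : μ.Φ x ≤ μ.Φ y :=
  μ.mono.monotoneOn hx hy h

variable {κ : ℕ → Fin 3} {wt : ℕ → ℕ} {M q : ℕ}

lemma c_mem : T.c ∈ Icc T.l T.r := ⟨T.lc.le, (T.cd.trans T.dr).le⟩
lemma d_mem : T.d ∈ Icc T.l T.r := ⟨(T.lc.trans T.cd).le, T.dr.le⟩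
lemma l_mem : T.l ∈ Icc T.l T.r := ⟨le_rfl, (T.lc.trans (T.cd.trans T.dr)).le⟩

/-- iterated global Lipschitz bound -/
lemma GLipn : ∀ (n : ℕ) (x y : ℝ), (∀ t < n, ∃ b, T.F^[t] x ∈ T.lap b ∧ T.F^[t] y ∈ T.lap b) →
    |μ.Φ (T.F^[n] x) - μ.Φ (T.F^[n] y)| ≤ μ.Mx ^ n * |μ.Φ x - μ.Φ y|
  | 0, x, y, _ => by simp
  | n + 1, x, y, h => by
    have h1 := GLipn n x y (fun t ht => h t (by omega))
    obtain ⟨b, hb1, hb2⟩ := h n (by omega)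
    have h2 := μ.GLip b _ _ hb1 hb2
    rw [Function.iterate_succ_apply', Function.iterate_succ_apply']
    calc _ ≤ _ := h2
      _ ≤ μ.Mx * (μ.Mx ^ n * |μ.Φ x - μ.Φ y|) := by gcongr; exact μ.Mxp.le
      _ = _ := by ring

/-- distance between points in lap 0 and lap 1/2 -/
lemma sepc_right {x y : ℝ} (hx : x ∈ Icc T.l T.r) (hy : y ∈ Icc T.l T.r) (h1 : x ≤ T.c)
    (h2 : T.c ≤ y) : |μ.Φ x - μ.Φ T.c| ≤ |μ.Φ x - μ.Φ y| ∧ |μ.Φ y - μ.Φ T.c| ≤ |μ.Φ x - μ.Φ y| := by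
  have a1 := μ.monoL hx c_mem h1
  have a2 := μ.monoL c_mem hy h2
  rw [abs_of_nonpos (by linarith : μ.Φ x - μ.Φ T.c ≤ 0),
    abs_of_nonpos (by linarith : μ.Φ x - μ.Φ y ≤ 0),
    abs_of_nonneg (by linarith : 0 ≤ μ.Φ y - μ.Φ T.c)]
  constructor <;> linarith

lemma sepd_right {x y : ℝ} (hx : x ∈ Icc T.l T.r) (hy : y ∈ Icc T.l T.r) (h1 : x ≤ T.d)
    (h2 : T.d ≤ y) : |μ.Φ x - μ.Φ T.d| ≤ |μ.Φ x - μ.Φ y| ∧ |μ.Φ y - μ.Φ T.d| ≤ |μ.Φ x - μ.Φ y| := by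
  have a1 := μ.monoL hx d_mem h1
  have a2 := μ.monoL d_mem hy h2
  rw [abs_of_nonpos (by linarith : μ.Φ x - μ.Φ T.d ≤ 0),
    abs_of_nonpos (by linarith : μ.Φ x - μ.Φ y ≤ 0),
    abs_of_nonneg (by linarith : 0 ≤ μ.Φ y - μ.Φ T.d)]
  constructor <;> linarith

/-- if `F x` is not in lap 0 interior, `x` is far from `d` -/
lemma far_d {i : Fin 3} (hi : i = 1 ∨ i = 2) {x : ℝ} (hx : x ∈ T.lap i) (h : T.c ≤ T.F x) :
    μ.c0 ≤ μ.Mx * |μ.Φ x - μ.Φ T.d| := by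
  have hd : T.d ∈ T.lap i := by
    rcases hi with rfl | rfl
    · rw [Top.lap1]; exact ⟨T.cd.le, le_rfl⟩
    · rw [Top.lap2]; exact ⟨le_rfl, T.dr.le⟩
  have h1 := μ.GLip i x T.d hx hd
  rw [T.Fd] at h1
  have h2 := μ.monoL c_mem (T.maps (T.lap_sub _ hx)) h
  have h3 := μ.g1
  have h4 := le_abs_self (μ.Φ (T.F x) - μ.Φ T.l)
  linarith

/-- far from `d` when followed by a finite run of zeros -/
lemma far_d_run {i : Fin 3} (hi : i = 1 ∨ i = 2) {x : ℝ} (hx : x ∈ T.lap i) (N : ℕ)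
    (hz : ∀ t < N, T.F^[t + 1] x ∈ T.lap 0) (h : T.c ≤ T.F^[N + 1] x) :
    μ.c0 ≤ μ.Mx ^ (N + 1) * |μ.Φ x - μ.Φ T.d| := by
  have hd : T.d ∈ T.lap i := by
    rcases hi with rfl | rfl
    · rw [Top.lap1]; exact ⟨T.cd.le, le_rfl⟩
    · rw [Top.lap2]; exact ⟨le_rfl, T.dr.le⟩
  have h1 := μ.GLipn (N + 1) x T.d (by
    rintro (_ | t) ht
    · exact ⟨i, hx, hd⟩
    · refine ⟨0, hz t (by omega), ?_⟩
      rw [Function.iterate_succ_apply, T.Fd, Top.iter_l]; exact T.l_mem0)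
  rw [Function.iterate_succ_apply _ _ T.d, T.Fd, Top.iter_l] at h1
  have h2 := μ.monoL c_mem (T.maps_iter (T.lap_sub _ hx) _) h
  have h3 := μ.g1
  have h4 := le_abs_self (μ.Φ (T.F^[N + 1] x) - μ.Φ T.l)
  linarith

/-- refined version with rate `hi 0 0` -/
lemma far_d_run' {x : ℝ} (hx : x ∈ T.lap 2) (N : ℕ)
    (hz : ∀ t < N + 1, T.F^[t + 1] x ∈ T.lap 0) (h : T.c ≤ T.F^[N + 2] x) :
    μ.c0 ≤ μ.Mx ^ 2 * (μ.hi 0 0) ^ N * |μ.Φ x - μ.Φ T.d| := by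
  have hd : T.d ∈ T.lap 2 := by rw [Top.lap2]; exact ⟨le_rfl, T.dr.le⟩
  have h1 := μ.GLip 2 x T.d hx hd
  rw [T.Fd] at h1
  have hh : 1 ≤ μ.hi 0 0 := μ.hi1 0 0 (by simp [okp])
  have step : ∀ k ≤ N, |μ.Φ (T.F^[k + 1] x) - μ.Φ T.l| ≤
      (μ.hi 0 0) ^ k * (μ.Mx * |μ.Φ x - μ.Φ T.d|) := by
    intro k
    induction k with
    | zero => intro _; simpa using h1
    | succ k ih =>
      intro hk
      have h5 := hz k (by omega)
      have h6 := hz (k + 1) (by omega)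
      rw [Function.iterate_succ_apply'] at h6
      have h2 := μ.HI 0 0 (T.F^[k + 1] x) T.l (by simp [okp]) h5 T.l_mem0 h6
        (by rw [T.Fl]; exact T.l_mem0)
      rw [T.Fl, ← Function.iterate_succ_apply' T.F (k + 1) x] at h2
      calc _ ≤ _ := h2
        _ ≤ μ.hi 0 0 * ((μ.hi 0 0) ^ k * (μ.Mx * |μ.Φ x - μ.Φ T.d|)) := by
          gcongr; exact ih (by omega)
        _ = _ := by ring
  have h2 := step N le_rfl
  have h5 := hz N (by omega)
  have h3 := μ.GLip 0 _ T.l h5 T.l_mem0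
  rw [T.Fl, ← Function.iterate_succ_apply' T.F (N + 1) x] at h3
  have h6 := μ.monoL c_mem (T.maps_iter (T.lap_sub _ hx) (N + 2)) h
  have h7 := μ.g1
  have h4 := le_abs_self (μ.Φ (T.F^[N + 2] x) - μ.Φ T.l)
  have h8 : μ.Mx * |μ.Φ (T.F^[N + 1] x) - μ.Φ T.l| ≤
      μ.Mx * ((μ.hi 0 0) ^ N * (μ.Mx * |μ.Φ x - μ.Φ T.d|)) := by
    gcongr; exact μ.Mxp.le
  calc μ.c0 ≤ μ.Mx * ((μ.hi 0 0) ^ N * (μ.Mx * |μ.Φ x - μ.Φ T.d|)) := by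
        linarith
    _ = _ := by ring

variable (hk : Kn M q κ wt) (ho : T.Orb κ T.v)
include hk ho

lemma Wmem (i : ℕ) : T.F^[i] T.v ∈ Icc T.l T.r := T.maps_iter T.v_mem i

/-- a point following the image of a return -/
lemma depth {j A : ℕ} (hj : wt j = A + 1) {z : ℝ}
    (hz : ∀ t ≤ A, T.F^[t] z ∈ T.lap (κ (j + 1 + t))) : μ.c0 ≤ μ.Mx ^ A * |μ.Φ T.v - μ.Φ z| := by
  have hr := hk.ret j A hj
  have h1 := μ.GLipn A T.v z (by
    intro t ht
    have := hz t ht.le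
    rw [(hr.agr t ht).1] at this
    exact ⟨κ t, ho t, this⟩)
  refine le_trans ?_ h1
  have h2 := hz A le_rfl
  rw [hr.e0, Top.lap0] at h2
  have h3 := ho A
  rw [hr.k0, Top.lap1] at h3
  have h4 := ho (A + 1)
  rw [hr.k1, Top.lap1, Function.iterate_succ_apply'] at h4
  have h5 := μ.g4 _ ⟨T.lc.le.trans h3.1, h3.2⟩ h4.2
  have h6 := (μ.sepc_right ⟨h2.1, h2.2.trans (T.cd.trans T.dr).le⟩ (Wmem hk ho A) h2.2 h3.1).2
  rw [abs_sub_comm (μ.Φ (T.F^[A] T.v))]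
  linarith

/-- distance of the critical orbit to `c` at a return -/
lemma far_c_ret {j A : ℕ} (hj : wt j = A + 1) :
    μ.c0 ≤ μ.Mx ^ (A + 1) * |μ.Φ (T.F^[j] T.v) - μ.Φ T.c| := by
  have h1 := μ.depth hk ho hj (z := T.F^[j + 1] T.v) (by
    intro t _
    have := ho (j + 1 + t)
    rwa [add_comm (j + 1) t, Function.iterate_add_apply, add_comm t (j + 1)] at this)
  have hr := hk.ret j A hj
  have h2 := ho j
  rw [hr.h1] at h2
  have h3 := μ.GLip 1 (T.F^[j] T.v) T.c h2 (by rw [Top.lap1]; exact ⟨le_rfl, T.cd.le⟩)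
  rw [T.Fc, ← Function.iterate_succ_apply' T.F j T.v, abs_sub_comm] at h3
  have : 0 < μ.Mx ^ A := pow_pos μ.Mxp _
  calc μ.c0 ≤ _ := h1
    _ ≤ μ.Mx ^ A * (μ.Mx * |μ.Φ (T.F^[j] T.v) - μ.Φ T.c|) := by gcongr
    _ = _ := by ring

lemma sep0 {D : ℕ} (h0 : κ D = 0) {y : ℝ} {b : Fin 3} (hy : y ∈ T.lap b) (hb : b ≠ 0) :
    μ.c0 ≤ |μ.Φ (T.F^[D] T.v) - μ.Φ y| := by
  have h1 := ho D
  rw [h0, Top.lap0] at h1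
  have hw : wt D = 0 := by
    by_contra hw
    have := (hk.ret D (wt D - 1) (by omega)).h1
    rw [h0] at this; simp at this
  have h2 := ho (D + 1)
  rw [Function.iterate_succ_apply'] at h2
  have h3 : T.F (T.F^[D] T.v) ≤ T.d := by
    have := hk.nr D hw
    rw [h0] at this
    simp [okp] at this
    have hcd := T.cd
    rcases this with h | h
    · rw [h, Top.lap0] at h2; linarith [h2.2]
    · rw [h, Top.lap1] at h2; exact h2.2
  have h4 := μ.g4 _ ⟨h1.1, h1.2.trans T.cd.le⟩ h3
  have hcy : T.c ≤ y := by
    have hcd := T.cd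
    rcases Top.fin3 b with rfl | rfl | rfl
    · exact absurd rfl hb
    · rw [Top.lap1] at hy; exact hy.1
    · rw [Top.lap2] at hy; linarith [hy.1]
  have := (μ.sepc_right (Wmem hk ho D) (T.lap_sub _ hy) h1.2 hcy).1
  linarith

lemma sep2 {D : ℕ} (h0 : κ D = 2) {y : ℝ} {b : Fin 3} (hy : y ∈ T.lap b) (hb : b ≠ 2) :
    μ.c0 ≤ μ.Mx * |μ.Φ (T.F^[D] T.v) - μ.Φ y| := by
  have h1 := ho D
  rw [h0] at h1
  have hw : wt D = 0 := by
    by_contra hw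
    have := (hk.ret D (wt D - 1) (by omega)).h1
    rw [h0] at this; simp at this
  have h2 := ho (D + 1)
  rw [Function.iterate_succ_apply'] at h2
  have h3 : T.c ≤ T.F (T.F^[D] T.v) := by
    have := hk.nr D hw
    rw [h0] at this
    simp [okp] at this
    have hcd := T.cd
    rcases this with h | h
    · rw [h, Top.lap2] at h2; linarith [h2.1]
    · rw [h, Top.lap1] at h2; exact h2.1
  have h4 := μ.far_d (Or.inr rfl) h1 h3
  rw [Top.lap2] at h1
  have hcy : y ≤ T.d := by
    have hcd := T.cd
    rcases Top.fin3 b with rfl | rfl | rfl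
    · rw [Top.lap0] at hy; linarith [hy.2]
    · rw [Top.lap1] at hy; exact hy.2
    · exact absurd rfl hb
  have := (μ.sepd_right (T.lap_sub _ hy) (Wmem hk ho D) hcy h1.1).2
  rw [abs_sub_comm (μ.Φ y)] at this
  have h5 : μ.Mx * |μ.Φ (T.F^[D] T.v) - μ.Φ T.d| ≤ μ.Mx * |μ.Φ (T.F^[D] T.v) - μ.Φ y| := by
    gcongr; exact μ.Mxp.le
  linarith

lemma sep10 {D : ℕ} (h0 : κ D = 1) {y : ℝ} (hy : y ∈ T.lap 0) :
    μ.c0 ≤ μ.Mx ^ (wt D) * |μ.Φ (T.F^[D] T.v) - μ.Φ y| := by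
  have h1 := ho D
  rw [h0, Top.lap1] at h1
  rw [Top.lap0] at hy
  have hcy := (μ.sepc_right ⟨hy.1, hy.2.trans (T.cd.trans T.dr).le⟩ (Wmem hk ho D) hy.2 h1.1).2
  rw [abs_sub_comm (μ.Φ y)] at hcy
  rcases Nat.eq_zero_or_pos (wt D) with hw | hw
  · rw [hw, pow_zero, one_mul]
    have h2 := ho (D + 1)
    rw [Function.iterate_succ_apply'] at h2
    have h3 : T.F (T.F^[D] T.v) ≤ T.d := by
      have := hk.nr D hw
      rw [h0] at this
      simp [okp] at this
      have hcd := T.cd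
      rcases this with h | h
      · rw [h, Top.lap1] at h2; exact h2.2
      · rw [h, Top.lap0] at h2; linarith [h2.2]
    have h4 := μ.g4 _ ⟨T.lc.le.trans h1.1, h1.2⟩ h3
    linarith
  · have h2 := μ.far_c_ret hk ho (j := D) (A := wt D - 1) (by omega)
    rw [show wt D - 1 + 1 = wt D by omega] at h2
    have : μ.Mx ^ wt D * |μ.Φ (T.F^[D] T.v) - μ.Φ T.c| ≤
        μ.Mx ^ wt D * |μ.Φ (T.F^[D] T.v) - μ.Φ y| := by
      have := pow_pos μ.Mxp (wt D)
      gcongr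
    linarith

lemma sep12 {D N : ℕ} (h0 : κ D = 1) {y : ℝ} (hy : y ∈ T.lap 2) (hz : ∀ t < N, κ (D + 1 + t) = 0)
    (hN : κ (D + 1 + N) ≠ 0) : μ.c0 ≤ μ.Mx ^ (N + 1) * |μ.Φ (T.F^[D] T.v) - μ.Φ y| := by
  have h1 := ho D
  rw [h0] at h1
  have h4 := μ.far_d_run (Or.inl rfl) h1 N (by
      intro t ht
      rw [← Function.iterate_add_apply, ← hz t ht, show t + 1 + D = D + 1 + t by ring]
      exact ho _) (by
      rw [← Function.iterate_add_apply, show N + 1 + D = D + 1 + N by ring]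
      have := ho (D + 1 + N)
      have hcd := T.cd
      rcases Top.fin3 (κ (D + 1 + N)) with h | h | h
      · exact absurd h hN
      · rw [h, Top.lap1] at this; exact this.1
      · rw [h, Top.lap2] at this; linarith [this.1])
  rw [Top.lap1] at h1
  rw [Top.lap2] at hy
  have := (μ.sepd_right (Wmem hk ho D) ⟨(T.lc.trans T.cd).le.trans hy.1, hy.2⟩ h1.2 hy.1).1
  have h5 : μ.Mx ^ (N + 1) * |μ.Φ (T.F^[D] T.v) - μ.Φ T.d| ≤
      μ.Mx ^ (N + 1) * |μ.Φ (T.F^[D] T.v) - μ.Φ y| := by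
    have := pow_pos μ.Mxp (N + 1)
    gcongr
  linarith

end Met
end RCE

namespace RCE
namespace Met
variable {T : Top} (μ : Met T) {κ : ℕ → Fin 3} {wt : ℕ → ℕ} {M q : ℕ}

/-! ### Part 4 : expansiveness, continued -/

def X (wt : ℕ → ℕ) (n : ℕ) : ℕ := ∑ j ∈ Finset.range n, wt j

lemma X_mono (wt : ℕ → ℕ) {a b : ℕ} (h : a ≤ b) : X wt a ≤ X wt b :=
  Finset.sum_le_sum_of_subset (Finset.range_mono h)

lemma X_single (wt : ℕ → ℕ) {j n : ℕ} (h : j < n) : wt j ≤ X wt n :=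
  Finset.single_le_sum (f := wt) (fun _ _ => Nat.zero_le _) (Finset.mem_range.2 h)

def gf (κ : ℕ → Fin 3) (wt : ℕ → ℕ) (j : ℕ) : ℝ :=
  if wt j = 0 then μ.lo (κ j) (κ (j + 1)) else μ.c0 / μ.Mx ^ (wt j - 1)

def hf (κ : ℕ → Fin 3) (wt : ℕ → ℕ) (j : ℕ) : ℝ :=
  if wt j = 0 then μ.hi (κ j) (κ (j + 1)) else μ.Mx

def G (κ : ℕ → Fin 3) (wt : ℕ → ℕ) (n : ℕ) : ℝ := ∏ j ∈ Finset.range n, μ.gf κ wt j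
def H (κ : ℕ → Fin 3) (wt : ℕ → ℕ) (n : ℕ) : ℝ := ∏ j ∈ Finset.range n, μ.hf κ wt j

lemma okp_nr {a b : Fin 3} (h : okp a b) : ¬ (a ≠ 2 ∧ b = 2) := by
  rcases Top.fin3 a with rfl | rfl | rfl <;> rcases Top.fin3 b with rfl | rfl | rfl <;>
    simp [okp] at h ⊢

lemma pow_rpow_le_one {t : ℝ} (h0 : 0 ≤ t) (h1 : t ≤ 1) : t ≤ t ^ μ.a := by
  rcases h0.eq_or_lt with rfl | h
  · exact Real.rpow_nonneg le_rfl _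
  · have := Real.rpow_le_rpow_of_exponent_ge h h1 μ.a1
    rwa [Real.rpow_one] at this

lemma Ec0 : μ.m ≤ μ.E * μ.c0 := by
  have h := μ.Ebig
  have h1 := μ.m1; have h2 := μ.c0p; have h3 := μ.c01; have h4 := μ.Mx1; have h5 := μ.Tot1
  have h6 : 1 ≤ μ.Mx ^ 3 := one_le_pow₀ h4
  have hE := μ.E1
  have h8 : μ.m ≤ μ.m * μ.Mx ^ 3 := by nlinarith
  have h9 : μ.m * μ.Mx ^ 3 ≤ μ.m * μ.Mx ^ 3 * μ.Tot := by nlinarith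
  have : μ.E * μ.c0 ^ 2 ≤ μ.E * μ.c0 := by
    have : μ.c0 ^ 2 ≤ μ.c0 := by nlinarith
    nlinarith
  linarith

variable (hk : Kn M q κ wt) (ho : T.Orb κ T.v)

include hk in
lemma gf_pos (j : ℕ) : 0 < μ.gf κ wt j := by
  unfold gf
  split_ifs with h
  · have h1 := μ.lo_m (κ j) (κ (j + 1)) (okp_nr (hk.nr j h))
    linarith [μ.m1]
  · exact div_pos μ.c0p (pow_pos μ.Mxp _)

include hk in
lemma hf1 (j : ℕ) : 1 ≤ μ.hf κ wt j := by
  unfold hf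
  split_ifs with h
  · exact μ.hi1 _ _ (hk.nr j h)
  · exact μ.Mx1

include hk in
lemma H1 (n : ℕ) : 1 ≤ μ.H κ wt n := Finset.one_le_prod fun j _ => μ.hf1 hk j

include hk in
lemma gh (j : ℕ) : μ.σ0 ^ 2 * (μ.hf κ wt j) ^ μ.a ≤ μ.gf κ wt j * μ.C2 ^ (wt j) := by
  unfold hf gf
  split_ifs with h
  · rw [h, pow_zero, mul_one]; exact μ.lohi _ _ (hk.nr j h)
  · obtain ⟨A, hA⟩ : ∃ A, wt j = A + 1 := ⟨wt j - 1, by omega⟩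
    rw [hA, Nat.add_sub_cancel]
    have h1 : μ.Mx ^ μ.a ≤ μ.Mx := by
      have := Real.rpow_le_rpow_of_exponent_le μ.Mx1 μ.a1
      rwa [Real.rpow_one] at this
    have h2 : μ.Mx ^ A ≤ μ.C2 ^ A := pow_le_pow_left₀ μ.Mxp.le μ.Mx_le_C2 _
    have hM := pow_pos μ.Mxp A
    have hc := μ.c0p
    calc μ.σ0 ^ 2 * μ.Mx ^ μ.a ≤ μ.σ0 ^ 2 * μ.Mx := by gcongr
      _ = μ.c0 / μ.Mx ^ A * (μ.Mx ^ A * μ.C2) := by unfold C2; field_simp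
      _ ≤ μ.c0 / μ.Mx ^ A * (μ.C2 ^ A * μ.C2) := by
          have := μ.C2p
          gcongr
      _ = _ := by ring

include hk in
lemma GHx (n : ℕ) : μ.σ0 ^ (2 * n) * (μ.H κ wt n) ^ μ.a ≤ μ.G κ wt n * μ.C2 ^ (X wt n) := by
  induction n with
  | zero => simp [H, G, X]
  | succ n ih =>
    have h1 := μ.gh hk n
    have hH : μ.H κ wt (n + 1) = μ.H κ wt n * μ.hf κ wt n := Finset.prod_range_succ _ _
    have hG : μ.G κ wt (n + 1) = μ.G κ wt n * μ.gf κ wt n := Finset.prod_range_succ _ _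
    have hX : X wt (n + 1) = X wt n + wt n := Finset.sum_range_succ _ _
    have a1 := μ.H1 hk n
    have a2 := μ.hf1 hk n
    rw [hH, hG, hX, Real.mul_rpow (by linarith) (by linarith)]
    have hσ := μ.σ1
    have p1 : 0 ≤ (μ.hf κ wt n) ^ μ.a := Real.rpow_nonneg (by linarith) _
    have p2 : 0 ≤ (μ.H κ wt n) ^ μ.a := Real.rpow_nonneg (by linarith) _
    calc _ = (μ.σ0 ^ (2 * n) * (μ.H κ wt n) ^ μ.a) * (μ.σ0 ^ 2 * (μ.hf κ wt n) ^ μ.a) := by ring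
      _ ≤ (μ.G κ wt n * μ.C2 ^ (X wt n)) * (μ.gf κ wt n * μ.C2 ^ (wt n)) := by
          apply mul_le_mul ih h1 (by positivity)
          exact le_trans (by positivity) ih
      _ = _ := by ring

include hk in
lemma GH (hq : μ.C2 ^ 4 ≤ μ.σ0 ^ q) (n : ℕ) :
    μ.σ0 ^ n * μ.C2 ^ (3 * X wt (n + 2)) * (μ.H κ wt n) ^ μ.a ≤ μ.G κ wt n := by
  have h1 := μ.GHx hk n
  have hX : X wt n ≤ X wt (n + 2) := X_mono wt (by omega)
  have hqX : q * X wt (n + 2) ≤ n := hk.qX n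
  have hC := μ.C2_1
  have hσ := μ.σ1
  have h2 : μ.C2 ^ (4 * X wt (n + 2)) ≤ μ.σ0 ^ n := by
    calc μ.C2 ^ (4 * X wt (n + 2)) = (μ.C2 ^ 4) ^ X wt (n + 2) := by rw [pow_mul]
      _ ≤ (μ.σ0 ^ q) ^ X wt (n + 2) := pow_le_pow_left₀ (by positivity) hq _
      _ = μ.σ0 ^ (q * X wt (n + 2)) := by rw [pow_mul]
      _ ≤ _ := pow_le_pow_right₀ hσ.le hqX
  have p2 : 0 ≤ (μ.H κ wt n) ^ μ.a := Real.rpow_nonneg (by linarith [μ.H1 hk n]) _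
  have pC : 0 < μ.C2 ^ X wt (n + 2) := by have := μ.C2p; positivity
  have gp : 0 ≤ μ.G κ wt n := Finset.prod_nonneg fun j _ => (μ.gf_pos hk j).le
  refine le_of_mul_le_mul_right ?_ pC
  calc _ = μ.σ0 ^ n * μ.C2 ^ (4 * X wt (n + 2)) * (μ.H κ wt n) ^ μ.a := by ring
    _ ≤ μ.σ0 ^ n * μ.σ0 ^ n * (μ.H κ wt n) ^ μ.a := by gcongr
    _ = μ.σ0 ^ (2 * n) * (μ.H κ wt n) ^ μ.a := by ring
    _ ≤ _ := h1
    _ ≤ _ := by gcongr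

include hk ho in
lemma lemH {s : ℕ → Fin 3} {y : ℝ} (hy : T.Orb s y) : ∀ n, (∀ i ≤ n, s i = κ i) →
    |μ.Φ (T.F^[n] T.v) - μ.Φ (T.F^[n] y)| ≤ μ.H κ wt n * |μ.Φ T.v - μ.Φ y|
  | 0, _ => by simp [H]
  | n + 1, h => by
    have ih := lemH hy n (fun i hi => h i (by omega))
    have hH : μ.H κ wt (n + 1) = μ.H κ wt n * μ.hf κ wt n := Finset.prod_range_succ _ _
    have h1 := hy n
    have h2 := hy (n + 1)
    have h3 := ho (n + 1)
    rw [h n (by omega)] at h1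
    rw [h (n + 1) le_rfl] at h2
    rw [Function.iterate_succ_apply'] at h2 h3
    have a1 := μ.hf1 hk n
    have : |μ.Φ (T.F (T.F^[n] T.v)) - μ.Φ (T.F (T.F^[n] y))| ≤
        μ.hf κ wt n * |μ.Φ (T.F^[n] T.v) - μ.Φ (T.F^[n] y)| := by
      unfold hf
      split_ifs with hw
      · exact μ.HI _ _ _ _ (hk.nr n hw) (ho n) h1 h3 h2
      · exact μ.GLip _ _ _ (ho n) h1
    rw [Function.iterate_succ_apply', Function.iterate_succ_apply', hH]
    calc _ ≤ _ := this
      _ ≤ μ.hf κ wt n * (μ.H κ wt n * |μ.Φ T.v - μ.Φ y|) := by gcongr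
      _ = _ := by ring

include hk ho in
lemma lemG {s : ℕ → Fin 3} {x y : ℝ} (hx : T.Orb s x) (hy : T.Orb s y) :
    ∀ n, (∀ i ≤ n, s i = κ i) →
    (∀ j < n, ∀ A, wt j = A + 1 → ∀ t ≤ A, s (j + 1 + t) = κ (j + 1 + t)) →
    μ.G κ wt n * |μ.Φ x - μ.Φ y| ≤ |μ.Φ (T.F^[n] x) - μ.Φ (T.F^[n] y)|
  | 0, _, _ => by simp [G]
  | n + 1, h, hr => by
    have ih := lemG hx hy n (fun i hi => h i (by omega)) (fun j hj => hr j (by omega))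
    have hG : μ.G κ wt (n + 1) = μ.G κ wt n * μ.gf κ wt n := Finset.prod_range_succ _ _
    have hx1 := hx n
    have hx2 := hx (n + 1)
    have h1 := hy n
    have h2 := hy (n + 1)
    rw [h n (by omega)] at h1 hx1
    rw [h (n + 1) le_rfl] at h2 hx2
    have e1 := Function.iterate_succ_apply' T.F n x
    have e2 := Function.iterate_succ_apply' T.F n y
    have : μ.gf κ wt n * |μ.Φ (T.F^[n] x) - μ.Φ (T.F^[n] y)| ≤
        |μ.Φ (T.F^[n+1] x) - μ.Φ (T.F^[n+1] y)| := by
      have hgf : μ.gf κ wt n = if wt n = 0 then μ.lo (κ n) (κ (n + 1))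
        else μ.c0 / μ.Mx ^ (wt n - 1) := rfl
      rw [hgf]
      split_ifs with hw
      · rw [e1] at hx2 ⊢; rw [e2] at h2 ⊢
        exact μ.LO _ _ _ _ (okp_nr (hk.nr n hw)) hx1 h1 hx2 h2
      · obtain ⟨A, hA⟩ : ∃ A, wt n = A + 1 := ⟨wt n - 1, by omega⟩
        rw [hA, Nat.add_sub_cancel]
        have hret := hk.ret n A hA
        have hag := hr n (by omega) A hA
        have dep : ∀ z, T.Orb s z → μ.c0 / μ.Mx ^ A ≤ μ.Φ T.v - μ.Φ (T.F^[n+1] z) := by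
          intro z hz
          have d1 := μ.depth hk ho hA (z := T.F^[n+1] z) (by
            intro t ht
            have := hz (n + 1 + t)
            rw [hag t ht] at this
            rwa [add_comm (n + 1) t, Function.iterate_add_apply, add_comm t (n + 1)] at this)
          have : T.F^[n+1] z ≤ T.v := by
            rw [Function.iterate_succ_apply']
            have h5 := hz n
            rw [h n (by omega), hret.h1] at h5
            exact (T.maps_le (by simp) h5).2
          have h6 := μ.monoL (T.maps_iter hz.mem (n+1)) T.v_mem this
          rw [abs_of_nonneg (by linarith)] at d1
          rw [div_le_iff₀ (pow_pos μ.Mxp _)]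
          linarith
        have hM := pow_pos μ.Mxp A
        have hc := μ.c0p
        set τ := μ.c0 / μ.Mx ^ A with hτ
        have τ0 : 0 ≤ τ := by positivity
        have τ1 : τ ≤ 1 := by
          rw [hτ, div_le_iff₀ hM]
          have := one_le_pow₀ μ.Mx1 (n := A)
          linarith [μ.c01]
        rw [hret.h1] at hx1 h1
        rw [hret.h2] at hx2 h2
        rw [e1] at hx2; rw [e2] at h2
        have dx := dep x hx
        have dy := dep y hy
        rw [e1] at dx; rw [e2] at dy
        have h7 := μ.RET 1 _ _ τ (by simp) hx1 h1 hx2 h2 τ0 dx dy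
        rw [← e1, ← e2] at h7
        refine le_trans ?_ h7
        gcongr
        refine le_min (τ1.trans μ.m1.le) ?_
        have := μ.pow_rpow_le_one τ0 τ1
        have hE := μ.E1
        nlinarith
    rw [hG]
    have gp := μ.gf_pos hk n
    calc _ = μ.gf κ wt n * (μ.G κ wt n * |μ.Φ x - μ.Φ y|) := by ring
      _ ≤ μ.gf κ wt n * |μ.Φ (T.F^[n] x) - μ.Φ (T.F^[n] y)| := by gcongr
      _ ≤ _ := this

/-- combination of `lemG` and `lemH` -/
lemma gain (hk : Kn M q κ wt) (ho : T.Orb κ T.v) (hq : μ.C2 ^ 4 ≤ μ.σ0 ^ q)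
    {s : ℕ → Fin 3} {x y : ℝ} (hx : T.Orb s x) (hy : T.Orb s y)
    (n : ℕ) (h : ∀ i ≤ n, s i = κ i)
    (hr : ∀ j < n, ∀ A, wt j = A + 1 → ∀ t ≤ A, s (j + 1 + t) = κ (j + 1 + t))
    {t : ℝ} (t0 : 0 ≤ t) (ht : t ≤ |μ.Φ (T.F^[n] T.v) - μ.Φ (T.F^[n] y)|) :
    μ.C2 ^ (3 * X wt (n + 2)) * t ^ μ.a * |μ.Φ x - μ.Φ y| ≤
      |μ.Φ T.v - μ.Φ y| ^ μ.a * |μ.Φ (T.F^[n] x) - μ.Φ (T.F^[n] y)| := by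
  have h1 := μ.lemG hk ho hx hy n h hr
  have h2 := μ.lemH hk ho hy n h
  have h3 := μ.GH hk hq n
  have hH := μ.H1 hk n
  have h4 : t ^ μ.a ≤ (μ.H κ wt n) ^ μ.a * |μ.Φ T.v - μ.Φ y| ^ μ.a := by
    rw [← Real.mul_rpow (by linarith) (abs_nonneg _)]
    exact Real.rpow_le_rpow t0 (ht.trans h2) μ.a0.le
  have hC := μ.C2p
  have hσ : 1 ≤ μ.σ0 ^ n := one_le_pow₀ μ.σ1.le
  have p1 : 0 ≤ |μ.Φ T.v - μ.Φ y| ^ μ.a := Real.rpow_nonneg (abs_nonneg _) _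
  have p2 : 0 ≤ (μ.H κ wt n) ^ μ.a := Real.rpow_nonneg (by linarith) _
  calc _ ≤ μ.C2 ^ (3 * X wt (n + 2)) * ((μ.H κ wt n) ^ μ.a * |μ.Φ T.v - μ.Φ y| ^ μ.a) *
        |μ.Φ x - μ.Φ y| := by gcongr
    _ = |μ.Φ T.v - μ.Φ y| ^ μ.a * ((1 * μ.C2 ^ (3 * X wt (n + 2)) * (μ.H κ wt n) ^ μ.a) *
        |μ.Φ x - μ.Φ y|) := by ring
    _ ≤ |μ.Φ T.v - μ.Φ y| ^ μ.a * ((μ.σ0 ^ n * μ.C2 ^ (3 * X wt (n + 2)) * (μ.H κ wt n) ^ μ.a) *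
        |μ.Φ x - μ.Φ y|) := by gcongr
    _ ≤ |μ.Φ T.v - μ.Φ y| ^ μ.a * (μ.G κ wt n * |μ.Φ x - μ.Φ y|) := by gcongr
    _ ≤ _ := by gcongr

/-- distance at a departure inside of a pending return -/
lemma sep_pend (hk : Kn M q κ wt) (ho : T.Orb κ T.v) {j A t : ℕ} (hj : wt j = A + 1)
    (ht : t ≤ A) {b : Fin 3} {y : ℝ} (hy : y ∈ T.lap b) (hb : b ≠ κ (j + 1 + t)) :
    μ.c0 ≤ μ.Mx ^ (A + 1) * |μ.Φ (T.F^[j + 1 + t] T.v) - μ.Φ y| := by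
  have hret := hk.ret j A hj
  have up : ∀ N ≤ A + 1, μ.c0 ≤ μ.Mx ^ N * |μ.Φ (T.F^[j + 1 + t] T.v) - μ.Φ y| →
      μ.c0 ≤ μ.Mx ^ (A + 1) * |μ.Φ (T.F^[j + 1 + t] T.v) - μ.Φ y| := by
    intro N hN h
    refine h.trans ?_
    have := pow_le_pow_right₀ μ.Mx1 hN
    gcongr
  rcases Top.fin3 (κ (j + 1 + t)) with h0 | h0 | h0
  · exact up 0 (by omega) (by simpa using μ.sep0 hk ho h0 hy (by rwa [h0] at hb))
  · have htA : t < A := by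
      rcases ht.lt_or_eq with h | h
      · exact h
      · rw [h, hret.e0] at h0; simp at h0
    rcases Top.fin3 b with rfl | rfl | rfl
    · refine up _ ?_ (μ.sep10 hk ho h0 hy)
      rw [(hret.agr t htA).2]
      rcases Nat.eq_zero_or_pos (wt t) with h | h
      · omega
      · have := hret.nest t htA h; omega
    · exact absurd h0.symm hb
    · classical
      have ex : ∃ N, κ (j + 1 + t + 1 + N) ≠ 0 := by
        refine ⟨A - t, ?_⟩
        rw [show j + 1 + t + 1 + (A - t) = j + 2 + A by omega, hret.e1]; simp
      have hle : Nat.find ex ≤ A - t := Nat.find_min' ex (by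
        rw [show j + 1 + t + 1 + (A - t) = j + 2 + A by omega, hret.e1]; simp)
      have := μ.sep12 hk ho h0 hy (N := Nat.find ex) (fun u hu => by
        have := Nat.find_min ex hu
        simpa using this) (Nat.find_spec ex)
      exact up _ (by omega) this
  · exact up 1 (by omega) (by simpa using μ.sep2 hk ho h0 hy (by rwa [h0] at hb))

lemma bdd {x y : ℝ} (hx : x ∈ Icc T.l T.r) (hy : y ∈ Icc T.l T.r) :
    |μ.Φ x - μ.Φ y| ≤ μ.Φ T.r - μ.Φ T.l := by
  have hr : T.r ∈ Icc T.l T.r := ⟨(T.lc.trans (T.cd.trans T.dr)).le, le_rfl⟩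
  have a1 := μ.monoL hx hr hx.2
  have a2 := μ.monoL l_mem hx hx.1
  have a3 := μ.monoL hy hr hy.2
  have a4 := μ.monoL l_mem hy hy.1
  rw [abs_le]; constructor <;> linarith

lemma no_growth {x y : ℝ} (hx : x ∈ Icc T.l T.r) (hy : y ∈ Icc T.l T.r)
    {σ L : ℝ} (hσ : 1 < σ) (hL : 0 < L)
    (h : ∀ n, ∃ k, σ ^ n * L ≤ |μ.Φ (T.F^[k] x) - μ.Φ (T.F^[k] y)|) : False := by
  obtain ⟨n, hn⟩ := pow_unbounded_of_one_lt ((μ.Φ T.r - μ.Φ T.l) / L) hσ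
  obtain ⟨k, hk⟩ := h n
  have := μ.bdd (T.maps_iter hx k) (T.maps_iter hy k)
  rw [div_lt_iff₀ hL] at hn
  linarith

lemma posL {s x y} (hx : T.Orb s x) (hy : T.Orb s y) (hne : x ≠ y) (n : ℕ) :
    0 < |μ.Φ (T.F^[n] x) - μ.Φ (T.F^[n] y)| := by
  rw [abs_pos, sub_ne_zero]
  intro h
  have := μ.mono.injOn (T.maps_iter hx.mem n) (T.maps_iter hy.mem n) h
  exact hne (Top.eq_of_eq_at n hx hy (fun _ _ => rfl) this)

lemma run0 {s : ℕ → Fin 3} {x y : ℝ} (hx : T.Orb s x) (hy : T.Orb s y) {p : ℕ} :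
    ∀ k, (∀ t ≤ k, s (p + t) = 0) →
    μ.lo 0 0 ^ k * |μ.Φ (T.F^[p] x) - μ.Φ (T.F^[p] y)| ≤
      |μ.Φ (T.F^[p + k] x) - μ.Φ (T.F^[p + k] y)|
  | 0, _ => by simp
  | k + 1, h => by
    have ih := run0 hx hy k (fun t ht => h t (by omega))
    have lom := μ.lo_m 0 0 (by simp)
    have hm := μ.m1
    have hx1 := hx (p + k)
    have hy1 := hy (p + k)
    have hx2 := hx (p + k + 1)
    have hy2 := hy (p + k + 1)
    rw [h k (by omega)] at hx1 hy1
    rw [add_assoc, h (k + 1) (by omega), ← add_assoc, Function.iterate_succ_apply'] at hx2 hy2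
    have := μ.LO 0 0 _ _ (by simp) hx1 hy1 hx2 hy2
    rw [← add_assoc, Function.iterate_succ_apply', Function.iterate_succ_apply']
    refine le_trans ?_ this
    calc _ = μ.lo 0 0 * (μ.lo 0 0 ^ k * |μ.Φ (T.F^[p] x) - μ.Φ (T.F^[p] y)|) := by ring
      _ ≤ _ := by gcongr; linarith

lemma close_tail (hk : Kn M q κ wt) (ho : T.Orb κ T.v) (hq : μ.C2 ^ 4 ≤ μ.σ0 ^ q)
    {s : ℕ → Fin 3} {x y : ℝ} (hx : T.Orb s x) (hy : T.Orb s y) (hne : x ≠ y) {n : ℕ}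
    (hag : ∀ i ≤ n, s i = κ i)
    (hrr : ∀ j < n, ∀ A, wt j = A + 1 → ∀ t ≤ A, s (j + 1 + t) = κ (j + 1 + t))
    (st : |μ.Φ (T.F^[n + 1] T.v) - μ.Φ (T.F^[n + 1] y)| ≤
      μ.Mx * |μ.Φ (T.F^[n] T.v) - μ.Φ (T.F^[n] y)|)
    (fin' : ∀ e, e ≤ 3 * X wt (n + 2) →
      μ.c0 ≤ μ.Mx ^ (e + 2) * |μ.Φ (T.F^[n + 1] T.v) - μ.Φ (T.F^[n + 1] y)| →
      ∃ n, μ.m * |μ.Φ x - μ.Φ y| ≤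
        μ.E * |μ.Φ T.v - μ.Φ y| ^ μ.a * |μ.Φ (T.F^[n] x) - μ.Φ (T.F^[n] y)|)
    (hκ : κ (n + 1) = 1) (hs : s (n + 1) = 2) :
    ∃ n, μ.m * |μ.Φ x - μ.Φ y| ≤
      μ.E * |μ.Φ T.v - μ.Φ y| ^ μ.a * |μ.Φ (T.F^[n] x) - μ.Φ (T.F^[n] y)| := by
  have hE1 := μ.E1
  have hm1 := μ.m1
  have hC := μ.C2p
  have hMp := μ.Mxp
  have hM1 := μ.Mx1
  have hc := μ.c0p
  have p1 : 0 ≤ |μ.Φ T.v - μ.Φ y| ^ μ.a := Real.rpow_nonneg (abs_nonneg _) _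
  have hxD := hx (n + 1)
  have hyD := hy (n + 1)
  rw [hs] at hxD hyD
  have hyD' := hyD
  have hxD' := hxD
  rw [Top.lap2] at hyD' hxD'
  have hW := ho (n + 1)
  rw [hκ, Top.lap1] at hW
  have hWm := Wmem hk ho (n + 1)
  have sd := (μ.sepd_right hWm (T.lap_sub _ hyD) hW.2 hyD'.1).2
  have cle : ∀ p, s p ≠ 0 → T.c ≤ T.F^[p] y := by
    intro p hp
    have := hy p
    have hcd := T.cd
    rcases Top.fin3 (s p) with h | h | h
    · exact absurd h hp
    · rw [h, Top.lap1] at this; exact this.1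
    · rw [h, Top.lap2] at this; linarith [this.1]
  by_cases hs2 : s (n + 1 + 1) ≠ 0
  · have h1 := cle _ hs2
    rw [Function.iterate_succ_apply'] at h1
    have h2 := μ.far_d (Or.inr rfl) hyD h1
    refine fin' 0 (by omega) (h2.trans ?_)
    calc _ ≤ μ.Mx * |μ.Φ (T.F^[n + 1] T.v) - μ.Φ (T.F^[n + 1] y)| := by gcongr
      _ ≤ _ := by gcongr; exact le_self_pow₀ hM1 (by norm_num)
  push Not at hs2
  have hxE := hx (n + 1 + 1)
  have hyE := hy (n + 1 + 1)
  rw [hs2] at hxE hyE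
  by_cases hinf : ∀ t, s (n + 2 + t) = 0
  · exfalso
    refine μ.no_growth hx.mem hy.mem μ.m1 (μ.posL hx hy hne (n + 2)) (fun k => ⟨n + 2 + k, ?_⟩)
    refine le_trans ?_ (μ.run0 hx hy k (fun t _ => hinf t))
    have := μ.lo_m 0 0 (by simp)
    gcongr
  push Not at hinf
  classical
  obtain ⟨k, hk1, hk2⟩ : ∃ k, (∀ t ≤ k, s (n + 2 + t) = 0) ∧ s (n + 2 + (k + 1)) ≠ 0 := by
    have h1 := Nat.find_spec hinf
    have h2 := fun {t} (ht : t < Nat.find hinf) => Nat.find_min hinf ht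
    have h3 : Nat.find hinf ≠ 0 := by
      intro h; rw [h] at h1; exact h1 hs2
    obtain ⟨k, hk⟩ := Nat.exists_eq_succ_of_ne_zero h3
    rw [hk] at h1 h2
    exact ⟨k, fun t ht => by simpa using h2 (t := t) (by omega), h1⟩
  have far := μ.far_d_run' (x := T.F^[n + 1] y) hyD k (by
      intro t ht
      rw [← Function.iterate_add_apply, show t + 1 + (n + 1) = n + 2 + t by ring,
        ← hk1 t (by omega)]
      exact hy _) (by
      rw [← Function.iterate_add_apply, show k + 2 + (n + 1) = n + 2 + (k + 1) by ring]
      exact cle _ hk2)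
  -- the step into lap 2
  have hxn := hx n
  have hyn := hy n
  have hθ : μ.c0 ≤ |μ.Φ (T.F^[n + 1] T.v) - μ.Φ (T.F^[n + 1] y)| ∨
      μ.c0 * |μ.Φ (T.F^[n] x) - μ.Φ (T.F^[n] y)| ≤
        μ.Tot * |μ.Φ (T.F^[n + 1] x) - μ.Φ (T.F^[n + 1] y)| := by
    have weak : |μ.Φ (T.F^[n] x) - μ.Φ (T.F^[n] y)| ≤
        |μ.Φ (T.F^[n + 1] x) - μ.Φ (T.F^[n + 1] y)| → μ.c0 * |μ.Φ (T.F^[n] x) - μ.Φ (T.F^[n] y)| ≤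
        μ.Tot * |μ.Φ (T.F^[n + 1] x) - μ.Φ (T.F^[n + 1] y)| := by
      intro h
      have h1 := μ.c01; have h2 := μ.Tot1
      have h3 := abs_nonneg (μ.Φ (T.F^[n] x) - μ.Φ (T.F^[n] y))
      nlinarith
    have hxD2 := hxD
    have hyD2 := hyD
    rw [Function.iterate_succ_apply'] at hxD2 hyD2
    by_cases h2 : s n = 2
    · right
      apply weak
      rw [h2] at hxn hyn
      have := μ.LO 2 2 _ _ (by simp) hxn hyn hxD2 hyD2
      rw [Function.iterate_succ_apply', Function.iterate_succ_apply']
      refine le_trans ?_ this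
      have := μ.lo_m 2 2 (by simp)
      have h3 := abs_nonneg (μ.Φ (T.F^[n] x) - μ.Φ (T.F^[n] y))
      nlinarith
    have hvx := μ.monoL (T.lap_sub _ hxD) T.v_mem (by
      rw [Function.iterate_succ_apply']; exact (T.maps_le h2 hxn).2)
    have hvy := μ.monoL (T.lap_sub _ hyD) T.v_mem (by
      rw [Function.iterate_succ_apply']; exact (T.maps_le h2 hyn).2)
    by_cases c1 : μ.Φ T.v - μ.Φ (T.F^[n + 1] y) < 2 * μ.c0
    · left
      refine le_trans ?_ sd
      have := μ.g3
      have h5 := le_abs_self (μ.Φ (T.F^[n + 1] y) - μ.Φ T.d)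
      linarith
    right
    push Not at c1
    by_cases c2 : μ.Φ T.v - μ.Φ (T.F^[n + 1] x) < μ.c0
    · have t1 := μ.TOT _ _ _ h2 hxn hyn hxD2 hyD2
      have h5 := le_abs_self (μ.Φ (T.F^[n + 1] x) - μ.Φ (T.F^[n + 1] y))
      have h6 : μ.c0 ≤ |μ.Φ (T.F^[n + 1] x) - μ.Φ (T.F^[n + 1] y)| := by linarith
      have h3 := abs_nonneg (μ.Φ (T.F^[n] x) - μ.Φ (T.F^[n] y))
      have h7 := μ.Tot1
      nlinarith
    · push Not at c2
      apply weak
      rw [Function.iterate_succ_apply'] at c1 c2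
      have := μ.RET _ _ _ μ.c0 h2 hxn hyn hxD2 hyD2 hc.le c2 (by linarith)
      rw [Function.iterate_succ_apply', Function.iterate_succ_apply']
      refine le_trans ?_ this
      have h3 := abs_nonneg (μ.Φ (T.F^[n] x) - μ.Φ (T.F^[n] y))
      have h8 : 1 ≤ min μ.m (μ.E * μ.c0 ^ μ.a) := by
        refine le_min hm1.le ?_
        have a1 := μ.Ec0
        have a2 := μ.pow_rpow_le_one hc.le μ.c01
        nlinarith
      nlinarith
  rcases hθ with hθ | hθ
  · refine fin' 0 (by omega) (hθ.trans ?_)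
    have := one_le_pow₀ hM1 (n := 0 + 2)
    have h3 := abs_nonneg (μ.Φ (T.F^[n + 1] T.v) - μ.Φ (T.F^[n + 1] y))
    nlinarith
  refine ⟨n + 2 + k, ?_⟩
  have hh1 : 1 ≤ μ.hi 0 0 := μ.hi1 0 0 (by simp [okp])
  set t := μ.c0 / (μ.Mx ^ 3 * μ.hi 0 0 ^ k) with ht
  have hden : 0 < μ.Mx ^ 3 * μ.hi 0 0 ^ k := by positivity
  have t0 : 0 ≤ t := by positivity
  have g := μ.gain hk ho hq hx hy n hag hrr t0 (by
    rw [ht, div_le_iff₀ hden]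
    calc μ.c0 ≤ _ := far
      _ ≤ μ.Mx ^ 2 * μ.hi 0 0 ^ k * |μ.Φ (T.F^[n + 1] T.v) - μ.Φ (T.F^[n + 1] y)| := by gcongr
      _ ≤ μ.Mx ^ 2 * μ.hi 0 0 ^ k * (μ.Mx * |μ.Φ (T.F^[n] T.v) - μ.Φ (T.F^[n] y)|) := by gcongr
      _ = _ := by ring)
  have r1 := μ.run0 hx hy k hk1
  have r2 : |μ.Φ (T.F^[n + 1] x) - μ.Φ (T.F^[n + 1] y)| ≤
      |μ.Φ (T.F^[n + 2] x) - μ.Φ (T.F^[n + 2] y)| := by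
    rw [Function.iterate_succ_apply'] at hxE hyE
    have := μ.LO 2 0 _ _ (by simp) hxD hyD hxE hyE
    rw [Function.iterate_succ_apply' _ (n + 1), Function.iterate_succ_apply' _ (n + 1)]
    refine le_trans ?_ this
    have := μ.lo_m 2 0 (by simp)
    have h3 := abs_nonneg (μ.Φ (T.F^[n + 1] x) - μ.Φ (T.F^[n + 1] y))
    nlinarith
  have hloh : μ.hi 0 0 ^ μ.a ≤ μ.lo 0 0 := by
    have a1 := μ.lohi 0 0 (by simp [okp])
    have a2 : 1 ≤ μ.σ0 ^ 2 := one_le_pow₀ μ.σ1.le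
    have a3 : 0 ≤ μ.hi 0 0 ^ μ.a := Real.rpow_nonneg (by linarith) _
    nlinarith
  have a3 : 0 ≤ μ.hi 0 0 ^ μ.a := Real.rpow_nonneg (by linarith) _
  have hTot := μ.Tot1
  have e1 : (μ.hi 0 0 ^ μ.a) ^ k * t ^ μ.a = (μ.c0 / μ.Mx ^ 3) ^ μ.a := by
    have : (μ.hi 0 0 ^ μ.a) ^ k = (μ.hi 0 0 ^ k) ^ μ.a := by
      rw [← Real.rpow_natCast, ← Real.rpow_natCast, ← Real.rpow_mul (by linarith),
        ← Real.rpow_mul (by linarith), mul_comm]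
    rw [this, ← Real.mul_rpow (by positivity) t0]
    congr 1
    rw [ht]; field_simp
  have e2 : μ.c0 / μ.Mx ^ 3 ≤ (μ.c0 / μ.Mx ^ 3) ^ μ.a := by
    apply μ.pow_rpow_le_one (by positivity)
    rw [div_le_iff₀ (by positivity)]
    have := one_le_pow₀ hM1 (n := 3)
    linarith [μ.c01]
  have hC3 : 1 ≤ μ.C2 ^ (3 * X wt (n + 2)) := one_le_pow₀ μ.C2_1
  have ta : 0 ≤ t ^ μ.a := Real.rpow_nonneg t0 _
  have Lb : (μ.hi 0 0 ^ μ.a) ^ k * (μ.c0 / μ.Tot * |μ.Φ (T.F^[n] x) - μ.Φ (T.F^[n] y)|) ≤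
      |μ.Φ (T.F^[n + 2 + k] x) - μ.Φ (T.F^[n + 2 + k] y)| := by
    refine le_trans ?_ r1
    have : μ.c0 / μ.Tot * |μ.Φ (T.F^[n] x) - μ.Φ (T.F^[n] y)| ≤
        |μ.Φ (T.F^[n + 2] x) - μ.Φ (T.F^[n + 2] y)| := by
      rw [div_mul_eq_mul_div, div_le_iff₀ (by linarith)]
      linarith [mul_le_mul_of_nonneg_left r2 (by linarith : 0 ≤ μ.Tot)]
    have hlo : 0 ≤ μ.lo 0 0 := a3.trans hloh
    gcongr
  have hb := μ.Ebig
  have hb' : μ.m ≤ μ.E * (μ.c0 / μ.Tot * (μ.c0 / μ.Mx ^ 3)) := by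
    rw [show μ.E * (μ.c0 / μ.Tot * (μ.c0 / μ.Mx ^ 3)) = μ.E * μ.c0 ^ 2 / (μ.Mx ^ 3 * μ.Tot) by
      field_simp, le_div_iff₀ (by positivity)]
    linarith
  calc μ.m * |μ.Φ x - μ.Φ y| ≤ μ.E * (μ.c0 / μ.Tot * (μ.c0 / μ.Mx ^ 3)) * |μ.Φ x - μ.Φ y| := by gcongr
    _ ≤ μ.E * (μ.c0 / μ.Tot * ((μ.hi 0 0 ^ μ.a) ^ k * t ^ μ.a)) * |μ.Φ x - μ.Φ y| := by
        rw [e1]; gcongr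
    _ = μ.E * (μ.hi 0 0 ^ μ.a) ^ k * (μ.c0 / μ.Tot) * (1 * t ^ μ.a * |μ.Φ x - μ.Φ y|) := by ring
    _ ≤ μ.E * (μ.hi 0 0 ^ μ.a) ^ k * (μ.c0 / μ.Tot) *
        (μ.C2 ^ (3 * X wt (n + 2)) * t ^ μ.a * |μ.Φ x - μ.Φ y|) := by gcongr
    _ ≤ μ.E * (μ.hi 0 0 ^ μ.a) ^ k * (μ.c0 / μ.Tot) *
        (|μ.Φ T.v - μ.Φ y| ^ μ.a * |μ.Φ (T.F^[n] x) - μ.Φ (T.F^[n] y)|) := by gcongr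
    _ = μ.E * |μ.Φ T.v - μ.Φ y| ^ μ.a * ((μ.hi 0 0 ^ μ.a) ^ k *
        (μ.c0 / μ.Tot * |μ.Φ (T.F^[n] x) - μ.Φ (T.F^[n] y)|)) := by ring
    _ ≤ _ := by gcongr

/-- growth after a close return -/
lemma close (hk : Kn M q κ wt) (hM : 1 ≤ M) (ho : T.Orb κ T.v) (hq : μ.C2 ^ 4 ≤ μ.σ0 ^ q)
    {s : ℕ → Fin 3} {x y : ℝ} (hx : T.Orb s x) (hy : T.Orb s y) (hne : x ≠ y) (h0 : s 0 = 2) :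
    ∃ n, μ.m * |μ.Φ x - μ.Φ y| ≤
      μ.E * |μ.Φ T.v - μ.Φ y| ^ μ.a * |μ.Φ (T.F^[n] x) - μ.Φ (T.F^[n] y)| := by
  have hE1 := μ.E1
  have hm1 := μ.m1
  have hC := μ.C2p
  have hMp := μ.Mxp
  have hc := μ.c0p
  have L0 : 0 < |μ.Φ x - μ.Φ y| := μ.posL hx hy hne 0
  have p1 : 0 ≤ |μ.Φ T.v - μ.Φ y| ^ μ.a := Real.rpow_nonneg (abs_nonneg _) _
  by_cases hsk : s = κ
  · subst hsk
    exfalso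
    refine μ.no_growth hx.mem hy.mem μ.σ1 L0 (fun n => ⟨n, ?_⟩)
    have h1 := μ.lemG hk ho hx hy n (fun _ _ => rfl) (fun _ _ _ _ _ _ => rfl)
    refine le_trans ?_ h1
    gcongr
    refine le_trans ?_ (μ.GH hk hq n)
    have a1 : 1 ≤ μ.C2 ^ (3 * X wt (n + 2)) := one_le_pow₀ μ.C2_1
    have a2 : 1 ≤ (μ.H s wt n) ^ μ.a := Real.one_le_rpow (μ.H1 hk n) μ.a0.le
    have a3 : 1 ≤ μ.σ0 ^ n := one_le_pow₀ μ.σ1.le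
    calc μ.σ0 ^ n = μ.σ0 ^ n * 1 * 1 := by ring
      _ ≤ _ := by gcongr
  obtain ⟨D, hD, hDne⟩ := exists_departure hsk
  have hD1 : 1 ≤ D := by
    rcases Nat.eq_zero_or_pos D with h | h
    · subst h; exact absurd (h0.trans (hk.two 0 (by omega)).symm) hDne
    · exact h
  -- general conclusion tool
  have fin : ∀ (n e : ℕ) , (∀ i ≤ n, s i = κ i) →
      (∀ j < n, ∀ A, wt j = A + 1 → ∀ t ≤ A, s (j + 1 + t) = κ (j + 1 + t)) →
      e ≤ 3 * X wt (n + 2) →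
      μ.c0 ≤ μ.Mx ^ (e + 3) * |μ.Φ (T.F^[n] T.v) - μ.Φ (T.F^[n] y)| →
      ∃ n, μ.m * |μ.Φ x - μ.Φ y| ≤
        μ.E * |μ.Φ T.v - μ.Φ y| ^ μ.a * |μ.Φ (T.F^[n] x) - μ.Φ (T.F^[n] y)| := by
    intro n e h1 h2 h3 h4
    refine ⟨n, ?_⟩
    set t := μ.c0 / μ.Mx ^ (e + 3) with ht
    have hMe : 0 < μ.Mx ^ (e + 3) := by positivity
    have t0 : 0 ≤ t := by positivity
    have t1 : t ≤ 1 := by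
      rw [ht, div_le_iff₀ hMe]
      have := one_le_pow₀ μ.Mx1 (n := e + 3)
      linarith [μ.c01]
    have g := μ.gain hk ho hq hx hy n h1 h2 t0 (by
      rw [ht, div_le_iff₀ hMe]; linarith)
    have ta := μ.pow_rpow_le_one t0 t1
    have hCe : μ.Mx ^ e ≤ μ.C2 ^ (3 * X wt (n + 2)) :=
      (pow_le_pow_left₀ hMp.le μ.Mx_le_C2 e).trans (pow_le_pow_right₀ μ.C2_1 h3)
    have key : μ.m ≤ μ.E * (μ.C2 ^ (3 * X wt (n + 2)) * t ^ μ.a) := by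
      have b1 := μ.Ebig
      have b2 : μ.m ≤ μ.E * (μ.c0 / μ.Mx ^ 3) := by
        rw [mul_div_assoc', le_div_iff₀ (by positivity)]
        have : μ.m * μ.Mx ^ 3 ≤ μ.m * μ.Mx ^ 3 * μ.Tot := by
          have := μ.Tot1
          have : 0 < μ.m * μ.Mx ^ 3 := by positivity
          nlinarith
        have : μ.E * μ.c0 ^ 2 ≤ μ.E * μ.c0 := by
          have := μ.c01
          have : μ.c0 ^ 2 ≤ μ.c0 := by nlinarith
          gcongr
        linarith
      refine b2.trans ?_
      gcongr
      calc μ.c0 / μ.Mx ^ 3 = μ.Mx ^ e * t := by rw [ht]; field_simp; ring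
        _ ≤ _ := by gcongr
    calc _ ≤ μ.E * (μ.C2 ^ (3 * X wt (n + 2)) * t ^ μ.a) * |μ.Φ x - μ.Φ y| := by gcongr
      _ = μ.E * (μ.C2 ^ (3 * X wt (n + 2)) * t ^ μ.a * |μ.Φ x - μ.Φ y|) := by ring
      _ ≤ μ.E * (|μ.Φ T.v - μ.Φ y| ^ μ.a * |μ.Φ (T.F^[n] x) - μ.Φ (T.F^[n] y)|) := by gcongr
      _ = _ := by ring
  have hyD := hy D
  by_cases hp : ∃ j A, wt j = A + 1 ∧ j + 1 < D ∧ D ≤ j + 1 + A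
  · classical
    obtain ⟨A, hA, hj1, hj2⟩ := Nat.find_spec hp
    have hmin := fun {i} (hi : i < Nat.find hp) => Nat.find_min hp hi
    generalize Nat.find hp = j at *
    obtain ⟨t, rfl⟩ : ∃ t, D = j + 1 + t := ⟨D - (j + 1), by omega⟩
    refine fin j (2 * (A + 1)) (fun i hi => hD i (by omega)) ?_ ?_ ?_
    · intro j' hj' A' hA' t' ht'
      apply hD
      by_contra hc
      exact hmin hj' ⟨A', hA', by omega, by omega⟩
    · have := X_single wt (j := j) (n := j + 2) (by omega)
      omega
    · have h1 := μ.sep_pend hk ho hA (by omega : t ≤ A) hyD hDne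
      have h2 := μ.GLipn (t + 1) (T.F^[j] T.v) (T.F^[j] y) (by
        intro u hu
        refine ⟨κ (j + u), ?_, ?_⟩
        · rw [← Function.iterate_add_apply, add_comm]; exact ho _
        · rw [← Function.iterate_add_apply, add_comm, ← hD (u + j) (by omega)]; exact hy _)
      rw [← Function.iterate_add_apply, ← Function.iterate_add_apply,
        show t + 1 + j = j + 1 + t by ring] at h2
      have h3 : μ.Mx ^ (t + 1) ≤ μ.Mx ^ (A + 1) := pow_le_pow_right₀ μ.Mx1 (by omega)
      calc μ.c0 ≤ _ := h1
        _ ≤ μ.Mx ^ (A + 1) * (μ.Mx ^ (t + 1) * |μ.Φ (T.F^[j] T.v) - μ.Φ (T.F^[j] y)|) := by gcongr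
        _ ≤ μ.Mx ^ (A + 1) * (μ.Mx ^ (A + 1) * |μ.Φ (T.F^[j] T.v) - μ.Φ (T.F^[j] y)|) := by gcongr
        _ = μ.Mx ^ (2 * (A + 1)) * |μ.Φ (T.F^[j] T.v) - μ.Φ (T.F^[j] y)| := by ring
        _ ≤ _ := by gcongr; exacts [μ.Mx1, by omega]
  push Not at hp
  obtain ⟨n, rfl⟩ : ∃ n, D = n + 1 := ⟨D - 1, by omega⟩
  have hag : ∀ i ≤ n, s i = κ i := fun i hi => hD i (by omega)
  have hrr : ∀ j < n, ∀ A, wt j = A + 1 → ∀ t ≤ A, s (j + 1 + t) = κ (j + 1 + t) := by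
    intro j hj A hA t ht
    apply hD
    have := hp j A hA (by omega)
    omega
  have st : |μ.Φ (T.F^[n + 1] T.v) - μ.Φ (T.F^[n + 1] y)| ≤
      μ.Mx * |μ.Φ (T.F^[n] T.v) - μ.Φ (T.F^[n] y)| := by
    rw [Function.iterate_succ_apply', Function.iterate_succ_apply']
    refine μ.GLip (κ n) _ _ (ho n) ?_
    rw [← hag n le_rfl]; exact hy n
  have fin' : ∀ e, e ≤ 3 * X wt (n + 2) →
      μ.c0 ≤ μ.Mx ^ (e + 2) * |μ.Φ (T.F^[n + 1] T.v) - μ.Φ (T.F^[n + 1] y)| →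
      ∃ n, μ.m * |μ.Φ x - μ.Φ y| ≤
        μ.E * |μ.Φ T.v - μ.Φ y| ^ μ.a * |μ.Φ (T.F^[n] x) - μ.Φ (T.F^[n] y)| := by
    intro e he h
    refine fin n e hag hrr he (h.trans ?_)
    calc _ ≤ μ.Mx ^ (e + 2) * (μ.Mx * |μ.Φ (T.F^[n] T.v) - μ.Φ (T.F^[n] y)|) := by gcongr
      _ = _ := by ring
  have up : ∀ N e, N ≤ e → ∀ T : ℝ, 0 ≤ T → μ.c0 ≤ μ.Mx ^ N * T → μ.c0 ≤ μ.Mx ^ e * T := by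
    intro N e hN T hT h
    refine h.trans ?_
    have := pow_le_pow_right₀ μ.Mx1 hN
    gcongr
  rcases Top.fin3 (κ (n + 1)) with hκ | hκ | hκ
  · exact fin' 0 (by omega) (up 0 _ (by omega) _ (abs_nonneg _)
      (by simpa using μ.sep0 hk ho hκ hyD (by rwa [hκ] at hDne)))
  · rcases Top.fin3 (s (n + 1)) with hs | hs | hs
    · rw [hs] at hyD
      exact fin' (wt (n + 1)) ((X_single wt (by omega : n + 1 < n + 2)).trans (by omega))
        (up _ _ (by omega) _ (abs_nonneg _) (μ.sep10 hk ho hκ hyD))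
    · exact absurd (hs.trans hκ.symm) hDne
    · by_cases hz : κ (n + 1 + 1) ≠ 0
      · rw [hs] at hyD
        exact fin' 0 (by omega) (up 1 _ (by omega) _ (abs_nonneg _)
          (by simpa using μ.sep12 hk ho hκ hyD (N := 0) (by simp) hz))
      · exact μ.close_tail hk ho hq hx hy hne hag hrr st fin' hκ hs
  · exact fin' 0 (by omega) (up 1 _ (by omega) _ (abs_nonneg _)
      (by simpa using μ.sep2 hk ho hκ hyD (by rwa [hκ] at hDne)))

lemma grow (hk : Kn M q κ wt) (hM : 1 ≤ M) (ho : T.Orb κ T.v) (hq : μ.C2 ^ 4 ≤ μ.σ0 ^ q)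
    {s : ℕ → Fin 3} {x y : ℝ} (hx : T.Orb s x) (hy : T.Orb s y) (hne : x ≠ y) :
    ∃ p, μ.m * |μ.Φ x - μ.Φ y| ≤ |μ.Φ (T.F^[p] x) - μ.Φ (T.F^[p] y)| := by
  have hx0 := hx 0
  have hy0 := hy 0
  have hx1 := hx 1
  have hy1 := hy 1
  simp only [Function.iterate_zero, id, Function.iterate_one] at hx0 hy0 hx1 hy1
  by_cases hc : s 0 ≠ 2 ∧ s 1 = 2
  · wlog hxy : T.F x ≤ T.F y generalizing x y with hw
    · obtain ⟨p, hp⟩ := hw hy hx hne.symm hy0 hx0 hy1 hx1 (le_of_not_ge hxy)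
      exact ⟨p, by rwa [abs_sub_comm, abs_sub_comm (μ.Φ (T.F^[p] x))]⟩
    rw [hc.2] at hx1 hy1
    have hv := μ.monoL (T.lap_sub _ hy1) T.v_mem (T.maps_le hc.1 hy0).2
    have hv2 := μ.monoL (T.lap_sub _ hx1) (T.lap_sub _ hy1) hxy
    have hne' : T.F x ≠ T.F y := fun h => hne (T.lap_inj _ hx0 hy0 h)
    have hr := μ.RET _ _ _ (μ.Φ T.v - μ.Φ (T.F y)) hc.1 hx0 hy0 hx1 hy1 (by linarith) (by linarith)
      le_rfl
    by_cases hm : μ.m ≤ μ.E * (μ.Φ T.v - μ.Φ (T.F y)) ^ μ.a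
    · rw [min_eq_left hm] at hr
      exact ⟨1, by simpa using hr⟩
    push Not at hm
    rw [min_eq_right hm.le] at hr
    obtain ⟨n, hn⟩ := μ.close hk hM ho hq hx.shift hy.shift hne' hc.2
    rw [abs_of_nonneg (by linarith : 0 ≤ μ.Φ T.v - μ.Φ (T.F y))] at hn
    refine ⟨n + 1, ?_⟩
    rw [Function.iterate_succ_apply, Function.iterate_succ_apply]
    have pos := μ.posL hx.shift hy.shift hne' 0
    simp only [Function.iterate_zero, id] at pos
    set e := μ.E * (μ.Φ T.v - μ.Φ (T.F y)) ^ μ.a with he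
    have he0 : 0 ≤ e := mul_nonneg (by linarith [μ.E1]) (Real.rpow_nonneg (by linarith) _)
    have hm1 := μ.m1
    have hep : 0 < e := by
      rcases he0.eq_or_lt with h | h
      · rw [← h] at hn; nlinarith
      · exact h
    refine le_of_mul_le_mul_left ?_ hep
    calc _ = μ.m * (e * |μ.Φ x - μ.Φ y|) := by ring
      _ ≤ μ.m * |μ.Φ (T.F x) - μ.Φ (T.F y)| := by gcongr
      _ ≤ _ := hn
  · refine ⟨1, ?_⟩
    have h1 := μ.LO _ _ _ _ hc hx0 hy0 hx1 hy1
    simp only [Function.iterate_one]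
    refine le_trans ?_ h1
    gcongr
    exact μ.lo_m _ _ hc

theorem expansive (hk : Kn M q κ wt) (hM : 1 ≤ M) (ho : T.Orb κ T.v)
    (hq : μ.C2 ^ 4 ≤ μ.σ0 ^ q) : T.Expansive := by
  intro s x y hx hy
  by_contra hne
  refine μ.no_growth hx.mem hy.mem μ.m1 (μ.posL hx hy hne 0) (fun n => ?_)
  induction n with
  | zero => exact ⟨0, by simp⟩
  | succ n ih =>
    obtain ⟨k, hk'⟩ := ih
    have hne' : T.F^[k] x ≠ T.F^[k] y := fun h => hne (Top.eq_of_eq_at k hx hy (fun _ _ => rfl) h)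
    obtain ⟨p, hp⟩ := μ.grow hk hM ho hq (hx.shiftn k) (hy.shiftn k) hne'
    refine ⟨p + k, ?_⟩
    rw [Function.iterate_add_apply, Function.iterate_add_apply]
    refine le_trans ?_ hp
    have := μ.m1
    calc _ = μ.m * (μ.m ^ n * |μ.Φ (T.F^[0] x) - μ.Φ (T.F^[0] y)|) := by ring
      _ ≤ _ := by gcongr

end Met
end RCE

namespace RCE

/-! ### Part 5 : kneading data -/

lemma sgnlt_of : ∀ (A : ℕ) (s t : ℕ → Fin 3), (∀ i < A, s i = t i) →
    (Even (ones s A) → s A < t A) → (¬ Even (ones s A) → t A < s A) → sgnlt A s t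
  | 0, s, t, _, h1, _ => by
    simp only [sgnlt]; exact h1 (by simp [ones])
  | A + 1, s, t, h, h1, h2 => by
    have e : ones s (A + 1) = ones (sh s) A + if s 0 = 1 then 1 else 0 := by
      unfold ones sh; rw [Finset.sum_range_succ']
    have e2 : ones (sh t) A = ones (sh s) A := by
      unfold ones sh
      refine Finset.sum_congr rfl fun i hi => ?_
      rw [h (i + 1) (by simp at hi; omega)]
    simp only [sgnlt]
    refine ⟨h 0 (by omega), ?_⟩
    split_ifs with h0
    · rw [if_pos h0] at e
      rw [e, Nat.even_add_one] at h1 h2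
      refine sgnlt_of A _ _ (fun i hi => (h (i + 1) (by omega)).symm) ?_ ?_
      · rw [e2]; intro h3; exact h2 (by simpa using h3)
      · rw [e2]; intro h3; exact h1 h3
    · rw [if_neg h0, add_zero] at e
      rw [e] at h1 h2
      exact sgnlt_of A _ _ (fun i hi => (h (i + 1) (by omega))) h1 h2

section
variable {κ : ℕ → Fin 3} {wt : ℕ → ℕ} {M q : ℕ}

lemma Kn.sgn (hk : Kn M q κ wt) {i A : ℕ} (h : wt i = A + 1) : sgnlt A (shn (i + 1) κ) κ := by
  have hr := hk.ret i A h
  have ha : ∀ t < A, shn (i + 1) κ t = κ t := fun t ht => (hr.agr t ht).1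
  refine sgnlt_of A _ _ ha ?_ ?_
  · intro _
    show κ (i + 1 + A) < κ A
    rw [hr.e0, hr.k0]; simp
  · rw [ones_congr ha]; intro h; exact absurd hr.ev h

variable {T : Top}

lemma Kn.dv (hk : Kn M q κ wt) (hM : 2 ≤ M) (ho : T.Orb κ T.v) : T.d < T.v := by
  have h0 := ho 0
  have h1 := ho 1
  rw [hk.two 0 (by omega), Top.lap2] at h0
  rw [hk.two 1 (by omega), Top.lap2] at h1
  rcases h0.1.eq_or_lt with h | h
  · exfalso
    simp only [Function.iterate_zero, id] at h
    rw [Function.iterate_one, ← h, T.Fd] at h1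
    have := T.lc; have := T.cd; linarith [h1.1]
  · exact h

lemma Kn.knd (hk : Kn M q κ wt) (hM : 2 ≤ M) (ho : T.Orb κ T.v) : T.Knd κ := by
  have hdv := hk.dv hM ho
  have hlc := T.lc
  have hcd := T.cd
  refine ⟨ho, ?_, ?_⟩
  · intro i
    induction i using Nat.strong_induction_on with
    | _ i ih =>
      intro hi
      have e : T.F^[i + 1] T.v = T.v := by rw [Function.iterate_succ_apply', hi, T.Fc]
      have h1 := ho (i + 1)
      have h0 := ho i
      rw [e] at h1
      rw [hi] at h0
      have k1 : κ (i + 1) = 2 := by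
        rcases Top.fin3 (κ (i + 1)) with h | h | h
        · rw [h, Top.lap0] at h1; linarith [h1.2]
        · rw [h, Top.lap1] at h1; linarith [h1.2]
        · exact h
      have k0 : κ i ≠ 2 := by
        intro h; rw [h, Top.lap2] at h0; linarith [h0.1]
      have hw : wt i ≠ 0 := by
        intro h
        exact Met.okp_nr (hk.nr i h) ⟨k0, k1⟩
      obtain ⟨A, hA⟩ := Nat.exists_eq_succ_of_ne_zero hw
      have hr := hk.ret i A hA
      refine ih A (by have := hr.le; omega) ?_
      have h2 := ho (i + 1 + A)
      rw [hr.e0, add_comm, Function.iterate_add_apply, e, Top.lap0] at h2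
      have h3 := ho A
      rw [hr.k0, Top.lap1] at h3
      exact le_antisymm h2.2 h3.1
  · intro i hi
    obtain ⟨j, hj, -, hz⟩ := hk.zero (i + 1)
    obtain ⟨t, rfl⟩ : ∃ t, j = t + (i + 1) := ⟨j - (i + 1), by omega⟩
    have h1 := ho (t + (i + 1))
    rw [Function.iterate_add_apply, Function.iterate_succ_apply', hi, T.Fd, Top.iter_l] at h1
    rcases Top.fin3 (κ (t + (i + 1))) with h | h | h
    · exact hz h
    · rw [h, Top.lap1] at h1; linarith [h1.1]
    · rw [h, Top.lap2] at h1; linarith [h1.1]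

/-- recurrence of the turning point `c` -/
lemma Kn.rec_c (hk : Kn M q κ wt) (ho : T.Orb κ T.v) (hE : T.Expansive) (ε : ℝ) (hε : 0 < ε)
    (N : ℕ) : ∃ n, N ≤ n ∧ 1 ≤ n ∧ |T.F^[n] T.c - T.c| < ε := by
  have hlc := T.lc
  have hcd := T.cd
  have hdr := T.dr
  let J : ℕ → Set ℝ := fun n => {z ∈ Icc T.c T.d | ε ≤ |z - T.c| ∧ ∀ t < n, T.F^[t + 1] z ∈ T.lap (κ t)}
  have hsub : Icc T.c T.d ⊆ Icc T.l T.r := Icc_subset_Icc hlc.le hdr.le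
  have hJc : ∀ n, IsClosed (J n) := by
    intro n
    have : J n = (Icc T.c T.d ∩ {z | ε ≤ |z - T.c|}) ∩
        ⋂ t ∈ Iio n, Icc T.c T.d ∩ (T.F^[t + 1]) ⁻¹' (T.lap (κ t)) := by
      ext z
      simp only [J, mem_ofPred_eq, mem_inter_iff, mem_iInter, mem_Iio, mem_preimage]
      constructor
      · rintro ⟨a, b, c⟩; exact ⟨⟨a, b⟩, fun i hi => ⟨a, c i hi⟩⟩
      · rintro ⟨⟨a, b⟩, c⟩; exact ⟨a, b, fun i hi => (c i hi).2⟩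
    rw [this]
    refine IsClosed.inter (isClosed_Icc.inter (isClosed_le continuous_const (by fun_prop))) ?_
    refine isClosed_biInter fun t _ => ?_
    exact ((T.cont_iter (t + 1)).mono hsub).preimage_isClosed_of_isClosed isClosed_Icc (T.lap_closed _)
  have hemp : ∃ n, ¬ (J n).Nonempty := by
    by_contra hc
    push Not at hc
    have hi := IsCompact.nonempty_iInter_of_sequence_nonempty_isCompact_isClosed J
      (fun n z hz => ⟨hz.1, hz.2.1, fun t ht => hz.2.2 t (by omega)⟩) hc
      (isCompact_Icc.of_isClosed_subset (hJc 0) (fun z hz => hz.1)) hJc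
    obtain ⟨z, hz⟩ := hi
    rw [mem_iInter] at hz
    have horb : T.Orb κ (T.F z) := by
      intro t
      have := (hz (t + 1)).2.2 t (by omega)
      rwa [Function.iterate_succ_apply] at this
    have h1 := hE κ _ _ horb ho
    have h2 := Top.eq_c_of (Or.inr rfl) (by rw [Top.lap1]; exact (hz 0).1) h1
    have h3 := (hz 0).2.1
    rw [h2] at h3; simp at h3; linarith
  obtain ⟨n, hn⟩ := hemp
  obtain ⟨i, A, hA, hw⟩ := hk.deep (max n N)
  have hr := hk.ret i A hw
  refine ⟨i + 1, by have := hr.le; omega, by omega, ?_⟩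
  by_contra hc
  push Not at hc
  rw [Function.iterate_succ_apply, T.Fc] at hc
  have h1 := ho i
  rw [hr.h1, Top.lap1] at h1
  apply hn
  refine ⟨T.F^[i] T.v, h1, hc, fun t ht => ?_⟩
  have h2 := ho (i + 1 + t)
  rw [(hr.agr t (by omega)).1] at h2
  rwa [← Function.iterate_add_apply, show t + 1 + i = i + 1 + t by ring]

end
end RCE

namespace RCE

/-! ### Part 6 : the one parameter families and realization of the kneading sequence -/

structure Fam where
  e : ℕ
  p : ℝ → ℝ
  q : ℝ → ℝ
  k : ℝ
  β : ℝ
  Q : ℝ → ℝ → ℝ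
  K : ℝ
  he : Even e
  e2 : 2 ≤ e
  hp : ∀ Y, HasDerivAt p (k * (Y ^ 2 - 1) ^ (e - 1)) Y
  kp : 0 < k
  β1 : 1 < β
  fac1 : ∀ Y, 1 + p Y = (Y - 1) ^ e * (Y + β) * q Y
  fac2 : ∀ Y, 1 - p Y = (Y + 1) ^ e * (β - Y) * q (-Y)
  qc : Continuous q
  qpos : ∀ Y, 0 < q Y
  hQ : ∀ B z, (B - z) * Q B z = p B - p z
  Kp : 0 < K
  QLip : ∀ B z, B ∈ Icc β (β + 1 / 2) → z ∈ Icc (-β) (β + 1 / 2) →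
    |Q B z - (z + 1) ^ e * q (-z)| ≤ K * (B - β)
  bend : 2 * (β + 1 / 2 + β) ≤ (1 + β) * (1 + p (β + 1 / 2))

lemma exists_inv {p : ℝ → ℝ} (hp : Continuous p) {a b : ℝ} (hab : a ≤ b)
    (hm : StrictMonoOn p (Icc a b)) :
    ∃ ψ : ℝ → ℝ, Continuous ψ ∧ ∀ y, ψ y ∈ Icc a b ∧ p (ψ y) = max (p a) (min (p b) y) := by
  have hle : p a ≤ p b := hm.monotoneOn ⟨le_rfl, hab⟩ ⟨hab, le_rfl⟩ hab
  have hex : ∀ y, ∃ x : Icc a b, p x = max (p a) (min (p b) y) := by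
    intro y
    have := intermediate_value_Icc hab hp.continuousOn
      (show max (p a) (min (p b) y) ∈ Icc (p a) (p b) from
        ⟨le_max_left _ _, max_le hle (min_le_left _ _)⟩)
    obtain ⟨x, hx, h⟩ := this
    exact ⟨⟨x, hx⟩, h⟩
  choose ψ hψ using hex
  have hmono : Monotone ψ := by
    intro y y' h
    by_contra hc
    push Not at hc
    have h1 := hm (ψ y').2 (ψ y).2 hc
    rw [hψ, hψ] at h1
    have : max (p a) (min (p b) y) ≤ max (p a) (min (p b) y') := by gcongr
    linarith
  have hs : Function.Surjective ψ := by
    intro x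
    refine ⟨p x, ?_⟩
    apply Subtype.ext
    apply hm.injOn (ψ (p x)).2 x.2
    rw [hψ, min_eq_right (hm.monotoneOn x.2 ⟨hab, le_rfl⟩ x.2.2),
      max_eq_right (hm.monotoneOn ⟨le_rfl, hab⟩ x.2 x.2.1)]
  exact ⟨fun y => ψ y, continuous_subtype_val.comp (hmono.continuous_of_surjective hs),
    fun y => ⟨(ψ y).2, hψ y⟩⟩

namespace Fam
variable (S : Fam)

lemma odd_e : Odd (S.e - 1) := by
  obtain ⟨r, hr⟩ := S.he
  have := S.e2
  exact ⟨r - 1, by omega⟩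

lemma e0 : S.e ≠ 0 := by have := S.e2; omega

lemma p1 : S.p 1 = -1 := by have := S.fac1 1; simp [S.e0] at this; linarith
lemma pm1 : S.p (-1) = 1 := by have := S.fac2 (-1); simp [S.e0] at this; linarith
lemma pβ : S.p S.β = 1 := by have := S.fac2 S.β; simp at this; linarith
lemma pmβ : S.p (-S.β) = -1 := by have := S.fac1 (-S.β); simp at this; linarith

lemma pcont : Continuous S.p := continuous_iff_continuousAt.2 fun Y => (S.hp Y).continuousAt
lemma pderiv (Y : ℝ) : deriv S.p Y = S.k * (Y ^ 2 - 1) ^ (S.e - 1) := (S.hp Y).deriv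

lemma mono0 : StrictMonoOn S.p (Iic (-1)) := by
  refine strictMonoOn_of_deriv_pos (convex_Iic _) S.pcont.continuousOn fun x hx => ?_
  rw [interior_Iic, mem_Iio] at hx
  rw [S.pderiv]
  have : 0 < x ^ 2 - 1 := by nlinarith
  have := S.kp
  positivity

lemma mono2 : StrictMonoOn S.p (Ici 1) := by
  refine strictMonoOn_of_deriv_pos (convex_Ici _) S.pcont.continuousOn fun x hx => ?_
  rw [interior_Ici, mem_Ioi] at hx
  rw [S.pderiv]
  have : 0 < x ^ 2 - 1 := by nlinarith
  have := S.kp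
  positivity

lemma anti1 : StrictAntiOn S.p (Icc (-1) 1) := by
  refine strictAntiOn_of_deriv_neg (convex_Icc _ _) S.pcont.continuousOn fun x hx => ?_
  rw [interior_Icc, mem_Ioo] at hx
  rw [S.pderiv]
  have : x ^ 2 - 1 < 0 := by nlinarith
  exact mul_neg_of_pos_of_neg S.kp (S.odd_e.pow_neg this)

def θ (B : ℝ) : ℝ := (B + S.β) / (1 + S.p B)
def F (B : ℝ) (Y : ℝ) : ℝ := -S.β + S.θ B * (1 + S.p Y)
def v (B : ℝ) : ℝ := -S.β + 2 * S.θ B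

variable {S} {B : ℝ} (hB : S.β ≤ B)
include hB

lemma pB : 1 ≤ S.p B := by
  have := S.mono2.monotoneOn (mem_Ici.2 S.β1.le) (mem_Ici.2 (S.β1.le.trans hB)) hB
  rwa [S.pβ] at this

lemma θpos : 0 < S.θ B := by
  have h1 := pB hB
  have h2 := S.β1
  unfold θ
  apply div_pos <;> linarith

lemma θmul : S.θ B * (1 + S.p B) = B + S.β := by
  have h1 := pB hB
  unfold θ
  field_simp

def top : Top where
  F := S.F B
  l := -S.β
  c := -1
  d := 1
  r := B
  v := S.v B
  lc := by have := S.β1; linarith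
  cd := by norm_num
  dr := lt_of_lt_of_le S.β1 hB
  cont := by
    have := S.pcont
    unfold F
    fun_prop
  m0 := by
    intro x hx y hy h
    have h1 := S.mono0 (mem_Iic.2 hx.2) (mem_Iic.2 hy.2) h
    have := θpos hB
    simp only [F]; gcongr
  m1 := by
    intro x hx y hy h
    have h1 := S.anti1 hx hy h
    have := θpos hB
    simp only [F]; gcongr
  m2 := by
    intro x hx y hy h
    have h1 := S.mono2 (mem_Ici.2 hx.1) (mem_Ici.2 hy.1) h
    have := θpos hB
    simp only [F]; gcongr
  Fl := by simp [F, S.pmβ]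
  Fc := by simp [F, S.pm1, v]; ring
  Fd := by simp [F, S.p1]
  Fr := by simp [F, θmul hB]
  vr := by
    have h1 := pB hB
    have h2 := θmul hB
    have h3 := θpos hB
    simp only [v]
    nlinarith

omit hB

lemma b1 (S : Fam) : S.β ≤ S.β + 1 / 2 := by linarith

lemma exists_psi (S : Fam) : ∃ ψ : Fin 3 → ℝ → ℝ, (∀ a, Continuous (ψ a)) ∧
    (∀ y, ψ 0 y ∈ Icc (-S.β) (-1) ∧ S.p (ψ 0 y) = max (-1) (min 1 y)) ∧
    (∀ y, ψ 1 y ∈ Icc (-1) 1 ∧ S.p (ψ 1 y) = min 1 (max (-1) y)) ∧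
    (∀ y, ψ 2 y ∈ Icc 1 (S.β + 1 / 2) ∧ S.p (ψ 2 y) = max (-1) (min (S.p (S.β + 1 / 2)) y)) := by
  have hβ := S.β1
  obtain ⟨ψ0, c0, h0⟩ := exists_inv S.pcont (a := -S.β) (b := -1) (by linarith)
    (S.mono0.mono Icc_subset_Iic_self)
  obtain ⟨ψ1, c1, h1⟩ := exists_inv (p := fun y => - S.p y) S.pcont.neg (a := -1) (b := 1) (by linarith)
    (fun x hx y hy h => neg_lt_neg (S.anti1 hx hy h))
  obtain ⟨ψ2, c2, h2⟩ := exists_inv S.pcont (a := 1) (b := S.β + 1 / 2) (by linarith)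
    (S.mono2.mono Icc_subset_Ici_self)
  refine ⟨![ψ0, fun y => ψ1 (-y), ψ2], ?_, ?_, ?_, ?_⟩
  · intro a
    rcases Top.fin3 a with rfl | rfl | rfl
    · exact c0
    · exact c1.comp continuous_neg
    · exact c2
  · intro y
    have := h0 y
    rw [S.pmβ, S.pm1] at this
    exact this
  · intro y
    have := h1 (-y)
    rw [S.p1, S.pm1] at this
    refine ⟨this.1, ?_⟩
    show S.p (ψ1 (-y)) = _
    rw [← neg_neg (S.p (ψ1 (-y))), this.2, ← min_neg_neg, neg_neg, ← max_neg_neg, neg_neg]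
  · intro y
    have := h2 y
    rw [S.p1] at this
    exact this

def zz (S : Fam) (ψ : Fin 3 → ℝ → ℝ) : ℕ → (ℕ → Fin 3) → ℝ → ℝ
  | 0, _, _ => -S.β
  | n + 1, s, B => ψ (s 0) ((zz S ψ n (sh s) B + S.β) / S.θ B - 1)

lemma θcont (S : Fam) : ContinuousOn S.θ (Ici S.β) := by
  unfold θ
  refine ContinuousOn.div (by fun_prop) (continuousOn_const.add S.pcont.continuousOn) ?_
  intro B hB
  have := pB (S := S) hB
  linarith

lemma vcont (S : Fam) : ContinuousOn S.v (Ici S.β) := by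
  have := S.θcont
  unfold v
  fun_prop

lemma zz_cont (S : Fam) {ψ : Fin 3 → ℝ → ℝ} (hψ : ∀ a, Continuous (ψ a)) :
    ∀ n s, ContinuousOn (S.zz ψ n s) (Ici S.β)
  | 0, s => by simp only [zz]; exact continuousOn_const
  | n + 1, s => by
    simp only [zz]
    refine (hψ (s 0)).comp_continuousOn ?_
    exact (((zz_cont S hψ n (sh s)).add continuousOn_const).div S.θcont
      (fun B hB => (θpos (S := S) hB).ne')).sub continuousOn_const

lemma iter_cont (S : Fam) (i : ℕ) : ContinuousOn (fun B => (S.F B)^[i] (S.v B)) (Ici S.β) := by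
  induction i with
  | zero => exact S.vcont
  | succ i ih =>
    simp only [Function.iterate_succ_apply']
    have h1 := S.θcont
    have h2 := S.pcont.comp_continuousOn ih
    exact continuousOn_const.add (h1.mul (continuousOn_const.add h2))

lemma zz_mem (S : Fam) {ψ : Fin 3 → ℝ → ℝ}
    (h0 : ∀ y, ψ 0 y ∈ Icc (-S.β) (-1) ∧ S.p (ψ 0 y) = max (-1) (min 1 y))
    (h1 : ∀ y, ψ 1 y ∈ Icc (-1) 1 ∧ S.p (ψ 1 y) = min 1 (max (-1) y))
    (h2 : ∀ y, ψ 2 y ∈ Icc 1 (S.β + 1 / 2) ∧ S.p (ψ 2 y) = max (-1) (min (S.p (S.β + 1 / 2)) y))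
    {B : ℝ} (hB : S.β ≤ B) (hB2 : B ≤ S.β + 1 / 2) {z : ℝ} (hz : z ∈ Icc (-S.β) B) (a : Fin 3) :
    ψ a ((z + S.β) / S.θ B - 1) ∈ (top hB).lap a ∧
      S.F B (ψ a ((z + S.β) / S.θ B - 1)) = if a = 2 then z else min z (S.v B) := by
  have hθ := θpos hB
  have hm := θmul hB
  have hβ := S.β1
  set y := (z + S.β) / S.θ B - 1 with hy
  have hyz : S.θ B * (1 + y) = z + S.β := by rw [hy]; field_simp; ring
  have hy1 : -1 ≤ y := by
    rw [hy]
    have : 0 ≤ (z + S.β) / S.θ B := div_nonneg (by linarith [hz.1]) hθ.le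
    linarith
  have hy2 : y ≤ S.p B := by
    have : S.θ B * (1 + y) ≤ S.θ B * (1 + S.p B) := by rw [hyz, hm]; linarith [hz.2]
    have := le_of_mul_le_mul_left this hθ
    linarith
  have hmin : -S.β + S.θ B * (1 + min 1 y) = min z (S.v B) := by
    unfold v
    rcases le_total 1 y with h | h
    · rw [min_eq_left h, min_eq_right]
      · ring
      · nlinarith
    · rw [min_eq_right h, min_eq_left]
      · linarith
      · nlinarith
  rcases Top.fin3 a with rfl | rfl | rfl
  · obtain ⟨m, e⟩ := h0 y
    refine ⟨by simpa [top] using m, ?_⟩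
    have : S.p (ψ 0 y) = min 1 y := by rw [e, max_eq_right]; exact le_min (by norm_num) hy1
    simp [F, this, hmin]
  · obtain ⟨m, e⟩ := h1 y
    refine ⟨by simpa [top] using m, ?_⟩
    have : S.p (ψ 1 y) = min 1 y := by rw [e, max_eq_right hy1]
    simp [F, this, hmin]
  · obtain ⟨m, e⟩ := h2 y
    have hpp : S.p B ≤ S.p (S.β + 1 / 2) :=
      S.mono2.monotoneOn (mem_Ici.2 (by linarith)) (mem_Ici.2 (by linarith)) hB2
    have : S.p (ψ 2 y) = y := by
      rw [e, min_eq_right (hy2.trans hpp), max_eq_right hy1]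
    refine ⟨?_, ?_⟩
    · have hle : ψ 2 y ≤ B := by
        by_contra hc
        push Not at hc
        have := S.mono2 (mem_Ici.2 (by linarith)) (mem_Ici.2 m.1) hc
        linarith
      simpa [top] using ⟨m.1, hle⟩
    · simp only [F, this, if_true]; linarith

lemma approx (S : Fam) {M q : ℕ} {κ : ℕ → Fin 3} {wt : ℕ → ℕ} (hk : Kn M q κ wt) (hM : 1 ≤ M) (N : ℕ) :
    ∃ B, ∃ h : B ∈ Icc S.β (S.β + 1 / 2), ∀ i ≤ N, (S.F B)^[i] (S.v B) ∈ (top h.1).lap (κ i) := by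
  obtain ⟨ψ, hψ, h0, h1, h2⟩ := S.exists_psi
  obtain ⟨n, hn, hcut⟩ := hk.cut N
  have hβ := S.β1
  have hmem : ∀ (m : ℕ) (s : ℕ → Fin 3) (B : ℝ), S.β ≤ B → B ≤ S.β + 1 / 2 →
      S.zz ψ m s B ∈ Icc (-S.β) B := by
    intro m
    induction m with
    | zero => intro s B hB _; simp only [zz]; exact ⟨le_rfl, by linarith⟩
    | succ m ih =>
      intro s B hB hB2
      exact (top hB).lap_sub _ (S.zz_mem h0 h1 h2 hB hB2 (ih (sh s) B hB hB2) (s 0)).1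
  have hk0 : κ 0 = 2 := hk.two 0 (by omega)
  -- choice of the parameter
  obtain ⟨B, hBm, hBv⟩ : ∃ B ∈ Icc S.β (S.β + 1 / 2), S.v B - S.zz ψ (n + 1) κ B = 0 := by
    have hc : ContinuousOn (fun B => S.v B - S.zz ψ (n + 1) κ B) (Icc S.β (S.β + 1 / 2)) :=
      (S.vcont.sub (S.zz_cont hψ (n + 1) κ)).mono Icc_subset_Ici_self
    have := intermediate_value_Icc' S.b1 hc
    refine this ⟨?_, ?_⟩
    · have e1 : 1 ≤ S.zz ψ (n + 1) κ (S.β + 1 / 2) := by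
        simp only [zz, hk0]; exact (h2 _).1.1
      have e2 : S.v (S.β + 1 / 2) ≤ 1 := by
        have hp := pB S.b1
        have := S.bend
        unfold v θ
        rw [← sub_nonneg]
        have : 0 ≤ 1 + S.β - 2 * ((S.β + 1 / 2 + S.β) / (1 + S.p (S.β + 1 / 2))) := by
          rw [sub_nonneg, ← mul_div_assoc, div_le_iff₀ (by linarith)]; linarith
        linarith
      linarith
    · have e1 := (hmem (n + 1) κ S.β le_rfl S.b1).2
      have e2 : S.v S.β = S.β := by unfold v θ; rw [S.pβ]; ring
      linarith
  refine ⟨B, hBm, ?_⟩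
  set T := top hBm.1
  set y : ℕ → ℝ := fun i => S.zz ψ (n + 1 - i) (shn i κ) B with hy
  have hstep : ∀ i ≤ n, y i ∈ T.lap (κ i) ∧ S.F B (y i) = if κ i = 2 then y (i + 1) else min (y (i + 1)) (S.v B) := by
    intro i hi
    have := S.zz_mem h0 h1 h2 hBm.1 hBm.2 (hmem (n - i) (shn (i + 1) κ) B hBm.1 hBm.2) (κ i)
    have e1 : n + 1 - i = (n - i) + 1 := by omega
    have e2 : n + 1 - (i + 1) = n - i := by omega
    have e3 : sh (shn i κ) = shn (i + 1) κ := by funext t; simp [sh, shn]; congr 1; omega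
    simp only [hy, e1, e2, zz, e3]
    simpa [shn] using this
  have hch : T.Ch κ n y := ⟨fun i hi => (hstep i hi).1, fun i hi => (hstep i hi.le).2⟩
  have hy0 : y 0 = S.v B := by
    have : shn 0 κ = κ := by funext t; simp [shn]
    simp only [hy, this]; simpa using (sub_eq_zero.1 hBv).symm
  have hy01 : 1 ≤ y 0 := by
    have := hch.1 0 (by omega)
    rw [hk0, T.lap2] at this
    exact this.1
  have hle : ∀ i < n, κ i ≠ 2 → y (i + 1) ≤ S.v B := by
    intro i hi h2'
    rw [← hy0]
    rcases hw : wt i with _ | A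
    · have hok := hk.nr i hw
      have h3 : κ (i + 1) ≠ 2 := by
        intro h4
        rw [h4] at hok
        rcases Top.fin3 (κ i) with h | h | h
        · rw [h] at hok; simp [okp] at hok
        · rw [h] at hok; simp [okp] at hok
        · exact h2' h
      have h4 : y (i + 1) ≤ 1 := by
        have h5 := hch.1 (i + 1) (by omega)
        rcases Top.fin3 (κ (i + 1)) with h | h | h
        · rw [h, T.lap0] at h5
          have := h5.2
          have e : T.c = -1 := rfl
          linarith
        · rw [h, T.lap1] at h5; exact h5.2
        · exact absurd h h3
      linarith
    · have hs := hk.sgn hw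
      have hlt := hcut i hi A hw
      have c1 : T.Ch κ (i + 1 + (n - (i + 1))) y := by
        have : i + 1 + (n - (i + 1)) = n := by omega
        rw [this]; exact hch
      exact T.ch_le A (c1.shiftn (i + 1)) hch (by omega) (by omega) hs
  have horb : ∀ i ≤ n, (S.F B)^[i] (S.v B) = y i := by
    intro i
    induction i with
    | zero => intro _; exact hy0.symm
    | succ i ih =>
      intro hi
      rw [Function.iterate_succ_apply', ih (by omega), (hstep i (by omega)).2]
      split_ifs with h
      · rfl
      · exact min_eq_left (hle i (by omega) h)
  intro i hi
  rw [horb i (by omega)]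
  exact hch.1 i (by omega)

lemma slope (S : Fam) {x y B : ℝ} (hx : 1 ≤ x) (hxy : x ≤ y) (hyB : y ≤ B) (hxB : x < B) :
    (S.p B - S.p x) * (B - y) ≤ (S.p B - S.p y) * (B - x) := by
  have hcv : ConvexOn ℝ (Ici 1) S.p := by
    refine MonotoneOn.convexOn_of_deriv (convex_Ici 1) S.pcont.continuousOn
      (fun x _ => (S.hp x).differentiableAt.differentiableWithinAt) ?_
    rw [interior_Ici]
    intro a ha b hb hab
    rw [mem_Ioi] at ha hb
    rw [S.pderiv, S.pderiv]
    have := S.kp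
    have : 0 ≤ a ^ 2 - 1 := by nlinarith
    have : a ^ 2 - 1 ≤ b ^ 2 - 1 := by nlinarith
    gcongr
  rcases eq_or_lt_of_le hyB with rfl | hyB
  · simp
  have := hcv.secant_mono (a := B) (x := x) (y := y) (mem_Ici.2 (by linarith)) (mem_Ici.2 hx) (mem_Ici.2 (by linarith))
    hxB.ne hyB.ne hxy
  have e1 : (S.p x - S.p B) / (x - B) = (S.p B - S.p x) / (B - x) := by
    rw [← neg_sub, ← neg_sub B x, neg_div_neg_eq]
  have e2 : (S.p y - S.p B) / (y - B) = (S.p B - S.p y) / (B - y) := by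
    rw [← neg_sub, ← neg_sub B y, neg_div_neg_eq]
  rwa [e1, e2, div_le_div_iff₀ (by linarith) (by linarith)] at this

def Cs (S : Fam) : ℝ := (S.β - 1) * (1 + S.p (S.β + 1 / 2)) * (2 * S.β + 1 / 2) / (4 * S.β)

theorem realize (S : Fam) {M q : ℕ} {κ : ℕ → Fin 3} {wt : ℕ → ℕ} (hk : Kn M q κ wt) (hM : 1 ≤ M) :
    ∃ B, S.β < B ∧ B ≤ S.β + 1 / 2 ∧ (B - S.β) * 2 ^ M ≤ S.Cs ∧
      ∀ hB : S.β ≤ B, (top hB).Orb κ (S.v B) := by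
  have hβ := S.β1
  choose Bs hm horb using S.approx hk hM
  obtain ⟨B, hB, φ, hφ, hlim⟩ := isCompact_Icc.tendsto_subseq hm
  have horbB : (top hB.1).Orb κ (S.v B) := by
    intro i
    have hti : Filter.Tendsto (fun n => (S.F (Bs (φ n)))^[i] (S.v (Bs (φ n)))) Filter.atTop
        (nhds ((S.F B)^[i] (S.v B))) := by
      refine ((S.iter_cont i) B hB.1).tendsto.comp ?_
      exact tendsto_nhdsWithin_iff.2 ⟨hlim, Filter.Eventually.of_forall fun n => (hm _).1⟩
    have hev : ∀ᶠ n in Filter.atTop, (S.F (Bs (φ n)))^[i] (S.v (Bs (φ n))) ∈ (top (hm (φ n)).1).lap (κ i) := by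
      filter_upwards [Filter.eventually_ge_atTop i] with n hn
      exact horb (φ n) i (hn.trans (hφ.id_le n))
    show (S.F B)^[i] (S.v B) ∈ _
    rcases Top.fin3 (κ i) with h | h | h
    · rw [h] at hev ⊢
      simp only [Top.lap0] at hev ⊢
      exact isClosed_Icc.mem_of_tendsto hti hev
    · rw [h] at hev ⊢
      simp only [Top.lap1] at hev ⊢
      exact isClosed_Icc.mem_of_tendsto hti hev
    · rw [h] at hev ⊢
      simp only [Top.lap2] at hev ⊢
      refine ⟨ge_of_tendsto hti (hev.mono fun n hn => hn.1), le_of_tendsto_of_tendsto hti hlim ?_⟩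
      exact hev.mono fun n hn => hn.2
  have hlt : S.β < B := by
    rcases eq_or_lt_of_le hB.1 with h | h
    · exfalso
      subst h
      have e2 : S.v S.β = S.β := by unfold v θ; rw [S.pβ]; ring
      have e3 : ∀ i, (S.F S.β)^[i] S.β = S.β := by
        intro i
        exact Function.iterate_fixed ((top (le_refl S.β)).Fr) i
      have := horbB M
      rw [hk.one, Top.lap1, e2] at this
      have h3 : (top hB.1).F^[M] S.β = S.β := e3 M
      rw [h3] at this
      have h4 : S.β ≤ 1 := this.2
      linarith
    · exact h
  refine ⟨B, hlt, hB.2, ?_, fun _ => horbB⟩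
  have hθ := θpos hB.1
  have hmul := θmul hB.1
  have hp := pB hB.1
  have hstep : ∀ z, 1 ≤ z → z ≤ B → 2 * (B - z) ≤ B - S.F B z := by
    intro z h1 h2
    have hs := S.slope le_rfl h1 h2 (by linarith)
    rw [S.p1] at hs
    have : S.θ B * ((S.p B + 1) * (B - z)) ≤ S.θ B * ((S.p B - S.p z) * (B - 1)) :=
      mul_le_mul_of_nonneg_left (by linarith) hθ.le
    have e : B - S.F B z = S.θ B * (S.p B - S.p z) := by unfold F; linarith
    have h3 : (B + S.β) * (B - z) ≤ (B - S.F B z) * (B - 1) := by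
      rw [e, ← hmul]; linarith
    have h4 : 2 * (B - 1) ≤ B + S.β := by linarith [hB.2]
    have h5 : 2 * (B - z) * (B - 1) ≤ (B - S.F B z) * (B - 1) := by nlinarith
    exact le_of_mul_le_mul_right h5 (by linarith)
  have hpow : ∀ i ≤ M, 2 ^ i * (B - S.v B) ≤ B - (S.F B)^[i] (S.v B) := by
    intro i
    induction i with
    | zero => intro _; simp
    | succ i ih =>
      intro hi
      have h1 := ih (by omega)
      have h2 := horbB i
      rw [hk.two i (by omega), Top.lap2] at h2
      have h3 := hstep ((S.F B)^[i] (S.v B)) h2.1 h2.2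
      rw [Function.iterate_succ_apply', pow_succ]
      linarith
  have h1 := hpow M le_rfl
  have h2 : -S.β ≤ (S.F B)^[M] (S.v B) := ((top hB.1).maps_iter (top hB.1).v_mem M).1
  have h3 : 2 ^ M * (B - S.v B) ≤ 2 * S.β + 1 / 2 := by linarith [hB.2]
  have h4 := S.slope le_rfl hβ.le hB.1 (by linarith : (1:ℝ) < B)
  rw [S.pβ, S.p1] at h4
  have hs : 2 * (B - S.β) ≤ (S.p B - 1) * (S.β - 1) := by nlinarith
  have e : (B - S.v B) * (1 + S.p B) = (B + S.β) * (S.p B - 1) := by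
    unfold v
    have : (B - (-S.β + 2 * S.θ B)) * (1 + S.p B) = (B + S.β) * (1 + S.p B) - 2 * (S.θ B * (1 + S.p B)) := by ring
    rw [this, hmul]; ring
  have hpp : S.p B ≤ S.p (S.β + 1 / 2) :=
      S.mono2.monotoneOn (mem_Ici.2 (by linarith)) (mem_Ici.2 (by linarith)) hB.2
  have hv : 0 ≤ B - S.v B := by have := (top hB.1).vr; exact sub_nonneg.2 this
  have h5 : 4 * S.β * (B - S.β) ≤ (S.β - 1) * (1 + S.p (S.β + 1 / 2)) * (B - S.v B) := by
    calc 4 * S.β * (B - S.β) = 2 * S.β * (2 * (B - S.β)) := by ring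
      _ ≤ (B + S.β) * ((S.p B - 1) * (S.β - 1)) :=
        mul_le_mul (by linarith) hs (by linarith) (by linarith)
      _ = (S.β - 1) * ((B - S.v B) * (1 + S.p B)) := by rw [e]; ring
      _ ≤ (S.β - 1) * ((B - S.v B) * (1 + S.p (S.β + 1 / 2))) := by
        apply mul_le_mul_of_nonneg_left _ (by linarith)
        apply mul_le_mul_of_nonneg_left _ hv; linarith
      _ = _ := by ring
  unfold Cs
  rw [le_div_iff₀ (by linarith)]
  have h6 : 0 ≤ (S.β - 1) * (1 + S.p (S.β + 1 / 2)) := mul_nonneg (by linarith) (by linarith)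
  calc (B - S.β) * 2 ^ M * (4 * S.β) = 2 ^ M * (4 * S.β * (B - S.β)) := by ring
    _ ≤ 2 ^ M * ((S.β - 1) * (1 + S.p (S.β + 1 / 2)) * (B - S.v B)) := by gcongr
    _ = (S.β - 1) * (1 + S.p (S.β + 1 / 2)) * (2 ^ M * (B - S.v B)) := by ring
    _ ≤ _ := mul_le_mul_of_nonneg_left h3 h6

end Fam
end RCE

namespace RCE

/-! ### Part 7 : the adapted metric -/

namespace Fam
variable (S : Fam)

def a : ℝ := 1 - 1 / (S.e : ℝ)
def ρ (B s : ℝ) : ℝ := ((s + S.β) * (B - s)) ^ (-S.a)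
def F' (B z : ℝ) : ℝ := S.θ B * (S.k * (z ^ 2 - 1) ^ (S.e - 1))
def R (B z : ℝ) : ℝ := |S.F' B z| * S.ρ B (S.F B z) / S.ρ B z

lemma ep : (0:ℝ) < S.e := by have := S.e2; positivity
lemma ae : S.a * S.e = ((S.e - 1 : ℕ) : ℝ) := by
  have := S.e2
  have h := S.ep
  rw [Nat.cast_sub (by omega)]
  unfold a
  field_simp
  simp
lemma a0 : 0 < S.a := by
  have := S.ae
  have h := S.ep
  have h2 : (0:ℝ) < ((S.e - 1 : ℕ) : ℝ) := by have := S.e2; exact_mod_cast (by omega : 0 < S.e - 1)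
  rw [← this] at h2
  exact pos_of_mul_pos_left h2 h.le
lemma a1 : S.a < 1 := by
  have h := S.ep
  unfold a
  have : 0 < 1 / (S.e : ℝ) := by positivity
  linarith

lemma hF (B z : ℝ) : HasDerivAt (S.F B) (S.F' B z) z := by
  unfold F F'
  have := ((S.hp z).const_add 1).const_mul (S.θ B)
  exact this.const_add _

lemma ρpos {B s : ℝ} (h1 : -S.β < s) (h2 : s < B) : 0 < S.ρ B s := by
  unfold ρ
  apply Real.rpow_pos_of_pos
  apply mul_pos <;> linarith

lemma p_le {z : ℝ} (h : z ≤ S.β) : S.p z ≤ 1 := by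
  have h1 := S.fac2 z
  have h2 := S.qpos (-z)
  have h3 : 0 ≤ (z + 1) ^ S.e := S.he.pow_nonneg _
  have h4 : 0 ≤ (z + 1) ^ S.e * (S.β - z) * S.q (-z) := by
    apply mul_nonneg (mul_nonneg h3 (by linarith)) h2.le
  linarith

lemma p_lt {B z : ℝ} (hB : S.β < B) (h : z < B) : S.p z < S.p B := by
  have hβ := S.β1
  rcases le_total z S.β with h1 | h1
  · have h2 := S.p_le h1
    have := S.mono2 (mem_Ici.2 hβ.le) (mem_Ici.2 (by linarith)) hB
    rw [S.pβ] at this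
    linarith
  · exact S.mono2 (mem_Ici.2 (by linarith)) (mem_Ici.2 (by linarith)) h

lemma Qpos {B z : ℝ} (hB : S.β < B) (h : z < B) : 0 < S.Q B z := by
  have h1 := S.p_lt hB h
  have h2 := S.hQ B z
  by_contra hc
  push Not at hc
  have : (B - z) * S.Q B z ≤ 0 := mul_nonpos_of_nonneg_of_nonpos (by linarith) hc
  linarith

lemma F_low (B z : ℝ) : S.F B z + S.β = S.θ B * ((z - 1) ^ S.e * (z + S.β) * S.q z) := by
  unfold F; rw [S.fac1]; ring

lemma F_up {B z : ℝ} (hB : S.β ≤ B) : B - S.F B z = S.θ B * ((B - z) * S.Q B z) := by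
  have := θmul hB
  rw [S.hQ]; unfold F; linarith

lemma F_gt {B z : ℝ} (hB : S.β ≤ B) (h : -S.β < z) (h1 : z ≠ 1) : -S.β < S.F B z := by
  have h2 := S.F_low B z
  have h3 : 0 < (z - 1) ^ S.e := S.he.pow_pos (sub_ne_zero.2 h1)
  have h4 := S.qpos z
  have h5 := θpos hB
  have : 0 < S.θ B * ((z - 1) ^ S.e * (z + S.β) * S.q z) :=
    mul_pos h5 (mul_pos (mul_pos h3 (by linarith)) h4)
  linarith

lemma F_lt {B z : ℝ} (hB : S.β < B) (h : z < B) : S.F B z < B := by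
  have h2 := S.F_up (z := z) hB.le
  have h5 := θpos hB.le
  have : 0 < S.θ B * ((B - z) * S.Q B z) :=
    mul_pos h5 (mul_pos (by linarith) (S.Qpos hB h))
  linarith

lemma R_nonneg (B z : ℝ) (hB : S.β < B) (h1 : -S.β < z) (h2 : z < B) (h3 : z ≠ 1) : 0 ≤ S.R B z := by
  unfold R
  have e1 := S.ρpos (S.F_gt hB.le h1 h3) (S.F_lt hB h2)
  have e2 := S.ρpos h1 h2
  positivity

lemma R_pow {B z : ℝ} (hB : S.β < B) (h1 : -S.β < z) (h2 : z < B) (h3 : z ≠ 1) :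
    S.R B z ^ S.e * (S.θ B ^ (S.e - 2) * (S.q z * S.Q B z) ^ (S.e - 1)) =
      S.k ^ S.e * ((z + 1) ^ S.e) ^ (S.e - 1) := by
  have hθ := θpos hB.le
  have hq := S.qpos z
  have hQ := S.Qpos hB h2
  have hz : 0 < (z - 1) ^ S.e := S.he.pow_pos (sub_ne_zero.2 h3)
  have he2 := S.e2
  set D := (z + S.β) * (B - z) with hD
  have hDp : 0 < D := mul_pos (by linarith) (by linarith)
  set W := S.θ B ^ 2 * (z - 1) ^ S.e * (S.q z * S.Q B z) with hW
  have hWp : 0 < W := by positivity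
  have hDF : (S.F B z + S.β) * (B - S.F B z) = W * D := by
    rw [S.F_low, S.F_up hB.le, hW, hD]; ring
  have hR : S.R B z = |S.F' B z| * W ^ (-S.a) := by
    unfold R ρ
    rw [hDF, ← hD, Real.mul_rpow hWp.le hDp.le]
    have : D ^ (-S.a) ≠ 0 := (Real.rpow_pos_of_pos hDp _).ne'
    field_simp
  have hWe : (W ^ (-S.a)) ^ S.e * W ^ (S.e - 1) = 1 := by
    rw [← Real.rpow_natCast, ← Real.rpow_mul hWp.le, neg_mul, S.ae, Real.rpow_neg hWp.le,
      Real.rpow_natCast]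
    field_simp
  have hF : |S.F' B z| ^ S.e = S.θ B ^ S.e * S.k ^ S.e * ((z - 1) ^ S.e) ^ (S.e - 1) * ((z + 1) ^ S.e) ^ (S.e - 1) := by
    rw [S.he.pow_abs]
    unfold F'
    have : z ^ 2 - 1 = (z - 1) * (z + 1) := by ring
    rw [this, mul_pow, mul_pow, mul_pow, mul_pow, ← pow_mul, ← pow_mul, ← pow_mul, ← pow_mul,
      mul_comm (S.e - 1)]
    ring
  have hWpow : W ^ (S.e - 1) = S.θ B ^ S.e * ((z - 1) ^ S.e) ^ (S.e - 1) *
      (S.θ B ^ (S.e - 2) * (S.q z * S.Q B z) ^ (S.e - 1)) := by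
    rw [hW, mul_pow, mul_pow, ← pow_mul]
    have : 2 * (S.e - 1) = S.e + (S.e - 2) := by omega
    rw [this, pow_add]
    ring
  have key : S.R B z ^ S.e * W ^ (S.e - 1) = |S.F' B z| ^ S.e := by
    rw [hR, mul_pow, mul_assoc, hWe, mul_one]
  rw [hWpow, hF] at key
  have hne : S.θ B ^ S.e * ((z - 1) ^ S.e) ^ (S.e - 1) ≠ 0 := by positivity
  apply mul_left_cancel₀ hne
  linarith

/-! #### the coordinate Φ -/

lemma ρ_int {B : ℝ} (hB : S.β < B) : IntervalIntegrable (S.ρ B) MeasureTheory.volume (-S.β) B := by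
  have hβ := S.β1
  have ha := S.a1
  have e1 : ∀ x ∈ uIcc (-S.β) 0, (x + S.β) ^ (-S.a) * (B - x) ^ (-S.a) = S.ρ B x := by
    intro x hx
    rw [uIcc_of_le (by linarith)] at hx
    unfold ρ
    rw [Real.mul_rpow (by linarith [hx.1]) (by linarith [hx.2])]
  have e2 : ∀ x ∈ uIcc 0 B, (B - x) ^ (-S.a) * (x + S.β) ^ (-S.a) = S.ρ B x := by
    intro x hx
    rw [uIcc_of_le (by linarith)] at hx
    unfold ρ
    rw [Real.mul_rpow (by linarith [hx.1]) (by linarith [hx.2]), mul_comm]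
  have i1 : IntervalIntegrable (fun x => (x + S.β) ^ (-S.a) * (B - x) ^ (-S.a)) MeasureTheory.volume (-S.β) 0 := by
    apply IntervalIntegrable.mul_continuousOn
    · have := (intervalIntegral.intervalIntegrable_rpow' (a := 0) (b := S.β) (r := -S.a) (by linarith)).comp_add_right S.β
      simpa using this
    · apply ContinuousOn.rpow_const (by fun_prop)
      intro x hx
      rw [uIcc_of_le (by linarith)] at hx
      left; linarith [hx.2]
  have i2 : IntervalIntegrable (fun x => (B - x) ^ (-S.a) * (x + S.β) ^ (-S.a)) MeasureTheory.volume 0 B := by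
    apply IntervalIntegrable.mul_continuousOn
    · have := (intervalIntegral.intervalIntegrable_rpow' (a := B) (b := 0) (r := -S.a) (by linarith)).comp_sub_left B
      simpa using this
    · apply ContinuousOn.rpow_const (by fun_prop)
      intro x hx
      rw [uIcc_of_le (by linarith)] at hx
      left; linarith [hx.1]
  refine IntervalIntegrable.trans (b := 0) ?_ ?_
  · exact i1.congr (fun x hx => e1 x (uIoc_subset_uIcc hx))
  · exact i2.congr (fun x hx => e2 x (uIoc_subset_uIcc hx))

def Φ (B x : ℝ) : ℝ := ∫ t in (-S.β)..x, S.ρ B t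

lemma ρ_cont {B x : ℝ} (h1 : -S.β < x) (h2 : x < B) : ContinuousAt (S.ρ B) x := by
  unfold ρ
  apply ContinuousAt.rpow_const (by fun_prop)
  left
  exact (mul_pos (by linarith) (by linarith)).ne'

lemma Φ_cont {B : ℝ} (hB : S.β < B) : ContinuousOn (S.Φ B) (Icc (-S.β) B) := by
  have := intervalIntegral.continuousOn_primitive_interval' (S.ρ_int hB) left_mem_uIcc
  rwa [uIcc_of_le (by linarith [S.β1])] at this

lemma Φ_deriv {B x : ℝ} (hB : S.β < B) (h1 : -S.β < x) (h2 : x < B) : HasDerivAt (S.Φ B) (S.ρ B x) x := by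
  unfold Φ
  apply intervalIntegral.integral_hasDerivAt_right
  · exact (S.ρ_int hB).mono_set (by
      rw [uIcc_of_le h1.le, uIcc_of_le (by linarith)]; exact Icc_subset_Icc le_rfl h2.le)
  · refine ContinuousOn.stronglyMeasurableAtFilter (s := Ioo (-S.β) B) isOpen_Ioo ?_ x ⟨h1, h2⟩
    intro y hy
    exact (S.ρ_cont hy.1 hy.2).continuousWithinAt
  · exact S.ρ_cont h1 h2

lemma Φ_mono {B : ℝ} (hB : S.β < B) : StrictMonoOn (S.Φ B) (Icc (-S.β) B) := by
  refine strictMonoOn_of_deriv_pos (convex_Icc _ _) (S.Φ_cont hB) fun x hx => ?_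
  rw [interior_Icc] at hx
  rw [(S.Φ_deriv hB hx.1 hx.2).deriv]
  exact S.ρpos hx.1 hx.2

lemma Φ_up {B x y C : ℝ} (hB : S.β < B) (h1 : -S.β ≤ x) (hxy : x ≤ y) (h2 : y ≤ B)
    (hC : ∀ z ∈ Ioo x y, S.ρ B z ≤ C) : S.Φ B y - S.Φ B x ≤ C * (y - x) := by
  refine Convex.image_sub_le_mul_sub_of_deriv_le (convex_Icc x y) ((S.Φ_cont hB).mono (Icc_subset_Icc h1 h2))
    ?_ ?_ x ⟨le_rfl, hxy⟩ y ⟨hxy, le_rfl⟩ hxy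
  · rw [interior_Icc]
    intro z hz
    exact (S.Φ_deriv hB (by linarith [hz.1]) (by linarith [hz.2])).differentiableAt.differentiableWithinAt
  · rw [interior_Icc]
    intro z hz
    rw [(S.Φ_deriv hB (by linarith [hz.1]) (by linarith [hz.2])).deriv]
    exact hC z hz

lemma Φ_low {B x y C : ℝ} (hB : S.β < B) (h1 : -S.β ≤ x) (hxy : x ≤ y) (h2 : y ≤ B)
    (hC : ∀ z ∈ Ioo x y, C ≤ S.ρ B z) : C * (y - x) ≤ S.Φ B y - S.Φ B x := by
  refine Convex.mul_sub_le_image_sub_of_le_deriv (convex_Icc x y) ((S.Φ_cont hB).mono (Icc_subset_Icc h1 h2))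
    ?_ ?_ x ⟨le_rfl, hxy⟩ y ⟨hxy, le_rfl⟩ hxy
  · rw [interior_Icc]
    intro z hz
    exact (S.Φ_deriv hB (by linarith [hz.1]) (by linarith [hz.2])).differentiableAt.differentiableWithinAt
  · rw [interior_Icc]
    intro z hz
    rw [(S.Φ_deriv hB (by linarith [hz.1]) (by linarith [hz.2])).deriv]
    exact hC z hz

lemma mvt {B : ℝ} (hB : S.β < B) {i : Fin 3} {x y : ℝ} (hx : x ∈ (top hB.le).lap i)
    (hy : y ∈ (top hB.le).lap i) (hxy : x < y) :
    ∃ z, z ∈ Ioo x y ∧ z ≠ 1 ∧ z ≠ -1 ∧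
      (S.F B x < S.F B z ∧ S.F B z < S.F B y ∨ S.F B y < S.F B z ∧ S.F B z < S.F B x) ∧
      |S.Φ B (S.F B x) - S.Φ B (S.F B y)| = S.R B z * |S.Φ B x - S.Φ B y| := by
  have hxl := (top hB.le).lap_sub _ hx
  have hyl := (top hB.le).lap_sub _ hy
  have hl : (top hB.le).l = -S.β := rfl
  have hr : (top hB.le).r = B := rfl
  rw [hl, hr] at hxl hyl
  have hne : ∀ z ∈ Ioo x y, z ≠ 1 ∧ z ≠ -1 := by
    intro z hz
    have hc : (top hB.le).c = -1 := rfl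
    have hd : (top hB.le).d = 1 := rfl
    rcases Top.fin3 i with rfl | rfl | rfl
    · rw [Top.lap0, hc, hl] at hx hy
      constructor <;> intro h <;> linarith [hx.1, hx.2, hy.1, hy.2, hz.1, hz.2]
    · rw [Top.lap1, hc, hd] at hx hy
      constructor <;> intro h <;> linarith [hx.1, hx.2, hy.1, hy.2, hz.1, hz.2]
    · rw [Top.lap2, hd, hr] at hx hy
      constructor <;> intro h <;> linarith [hx.1, hx.2, hy.1, hy.2, hz.1, hz.2]
  have hlap : ∀ z ∈ Icc x y, z ∈ (top hB.le).lap i := by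
    intro z hz
    rcases Top.fin3 i with rfl | rfl | rfl
    · rw [Top.lap0] at hx hy ⊢; exact ⟨hx.1.trans hz.1, hz.2.trans hy.2⟩
    · rw [Top.lap1] at hx hy ⊢; exact ⟨hx.1.trans hz.1, hz.2.trans hy.2⟩
    · rw [Top.lap2] at hx hy ⊢; exact ⟨hx.1.trans hz.1, hz.2.trans hy.2⟩
  have hFc : Continuous (S.F B) := continuous_iff_continuousAt.2 fun z => (S.hF B z).continuousAt
  have hFm : MapsTo (S.F B) (Icc x y) (Icc (-S.β) B) := by
    intro z hz
    exact (top hB.le).maps ((top hB.le).lap_sub _ (hlap z hz))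
  obtain ⟨z, hz, he⟩ := exists_ratio_hasDerivAt_eq_ratio_slope (S.Φ B) (S.ρ B) hxy
    ((S.Φ_cont hB).mono (Icc_subset_Icc hxl.1 hyl.2))
    (fun z hz => S.Φ_deriv hB (by linarith [hz.1, hxl.1]) (by linarith [hz.2, hyl.2]))
    (fun z => S.Φ B (S.F B z)) (fun z => S.ρ B (S.F B z) * S.F' B z)
    ((S.Φ_cont hB).comp hFc.continuousOn hFm)
    (fun z hz => by
      have hz1 : -S.β < z := by linarith [hz.1, hxl.1]
      have hz2 : z < B := by linarith [hz.2, hyl.2]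
      exact (S.Φ_deriv hB (S.F_gt hB.le hz1 (hne z hz).1) (S.F_lt hB hz2)).comp z (S.hF B z))
  have hz1 : -S.β < z := by linarith [hz.1, hxl.1]
  have hz2 : z < B := by linarith [hz.2, hyl.2]
  refine ⟨z, hz, (hne z hz).1, (hne z hz).2, ?_, ?_⟩
  · have hzl := hlap z ⟨hz.1.le, hz.2.le⟩
    rcases Top.fin3 i with rfl | rfl | rfl
    · rw [Top.lap0] at hx hy hzl
      left; exact ⟨(top hB.le).m0 hx hzl hz.1, (top hB.le).m0 hzl hy hz.2⟩
    · rw [Top.lap1] at hx hy hzl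
      right; exact ⟨(top hB.le).m1 hzl hy hz.2, (top hB.le).m1 hx hzl hz.1⟩
    · rw [Top.lap2] at hx hy hzl
      left; exact ⟨(top hB.le).m2 hx hzl hz.1, (top hB.le).m2 hzl hy hz.2⟩
  · have hρ := S.ρpos hz1 hz2
    have hρF := S.ρpos (S.F_gt hB.le hz1 (hne z hz).1) (S.F_lt hB hz2)
    have := congrArg abs he
    simp only [abs_mul, abs_of_pos hρ, abs_of_pos hρF] at this
    rw [abs_sub_comm, abs_sub_comm (S.Φ B x)]
    unfold R
    rw [div_mul_eq_mul_div, eq_div_iff hρ.ne', this]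
    ring

end Fam
end RCE

namespace RCE

/-! ### Part 8 : quantitative estimates for the adapted metric -/

namespace Fam
open Filter Topology
variable (S : Fam)

def Rs (z : ℝ) : ℝ := S.k ^ S.e / (S.β ^ (S.e - 2) * (S.q z * S.q (-z)) ^ (S.e - 1))

lemma qbd : ∃ q0 q1, 0 < q0 ∧ 0 < q1 ∧ ∀ z ∈ Icc (-(S.β + 1 / 2)) (S.β + 1 / 2), q0 ≤ S.q z ∧ S.q z ≤ q1 := by
  have hβ := S.β1
  have hne : (Icc (-(S.β + 1 / 2)) (S.β + 1 / 2)).Nonempty := nonempty_Icc.2 (by linarith)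
  obtain ⟨x, hx, h1⟩ := isCompact_Icc.exists_isMinOn hne S.qc.continuousOn
  obtain ⟨y, hy, h2⟩ := isCompact_Icc.exists_isMaxOn hne S.qc.continuousOn
  exact ⟨S.q x, S.q y, S.qpos x, S.qpos y, fun z hz => ⟨h1 hz, h2 hz⟩⟩

lemma ev_b : ∀ᶠ B in 𝓝[>] S.β, S.β < B ∧ B ≤ S.β + 1 / 2 := by
  have : Ioc S.β (S.β + 1 / 2) ∈ 𝓝[>] S.β := Ioc_mem_nhdsGT (by linarith)
  exact this

lemma ev_small {δ : ℝ} (hδ : 0 < δ) : ∀ᶠ B in 𝓝[>] S.β, B - S.β ≤ δ := by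
  have : Ioc S.β (S.β + δ) ∈ 𝓝[>] S.β := Ioc_mem_nhdsGT (by linarith)
  filter_upwards [this] with B hB
  linarith [hB.2]

lemma θβ : S.θ S.β = S.β := by unfold θ; rw [S.pβ]; ring

lemma ev_θ {γ : ℝ} (hγ : 0 < γ) : ∀ᶠ B in 𝓝[>] S.β, |S.θ B - S.β| ≤ γ := by
  have h := (S.θcont S.β (mem_Ici.2 le_rfl)).mono (Ioi_subset_Ici_self)
  have := h.tendsto
  rw [S.θβ] at this
  have := (Metric.tendsto_nhds.1 this) γ hγ
  filter_upwards [this] with B hB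
  rw [Real.dist_eq] at hB
  exact hB.le

lemma p_bd {z : ℝ} (h1 : -S.β ≤ z) (h2 : z ≤ S.β + 1 / 2) : 0 ≤ 1 + S.p z ∧ 1 + S.p z ≤ 1 + S.p (S.β + 1 / 2) := by
  have hβ := S.β1
  constructor
  · rw [S.fac1]
    have := S.qpos z
    have h3 : 0 ≤ (z - 1) ^ S.e := S.he.pow_nonneg _
    exact mul_nonneg (mul_nonneg h3 (by linarith)) this.le
  · have h3 := pB S.b1
    rcases le_total z S.β with h | h
    · have := S.p_le h; linarith
    · have := S.mono2.monotoneOn (mem_Ici.2 (by linarith)) (mem_Ici.2 (by linarith)) h2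
      linarith

lemma ev_F {γ : ℝ} (hγ : 0 < γ) : ∀ᶠ B in 𝓝[>] S.β, ∀ z ∈ Icc (-S.β) B, |S.F B z - S.β * S.p z| ≤ γ := by
  have h3 := pB S.b1
  have hp : 0 < 1 + S.p (S.β + 1 / 2) := by linarith
  filter_upwards [S.ev_b, S.ev_θ (div_pos hγ hp)] with B hB hθ z hz
  have h := S.p_bd hz.1 (hz.2.trans hB.2)
  have e : S.F B z - S.β * S.p z = (S.θ B - S.β) * (1 + S.p z) := by unfold F; ring
  rw [e, abs_mul, abs_of_nonneg h.1]
  calc |S.θ B - S.β| * (1 + S.p z) ≤ γ / (1 + S.p (S.β + 1 / 2)) * (1 + S.p (S.β + 1 / 2)) :=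
        mul_le_mul hθ h.2 h.1 (by positivity)
    _ = γ := div_mul_cancel₀ _ hp.ne'

lemma nearC : ∃ e0 > 0, ∀ᶠ B in 𝓝[>] S.β, ∀ z ∈ Icc (-S.β) B, |z + 1| < e0 → 1 < S.F B z := by
  have hβ := S.β1
  have hc : ContinuousAt (fun z => S.β * S.p z) (-1) := (continuous_const.mul S.pcont).continuousAt
  obtain ⟨e0, he0, h⟩ := Metric.continuousAt_iff.1 hc ((S.β - 1) / 2) (by linarith)
  refine ⟨e0, he0, ?_⟩
  filter_upwards [S.ev_F (show 0 < (S.β - 1) / 4 by linarith)] with B hB z hz hze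
  have h1 := hB z hz
  have h2 := @h z (by rw [Real.dist_eq]; simpa using hze)
  rw [Real.dist_eq, S.pm1, mul_one] at h2
  rw [abs_lt] at h2
  rw [abs_le] at h1
  linarith [h1.1, h2.1]

lemma nearL : ∃ e0 > 0, ∀ᶠ B in 𝓝[>] S.β, ∀ z ∈ Icc (-S.β) B, z < -S.β + e0 → S.F B z < 1 := by
  have hβ := S.β1
  have hc : ContinuousAt (fun z => S.β * S.p z) (-S.β) := (continuous_const.mul S.pcont).continuousAt
  obtain ⟨e0, he0, h⟩ := Metric.continuousAt_iff.1 hc 1 (by norm_num)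
  refine ⟨e0, he0, ?_⟩
  filter_upwards [S.ev_F (show (0:ℝ) < 1 by norm_num)] with B hB z hz hze
  have h1 := hB z hz
  have h2 := @h z (by rw [Real.dist_eq, abs_lt]; constructor <;> linarith [hz.1])
  rw [Real.dist_eq, S.pmβ] at h2
  rw [abs_lt] at h2
  rw [abs_le] at h1
  linarith [h1.2, h2.2]

lemma est {γ : ℝ} (hγ : 0 < γ) : ∃ A0 > 0, ∀ᶠ B in 𝓝[>] S.β, ∀ z, -S.β < z → z < B → z ≠ 1 →
    A0 * (B - S.β) ≤ (z + 1) ^ S.e → (1 - γ) * S.Rs z ≤ S.R B z ^ S.e ∧ S.R B z ^ S.e ≤ (1 + γ) * S.Rs z := by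
  have hβ := S.β1
  have hK := S.Kp
  obtain ⟨q0, q1, hq0, hq1, hq⟩ := S.qbd
  obtain ⟨g, hg0, hg1, hg2, hg3⟩ : ∃ g : ℝ, 0 < g ∧ g < 1 / 2 ∧
      (1 - γ) * ((1 + g) ^ (S.e - 2) * (1 + g) ^ (S.e - 1)) ≤ 1 ∧
      1 ≤ (1 + γ) * ((1 - g) ^ (S.e - 2) * (1 - g) ^ (S.e - 1)) := by
    have t1 : Tendsto (fun g : ℝ => (1 - γ) * ((1 + g) ^ (S.e - 2) * (1 + g) ^ (S.e - 1))) (𝓝[>] 0) (𝓝 (1 - γ)) := by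
      have : Continuous (fun g : ℝ => (1 - γ) * ((1 + g) ^ (S.e - 2) * (1 + g) ^ (S.e - 1))) := by fun_prop
      have := (this.tendsto 0).mono_left (nhdsWithin_le_nhds (s := Ioi 0))
      simpa using this
    have t2 : Tendsto (fun g : ℝ => (1 + γ) * ((1 - g) ^ (S.e - 2) * (1 - g) ^ (S.e - 1))) (𝓝[>] 0) (𝓝 (1 + γ)) := by
      have : Continuous (fun g : ℝ => (1 + γ) * ((1 - g) ^ (S.e - 2) * (1 - g) ^ (S.e - 1))) := by fun_prop
      have := (this.tendsto 0).mono_left (nhdsWithin_le_nhds (s := Ioi 0))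
      simpa using this
    have e1 := t1.eventually (gt_mem_nhds (show 1 - γ < 1 by linarith))
    have e2 := t2.eventually (lt_mem_nhds (show 1 < 1 + γ by linarith))
    have e3 : Ioo (0:ℝ) (1 / 2) ∈ 𝓝[>] (0:ℝ) := Ioo_mem_nhdsGT (by norm_num)
    obtain ⟨g, h1, h2, h3⟩ := (e1.and (e2.and e3)).exists
    exact ⟨g, h3.1, h3.2, h1.le, h2.le⟩
  refine ⟨K S / (g * q0), by positivity, ?_⟩
  filter_upwards [S.ev_b, S.ev_θ (show 0 < g * S.β by positivity)] with B hB hθ z h1 h2 h3 h4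
  have hε : 0 < B - S.β := by linarith [hB.1]
  set N := (z + 1) ^ S.e with hN
  have hNp : 0 < N := lt_of_lt_of_le (by positivity) h4
  have hqz := hq z ⟨by linarith, by linarith⟩
  have hqz' := hq (-z) ⟨by linarith, by linarith⟩
  have hQ := S.QLip B z ⟨hB.1.le, hB.2⟩ ⟨h1.le, by linarith⟩
  have hb : K S * (B - S.β) ≤ g * (N * S.q (-z)) := by
    rw [div_mul_eq_mul_div, div_le_iff₀ (by positivity)] at h4
    calc K S * (B - S.β) ≤ N * (g * q0) := h4
      _ ≤ N * (g * S.q (-z)) := by gcongr; exact hqz'.1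
      _ = _ := by ring
  have hQ' := abs_le.1 (hQ.trans hb)
  rw [← hN] at hQ'
  have hθ' := abs_le.1 hθ
  have hpow := S.R_pow hB.1 h1 h2 h3
  rw [← hN] at hpow
  set X := S.R B z ^ S.e with hX
  have hX0 : 0 ≤ X := S.he.pow_nonneg _
  have hqp := S.qpos z
  have hqp' := S.qpos (-z)
  set P := S.β ^ (S.e - 2) * (S.q z * S.q (-z)) ^ (S.e - 1) with hP
  have hPp : 0 < P := by positivity
  have hRs : S.Rs z = S.k ^ S.e / P := rfl
  have hkp := S.kp
  have hg' : 0 < 1 - g := by linarith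
  have ub : S.θ B ^ (S.e - 2) * (S.q z * S.Q B z) ^ (S.e - 1) ≤
      ((1 + g) ^ (S.e - 2) * (1 + g) ^ (S.e - 1)) * P * N ^ (S.e - 1) := by
    have t : 0 < S.θ B := θpos hB.1.le
    have t2 : 0 < S.Q B z := S.Qpos hB.1 h2
    calc S.θ B ^ (S.e - 2) * (S.q z * S.Q B z) ^ (S.e - 1) ≤
        ((1 + g) * S.β) ^ (S.e - 2) * (S.q z * ((1 + g) * (N * S.q (-z)))) ^ (S.e - 1) := by
          gcongr
          · linarith [hθ'.2]
          · linarith [hQ'.2]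
      _ = _ := by rw [hP]; simp only [mul_pow]; ring
  have lb : ((1 - g) ^ (S.e - 2) * (1 - g) ^ (S.e - 1)) * P * N ^ (S.e - 1) ≤
      S.θ B ^ (S.e - 2) * (S.q z * S.Q B z) ^ (S.e - 1) := by
    calc ((1 - g) ^ (S.e - 2) * (1 - g) ^ (S.e - 1)) * P * N ^ (S.e - 1) =
        ((1 - g) * S.β) ^ (S.e - 2) * (S.q z * ((1 - g) * (N * S.q (-z)))) ^ (S.e - 1) := by
          rw [hP]; simp only [mul_pow]; ring
      _ ≤ _ := by
          have t : 0 < S.θ B := θpos hB.1.le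
          have t2 : 0 < S.Q B z := S.Qpos hB.1 h2
          gcongr
          · linarith [hθ'.1]
          · linarith [hQ'.1]
  have hNe : 0 < N ^ (S.e - 1) := by positivity
  set G1 := (1 + g) ^ (S.e - 2) * (1 + g) ^ (S.e - 1) with hG1
  set G2 := (1 - g) ^ (S.e - 2) * (1 - g) ^ (S.e - 1) with hG2
  have hG1p : 0 < G1 := by positivity
  have hG2p : 0 < G2 := by positivity
  have k1 : S.k ^ S.e ≤ X * (G1 * P) := by
    have := mul_le_mul_of_nonneg_left ub hX0
    rw [hpow] at this
    have : S.k ^ S.e * N ^ (S.e - 1) ≤ X * (G1 * P) * N ^ (S.e - 1) := by linarith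
    exact le_of_mul_le_mul_right this hNe
  have k2 : X * (G2 * P) ≤ S.k ^ S.e := by
    have := mul_le_mul_of_nonneg_left lb hX0
    rw [hpow] at this
    have : X * (G2 * P) * N ^ (S.e - 1) ≤ S.k ^ S.e * N ^ (S.e - 1) := by linarith
    exact le_of_mul_le_mul_right this hNe
  rw [hRs]
  constructor
  · rw [← mul_div_assoc, div_le_iff₀ hPp]
    rcases le_total 0 (1 - γ) with h | h
    · calc (1 - γ) * S.k ^ S.e ≤ (1 - γ) * (X * (G1 * P)) := by gcongr
        _ = ((1 - γ) * G1) * (X * P) := by ring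
        _ ≤ 1 * (X * P) := by gcongr
        _ = _ := by ring
    · have : (1 - γ) * S.k ^ S.e ≤ 0 := mul_nonpos_of_nonpos_of_nonneg h (by positivity)
      have : 0 ≤ X * P := by positivity
      linarith
  · rw [← mul_div_assoc, le_div_iff₀ hPp]
    calc X * P = 1 * (X * P) := by ring
      _ ≤ ((1 + γ) * G2) * (X * P) := by gcongr
      _ = (1 + γ) * (X * (G2 * P)) := by ring
      _ ≤ _ := by gcongr

lemma Rmax : ∃ Mx : ℝ, 1 ≤ Mx ∧ ∀ᶠ B in 𝓝[>] S.β, ∀ z, -S.β < z → z < B → z ≠ 1 → S.R B z ≤ Mx := by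
  have hβ := S.β1
  have hK := S.Kp
  have hk := S.kp
  have he1 := S.e2
  obtain ⟨q0, q1, hq0, hq1, hq⟩ := S.qbd
  refine ⟨max 1 (S.k ^ S.e * (2 / q0 ^ 2) ^ (S.e - 1)), le_max_left _ _, ?_⟩
  filter_upwards [S.ev_b, S.ev_θ (show 0 < S.β - 1 by linarith),
    S.ev_small (show 0 < q0 / 2 / K S by positivity)] with B hB hθ hε z h1 h2 h3
  have hθ1 : 1 ≤ S.θ B := by linarith [(abs_le.1 hθ).1]
  set N := (z + 1) ^ S.e with hN
  have hN0 : 0 ≤ N := S.he.pow_nonneg _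
  have hqz := hq z ⟨by linarith, by linarith⟩
  have hqz' := hq (-z) ⟨by linarith, by linarith⟩
  have hqp' := S.qpos (-z)
  have hpB := pB hB.1.le
  have hQp := S.Qpos hB.1 h2
  have hQlow : N * q0 / 2 ≤ S.Q B z := by
    rcases le_total z 0 with h | h
    · have e1 := S.hQ B z
      have e2 := S.fac2 z
      rw [← hN] at e2
      have e3 : N * (S.β - z) * S.q (-z) ≤ (B - z) * S.Q B z := by rw [e1, ← e2]; linarith
      have e4 : (B - z) * S.Q B z ≤ 2 * (S.β - z) * S.Q B z := by gcongr; linarith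
      have e5 : (S.β - z) * (N * S.q (-z)) ≤ (S.β - z) * (2 * S.Q B z) := by linarith
      have e6 := le_of_mul_le_mul_left e5 (by linarith)
      have : N * q0 ≤ N * S.q (-z) := by gcongr; exact hqz'.1
      linarith
    · have hQ := S.QLip B z ⟨hB.1.le, hB.2⟩ ⟨h1.le, by linarith⟩
      have hN1 : 1 ≤ N := one_le_pow₀ (by linarith)
      rw [← hN] at hQ
      have e1 := (abs_le.1 hQ).1
      have e2 : K S * (B - S.β) ≤ q0 / 2 := by
        rw [le_div_iff₀ hK] at hε; linarith
      have : N * q0 ≤ N * S.q (-z) := by gcongr; exact hqz'.1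
      nlinarith
  have hR0 := S.R_nonneg B z hB.1 h1 h2 h3
  have hpow := S.R_pow hB.1 h1 h2 h3
  rw [← hN] at hpow
  set X := S.R B z ^ S.e with hX
  have hX0 : 0 ≤ X := S.he.pow_nonneg _
  have hfin : X ≤ max 1 (S.k ^ S.e * (2 / q0 ^ 2) ^ (S.e - 1)) := by
    rcases eq_or_lt_of_le hN0 with h0 | hNp
    · rw [← h0, zero_pow (by omega), mul_zero] at hpow
      have hθ0 : 0 < S.θ B := by linarith
      have hqp := S.qpos z
      have : S.θ B ^ (S.e - 2) * (S.q z * S.Q B z) ^ (S.e - 1) ≠ 0 := by positivity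
      have := (mul_eq_zero.1 hpow).resolve_right this
      rw [this]; exact le_trans zero_le_one (le_max_left _ _)
    · apply le_max_of_le_right
      have lb : 1 * (q0 * (N * q0 / 2)) ^ (S.e - 1) ≤ S.θ B ^ (S.e - 2) * (S.q z * S.Q B z) ^ (S.e - 1) := by
        have : 1 ≤ S.θ B ^ (S.e - 2) := one_le_pow₀ hθ1
        have hqq := S.qpos z
        gcongr
        exact hqz.1
      have := mul_le_mul_of_nonneg_left lb hX0
      rw [hpow] at this
      have e : q0 * (N * q0 / 2) = N * (q0 ^ 2 / 2) := by ring
      rw [e, one_mul, mul_pow] at this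
      have h5 : X * (q0 ^ 2 / 2) ^ (S.e - 1) * N ^ (S.e - 1) ≤ S.k ^ S.e * N ^ (S.e - 1) := by linarith
      have h6 := le_of_mul_le_mul_right h5 (by positivity)
      have h7 : (2 / q0 ^ 2) ^ (S.e - 1) = ((q0 ^ 2 / 2) ^ (S.e - 1))⁻¹ := by
        rw [← inv_pow, inv_div]
      rw [h7, ← div_eq_mul_inv, le_div_iff₀ (by positivity)]
      exact h6
  by_contra hc
  push Not at hc
  have h8 : (1:ℝ) ≤ S.R B z := (le_max_left _ _).trans hc.le
  have h9 : S.R B z ≤ X := le_self_pow₀ h8 S.e0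
  linarith

lemma Bv {B : ℝ} (hB : S.β < B) (hB2 : B ≤ S.β + 1 / 2) :
    4 * S.β / ((S.β - 1) * (1 + S.p (S.β + 1 / 2))) * (B - S.β) ≤ B - S.v B := by
  have hβ := S.β1
  have hmul := θmul hB.le
  have hp := pB hB.le
  have h4 := S.slope le_rfl hβ.le hB.le (by linarith : (1:ℝ) < B)
  rw [S.pβ, S.p1] at h4
  have hs : 2 * (B - S.β) ≤ (S.p B - 1) * (S.β - 1) := by nlinarith
  have e : (B - S.v B) * (1 + S.p B) = (B + S.β) * (S.p B - 1) := by
    unfold v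
    have : (B - (-S.β + 2 * S.θ B)) * (1 + S.p B) = (B + S.β) * (1 + S.p B) - 2 * (S.θ B * (1 + S.p B)) := by ring
    rw [this, hmul]; ring
  have hpp : S.p B ≤ S.p (S.β + 1 / 2) :=
      S.mono2.monotoneOn (mem_Ici.2 (by linarith)) (mem_Ici.2 (by linarith)) hB2
  have hv : 0 ≤ B - S.v B := by have := (top hB.le).vr; exact sub_nonneg.2 this
  have h6 : 0 < (S.β - 1) * (1 + S.p (S.β + 1 / 2)) := mul_pos (by linarith) (by linarith)
  rw [div_mul_eq_mul_div, div_le_iff₀ h6]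
  calc 4 * S.β * (B - S.β) = 2 * S.β * (2 * (B - S.β)) := by ring
      _ ≤ (B + S.β) * ((S.p B - 1) * (S.β - 1)) := 
        mul_le_mul (by linarith) hs (by linarith) (by linarith)
      _ = (S.β - 1) * ((B - S.v B) * (1 + S.p B)) := by rw [e]; ring
      _ ≤ (S.β - 1) * ((B - S.v B) * (1 + S.p (S.β + 1 / 2))) := by
        apply mul_le_mul_of_nonneg_left _ (by linarith)
        apply mul_le_mul_of_nonneg_left _ hv; linarith
      _ = _ := by ring

set_option maxHeartbeats 800000 in
lemma ret {A0 E : ℝ} (hA : 0 < A0) (hE : 0 < E) : ∀ᶠ B in 𝓝[>] S.β, ∀ z τ, -S.β < z → z < 1 →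
    (z + 1) ^ S.e ≤ A0 * (B - S.β) → 1 ≤ S.F B z → 0 ≤ τ → τ ≤ S.Φ B (S.v B) - S.Φ B (S.F B z) →
    E * τ ^ S.a ≤ S.R B z := by
  have hβ := S.β1
  have hK := S.Kp
  have hk := S.kp
  have he1 := S.e2
  have ha0 := S.a0
  have ha1 := S.a1
  obtain ⟨q0, q1, hq0, hq1, hq⟩ := S.qbd
  have h6 : 0 < (S.β - 1) * (1 + S.p (S.β + 1 / 2)) := by
    have := pB S.b1
    exact mul_pos (by linarith) (by linarith)
  set c' := 4 * S.β / ((S.β - 1) * (1 + S.p (S.β + 1 / 2))) with hc'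
  have hc'p : 0 < c' := by positivity
  set c3 := q1 * (q1 * A0 + K S) with hc3
  have hc3p : 0 < c3 := by positivity
  set C4 := (2 * S.β) * (2 * S.β) * q1 with hC4
  have hC4p : 0 < C4 := by positivity
  set E2 := max 1 (E ^ S.e * ((2 * S.β) ^ (S.e - 2) * c3 ^ (S.e - 1)) / S.k ^ S.e) with hE2
  have hE21 : 1 ≤ E2 := le_max_left _ _
  have hE2p : 0 < E2 := by linarith
  have hE2b : E ^ S.e * ((2 * S.β) ^ (S.e - 2) * c3 ^ (S.e - 1)) ≤ S.k ^ S.e * E2 ^ (S.e - 1) := by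
    have h1 : E2 ≤ E2 ^ (S.e - 1) := le_self_pow₀ hE21 (by omega)
    have h2 : E ^ S.e * ((2 * S.β) ^ (S.e - 2) * c3 ^ (S.e - 1)) / S.k ^ S.e ≤ E2 ^ (S.e - 1) :=
      (le_max_right _ _).trans h1
    rw [div_le_iff₀ (by positivity)] at h2
    linarith
  have hsm : ∀ᶠ B in 𝓝[>] S.β, C4 * E2 / c' * (c' * (B - S.β)) ^ (1 - S.a) < 1 := by
    have : ContinuousAt (fun B => C4 * E2 / c' * (c' * (B - S.β)) ^ (1 - S.a)) S.β := by
      apply ContinuousAt.mul continuousAt_const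
      apply ContinuousAt.rpow_const (by fun_prop)
      right; linarith
    have t := this.tendsto.mono_left (nhdsWithin_le_nhds (s := Ioi S.β))
    have e : C4 * E2 / c' * (c' * (S.β - S.β)) ^ (1 - S.a) = 0 := by
      rw [sub_self, mul_zero, Real.zero_rpow (by linarith), mul_zero]
    rw [e] at t
    exact t.eventually (gt_mem_nhds one_pos)
  filter_upwards [S.ev_b, S.ev_θ (show 0 < S.β by linarith), hsm] with B hB hθ hs z τ h1 h2 h3 h4 hτ hτ2
  have hε : 0 < B - S.β := by linarith [hB.1]
  have hθp := θpos hB.1.le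
  have hθ2 : S.θ B ≤ 2 * S.β := by linarith [(abs_le.1 hθ).2]
  have hzB : z < B := by linarith [hB.1]
  have hR0 := S.R_nonneg B z hB.1 h1 hzB h2.ne
  have hqz := hq z ⟨by linarith, by linarith⟩
  have hqz' := hq (-z) ⟨by linarith, by linarith⟩
  have hqp := S.qpos z
  have hqp' := S.qpos (-z)
  have hQp := S.Qpos hB.1 hzB
  have hQ := S.QLip B z ⟨hB.1.le, hB.2⟩ ⟨h1.le, by linarith [hB.1]⟩
  set N := (z + 1) ^ S.e with hN
  have hN0 : 0 ≤ N := S.he.pow_nonneg _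
  have hqQ : S.q z * S.Q B z ≤ c3 * (B - S.β) := by
    have e1 := (abs_le.1 hQ).2
    have e2 : N * S.q (-z) ≤ (A0 * (B - S.β)) * q1 := by gcongr; exact hqz'.2
    have e3 : S.Q B z ≤ (q1 * A0 + K S) * (B - S.β) := by linarith
    calc S.q z * S.Q B z ≤ q1 * ((q1 * A0 + K S) * (B - S.β)) := by gcongr; exact hqz.2
      _ = _ := by rw [hc3]; ring
  have hpow := S.R_pow hB.1 h1 hzB h2.ne
  rw [← hN] at hpow
  set X := S.R B z ^ S.e with hX
  have hX0 : 0 ≤ X := S.he.pow_nonneg _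
  have k1 : S.k ^ S.e * N ^ (S.e - 1) ≤ X * ((2 * S.β) ^ (S.e - 2) * (c3 * (B - S.β)) ^ (S.e - 1)) := by
    rw [← hpow]
    gcongr
  -- bound of τ
  have hvF : S.v B - S.F B z = S.θ B * (N * (S.β - z) * S.q (-z)) := by
    rw [hN, ← S.fac2]; unfold v F; ring
  have hvF0 : 0 ≤ S.v B - S.F B z := by
    rw [hvF]
    have : 0 ≤ S.β - z := by linarith
    positivity
  have hvF2 : S.v B - S.F B z ≤ C4 * N := by
    rw [hvF]
    have : 0 ≤ S.β - z := by linarith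
    calc S.θ B * (N * (S.β - z) * S.q (-z)) ≤ (2 * S.β) * (N * (2 * S.β) * q1) := by
          gcongr
          · linarith
          · exact hqz'.2
      _ = _ := by rw [hC4]; ring
  have hBv := S.Bv hB.1 hB.2
  rw [← hc'] at hBv
  have hce : 0 < c' * (B - S.β) := by positivity
  have hρ : ∀ s ∈ Ioo (S.F B z) (S.v B), S.ρ B s ≤ (c' * (B - S.β)) ^ (-S.a) := by
    intro s hs
    unfold ρ
    apply Real.rpow_le_rpow_of_nonpos hce _ (by linarith)
    have g1 : 1 ≤ s + S.β := by linarith [hs.1]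
    have g2 : c' * (B - S.β) ≤ B - s := by linarith [hs.2]
    have := mul_le_mul g1 g2 hce.le (by linarith)
    rwa [one_mul] at this
  have hτ3 := S.Φ_up hB.1 (by linarith) (by linarith) (by linarith : S.v B ≤ B) hρ
  have hτ4 : τ ≤ (c' * (B - S.β)) ^ (-S.a) * (C4 * N) := by
    refine (hτ2.trans hτ3).trans ?_
    have := Real.rpow_pos_of_pos hce (-S.a)
    gcongr
  have k2 : E2 * τ * (B - S.β) ≤ N := by
    have e1 : (c' * (B - S.β)) ^ (1 - S.a) = (c' * (B - S.β)) ^ (-S.a) * (c' * (B - S.β)) := by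
      rw [show 1 - S.a = -S.a + 1 by ring, Real.rpow_add hce, Real.rpow_one]
    rw [e1] at hs
    calc E2 * τ * (B - S.β) ≤ E2 * ((c' * (B - S.β)) ^ (-S.a) * (C4 * N)) * (B - S.β) := by gcongr
      _ = (C4 * E2 / c' * ((c' * (B - S.β)) ^ (-S.a) * (c' * (B - S.β)))) * N := by field_simp
      _ ≤ 1 * N := by gcongr
      _ = N := one_mul _
  have k3 : E ^ S.e * τ ^ (S.e - 1) ≤ X := by
    have e1 : (E2 * τ * (B - S.β)) ^ (S.e - 1) ≤ N ^ (S.e - 1) := by gcongr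
    have e2 : (E ^ S.e * τ ^ (S.e - 1)) * ((2 * S.β) ^ (S.e - 2) * (c3 * (B - S.β)) ^ (S.e - 1)) ≤
        X * ((2 * S.β) ^ (S.e - 2) * (c3 * (B - S.β)) ^ (S.e - 1)) := by
      refine le_trans ?_ k1
      calc (E ^ S.e * τ ^ (S.e - 1)) * ((2 * S.β) ^ (S.e - 2) * (c3 * (B - S.β)) ^ (S.e - 1))
          = (E ^ S.e * ((2 * S.β) ^ (S.e - 2) * c3 ^ (S.e - 1))) * (τ * (B - S.β)) ^ (S.e - 1) := by
            simp only [mul_pow]; ring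
        _ ≤ (S.k ^ S.e * E2 ^ (S.e - 1)) * (τ * (B - S.β)) ^ (S.e - 1) := by gcongr
        _ = S.k ^ S.e * (E2 * τ * (B - S.β)) ^ (S.e - 1) := by simp only [mul_pow]; ring
        _ ≤ _ := by gcongr
    exact le_of_mul_le_mul_right e2 (by positivity)
  have k4 : (E * τ ^ S.a) ^ S.e ≤ X := by
    rw [mul_pow, ← Real.rpow_natCast (τ ^ S.a), ← Real.rpow_mul hτ, S.ae, Real.rpow_natCast]
    exact k3
  exact (pow_le_pow_iff_left₀ (by positivity) hR0 S.e0).1 k4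

end Fam
end RCE

namespace RCE

/-! ### Part 9 : construction of the adapted metric -/

namespace Fam
open Filter Topology

def inl (i : Fin 3) (z : ℝ) : Prop := (i = 0 → z ≤ -1) ∧ (i = 1 → -1 ≤ z ∧ z ≤ 1) ∧ (i = 2 → 1 ≤ z)
def ifa (γ : ℝ) (j : Fin 3) (w : ℝ) : Prop :=
  (j = 0 → w ≤ -1 + γ) ∧ (j = 1 → -1 - γ ≤ w ∧ w ≤ 1 + γ) ∧ (j = 2 → 1 - γ ≤ w)

structure Num (S : Fam) where
  γ : ℝ
  lo : Fin 3 → Fin 3 → ℝ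
  hi : Fin 3 → Fin 3 → ℝ
  m : ℝ
  σ : ℝ
  γ0 : 0 < γ
  nlo : ∀ i j z, ¬(i ≠ 2 ∧ j = 2) → z ∈ Icc (-S.β) (S.β + γ) → inl i z → ifa γ j (S.β * S.p z) →
    lo i j ^ S.e ≤ (1 - γ) * S.Rs z
  nhi : ∀ i j z, okp i j → z ∈ Icc (-S.β) (S.β + γ) → inl i z → ifa γ j (S.β * S.p z) →
    (1 + γ) * S.Rs z ≤ hi i j ^ S.e
  nm : ∀ z ∈ Icc (-S.β) 1, m ^ S.e ≤ (1 - γ) * S.Rs z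
  m1 : 1 < m
  lo_m : ∀ i j, ¬(i ≠ 2 ∧ j = 2) → m ≤ lo i j
  hi1 : ∀ i j, okp i j → 1 ≤ hi i j
  lohi : ∀ i j, okp i j → σ ^ 2 * hi i j ^ S.a ≤ lo i j
  σ1 : 1 < σ

variable {S : Fam}

lemma ratio {B : ℝ} (hB : S.β < B) {i : Fin 3} {x y : ℝ} (hx : x ∈ (top hB.le).lap i)
    (hy : y ∈ (top hB.le).lap i) : x = y ∨ ∃ z, z ∈ (top hB.le).lap i ∧ -S.β < z ∧ z < B ∧ z ≠ 1 ∧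
      S.F B z ∈ uIcc (S.F B x) (S.F B y) ∧
      |S.Φ B (S.F B x) - S.Φ B (S.F B y)| = S.R B z * |S.Φ B x - S.Φ B y| := by
  have key : ∀ x y, x ∈ (top hB.le).lap i → y ∈ (top hB.le).lap i → x < y →
      ∃ z, z ∈ (top hB.le).lap i ∧ -S.β < z ∧ z < B ∧ z ≠ 1 ∧ S.F B z ∈ uIcc (S.F B x) (S.F B y) ∧
      |S.Φ B (S.F B x) - S.Φ B (S.F B y)| = S.R B z * |S.Φ B x - S.Φ B y| := by
    intro x y hx hy hxy
    obtain ⟨z, hz, h1, h2, h3, h4⟩ := S.mvt hB hx hy hxy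
    have hxl : -S.β ≤ x := ((top hB.le).lap_sub _ hx).1
    have hyl : y ≤ B := ((top hB.le).lap_sub _ hy).2
    refine ⟨z, ?_, by linarith [hz.1], by linarith [hz.2], h1, ?_, h4⟩
    · rcases Top.fin3 i with rfl | rfl | rfl
      · rw [Top.lap0] at hx hy ⊢; exact ⟨hx.1.trans hz.1.le, hz.2.le.trans hy.2⟩
      · rw [Top.lap1] at hx hy ⊢; exact ⟨hx.1.trans hz.1.le, hz.2.le.trans hy.2⟩
      · rw [Top.lap2] at hx hy ⊢; exact ⟨hx.1.trans hz.1.le, hz.2.le.trans hy.2⟩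
    · rw [mem_uIcc]
      rcases h3 with h3 | h3
      · left; exact ⟨h3.1.le, h3.2.le⟩
      · right; exact ⟨h3.1.le, h3.2.le⟩
  rcases lt_trichotomy x y with h | h | h
  · right; exact key x y hx hy h
  · left; exact h
  · right
    obtain ⟨z, h1, h2, h3, h4, h5, h6⟩ := key y x hy hx h
    refine ⟨z, h1, h2, h3, h4, by rwa [uIcc_comm], ?_⟩
    rw [abs_sub_comm, h6, abs_sub_comm]

lemma lap_uIcc {T : Top} {j : Fin 3} {x y z : ℝ} (hx : x ∈ T.lap j) (hy : y ∈ T.lap j) (hz : z ∈ uIcc x y) :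
    z ∈ T.lap j := by
  rcases Top.fin3 j with rfl | rfl | rfl
  · rw [Top.lap0] at *; exact ordConnected_Icc.uIcc_subset hx hy hz
  · rw [Top.lap1] at *; exact ordConnected_Icc.uIcc_subset hx hy hz
  · rw [Top.lap2] at *; exact ordConnected_Icc.uIcc_subset hx hy hz

/-- pointwise lower bound away from returns -/
def PLow (S : Fam) (lo : Fin 3 → Fin 3 → ℝ) (B : ℝ) : Prop := ∀ hB : S.β < B, ∀ i j z,
  ¬(i ≠ 2 ∧ j = 2) → z ∈ (top hB.le).lap i → -S.β < z → z < B → z ≠ 1 → S.F B z ∈ (top hB.le).lap j →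
    lo i j ≤ S.R B z

def PHi (S : Fam) (hi : Fin 3 → Fin 3 → ℝ) (B : ℝ) : Prop := ∀ hB : S.β < B, ∀ i j z,
  okp i j → z ∈ (top hB.le).lap i → -S.β < z → z < B → z ≠ 1 → S.F B z ∈ (top hB.le).lap j →
    S.R B z ≤ hi i j

/-- pointwise lower bound at returns -/
def PRet (S : Fam) (m E : ℝ) (B : ℝ) : Prop := ∀ z τ, -S.β < z → z < 1 → 1 ≤ S.F B z → 0 ≤ τ →
  τ ≤ S.Φ B (S.v B) - S.Φ B (S.F B z) → min m (E * τ ^ S.a) ≤ S.R B z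

lemma inl_of {B : ℝ} (hB : S.β ≤ B) {i : Fin 3} {z : ℝ} (h : z ∈ (top hB).lap i) : inl i z := by
  rcases Top.fin3 i with rfl | rfl | rfl
  · rw [Top.lap0] at h; exact ⟨fun _ => h.2, by simp, by simp⟩
  · rw [Top.lap1] at h; exact ⟨by simp, fun _ => h, by simp⟩
  · rw [Top.lap2] at h; exact ⟨by simp, by simp, fun _ => h.1⟩

lemma ifa_of {B γ w : ℝ} (hB : S.β ≤ B) {j : Fin 3} {z : ℝ} (h : z ∈ (top hB).lap j) (hw : |z - w| ≤ γ) :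
    ifa γ j w := by
  have := abs_le.1 hw
  have hc : (top hB).c = -1 := rfl
  have hd : (top hB).d = 1 := rfl
  rcases Top.fin3 j with rfl | rfl | rfl
  · rw [Top.lap0, hc] at h; exact ⟨fun _ => by linarith [h.2], by simp, by simp⟩
  · rw [Top.lap1, hc, hd] at h; exact ⟨by simp, fun _ => ⟨by linarith [h.1], by linarith [h.2]⟩, by simp⟩
  · rw [Top.lap2, hd] at h; exact ⟨by simp, by simp, fun _ => by linarith [h.1]⟩

lemma okp_nret {i j : Fin 3} (h : okp i j) : ¬(i ≠ 2 ∧ j = 2) := by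
  rintro ⟨h1, rfl⟩
  rcases Top.fin3 i with rfl | rfl | rfl
  · simp [okp] at h
  · simp [okp] at h
  · exact h1 rfl

lemma pointwise (N : Num S) {E : ℝ} (hE : 0 < E) :
    ∀ᶠ B in 𝓝[>] S.β, PLow S N.lo B ∧ PHi S N.hi B ∧ PRet S N.m E B := by
  obtain ⟨A0, hA, hest⟩ := S.est N.γ0
  obtain ⟨e0, he0, hC⟩ := S.nearC
  have hη : 0 < (min e0 1) ^ S.e := by positivity
  filter_upwards [S.ev_b, hest, hC, S.ev_F N.γ0, S.ev_small N.γ0, S.ev_small (show 0 < (min e0 1) ^ S.e / A0 by positivity),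
    S.ret hA hE] with B hB hest hC hF hγ hsm hret
  have hη2 : A0 * (B - S.β) ≤ (min e0 1) ^ S.e := by
    rw [le_div_iff₀ hA] at hsm; linarith
  have far : ∀ hB : S.β < B, ∀ i j z, ¬(i ≠ 2 ∧ j = 2) → z ∈ (top hB.le).lap i → -S.β < z → z < B → z ≠ 1 →
      S.F B z ∈ (top hB.le).lap j → A0 * (B - S.β) ≤ (z + 1) ^ S.e := by
    intro hB i j z hij hz h1 h2 h3 hFz
    refine hη2.trans ?_
    rw [← S.he.pow_abs (z + 1)]
    have : min e0 1 ≤ |z + 1| := by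
      by_cases hi : i = 2
      · subst hi
        rw [Top.lap2] at hz
        have : 1 ≤ z := hz.1
        rw [abs_of_pos (by linarith)]
        exact (min_le_right _ _).trans (by linarith)
      · have hj : j ≠ 2 := fun h => hij ⟨hi, h⟩
        by_contra hc
        push Not at hc
        have h4 := hC z ⟨h1.le, h2.le⟩ (hc.trans_le (min_le_left _ _))
        have hc : (top hB.le).c = -1 := rfl
        have hd : (top hB.le).d = 1 := rfl
        rcases Top.fin3 j with rfl | rfl | rfl
        · rw [Top.lap0, hc] at hFz; linarith [hFz.2]
        · rw [Top.lap1, hd] at hFz; linarith [hFz.2]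
        · exact hj rfl
    gcongr
  refine ⟨?_, ?_, ?_⟩
  · intro hB i j z hij hz h1 h2 h3 hFz
    have hR0 := S.R_nonneg B z hB h1 h2 h3
    have h4 := (hest z h1 h2 h3 (far hB i j z hij hz h1 h2 h3 hFz)).1
    have h5 := N.nlo i j z hij ⟨h1.le, by linarith⟩ (inl_of hB.le hz) (ifa_of hB.le hFz (hF z ⟨h1.le, h2.le⟩))
    have hl : 0 ≤ N.lo i j := by linarith [N.lo_m i j hij, N.m1]
    exact (pow_le_pow_iff_left₀ hl hR0 S.e0).1 (h5.trans h4)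
  · intro hB i j z hij hz h1 h2 h3 hFz
    have hR0 := S.R_nonneg B z hB h1 h2 h3
    have h4 := (hest z h1 h2 h3 (far hB i j z (okp_nret hij) hz h1 h2 h3 hFz)).2
    have h5 := N.nhi i j z hij ⟨h1.le, by linarith⟩ (inl_of hB.le hz) (ifa_of hB.le hFz (hF z ⟨h1.le, h2.le⟩))
    have hl : 0 ≤ N.hi i j := by linarith [N.hi1 i j hij]
    exact (pow_le_pow_iff_left₀ hR0 hl S.e0).1 (h4.trans h5)
  · intro z τ h1 h2 h3 hτ hτ2
    have hz : z < B := by linarith [hB.1, S.β1]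
    have hR0 := S.R_nonneg B z hB.1 h1 hz h2.ne
    rcases le_total (A0 * (B - S.β)) ((z + 1) ^ S.e) with h | h
    · have h4 := (hest z h1 hz h2.ne h).1
      have h5 := N.nm z ⟨h1.le, h2.le⟩
      have hl : 0 ≤ N.m := by linarith [N.m1]
      exact (min_le_left _ _).trans ((pow_le_pow_iff_left₀ hl hR0 S.e0).1 (h5.trans h4))
    · exact (min_le_right _ _).trans (hret z τ h1 h2 h h3 hτ hτ2)

set_option maxHeartbeats 800000 in
theorem metric (N : Num S) : ∃ C2 : ℝ, ∀ᶠ B in 𝓝[>] S.β, ∀ hB : S.β < B,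
    ∃ μ : Met (top hB.le), μ.C2 = C2 ∧ μ.σ0 = N.σ ∧ μ.lo = N.lo ∧ μ.m = N.m ∧ μ.a = S.a ∧ μ.Φ = S.Φ B ∧
      PLow S N.lo B ∧ PHi S N.hi B ∧ PRet S N.m μ.E B := by
  have hβ := S.β1
  have ha0 := S.a0
  obtain ⟨Mx, hMx, hmax⟩ := S.Rmax
  obtain ⟨e0, he0, hC⟩ := S.nearC
  obtain ⟨e1, he1, hL⟩ := S.nearL
  set c1 : ℝ := ((2 * S.β + 1) ^ 2) ^ (-S.a) with hc1
  have hc1p : 0 < c1 := Real.rpow_pos_of_pos (by positivity) _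
  set c0 : ℝ := min 1 (c1 * min e0 ((S.β - 1) / 6)) with hc0
  have hβ1 : 0 < (S.β - 1) / 6 := by linarith
  have hc0p : 0 < c0 := by positivity
  have hc0e : c0 ≤ c1 * e0 := (min_le_right _ _).trans (by gcongr; exact min_le_left _ _)
  have hc0b : c0 ≤ c1 * ((S.β - 1) / 6) := (min_le_right _ _).trans (by gcongr; exact min_le_right _ _)
  set Tot : ℝ := max 1 ((e1 * (S.β - 1)) ^ (-S.a) * (1 + S.β)) with hTot
  have hTot1 : 1 ≤ Tot := le_max_left _ _
  set E := N.m * Mx ^ 3 * Tot / c0 ^ 2 with hE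
  have hm := N.m1
  have hm0 : 0 < N.m := by linarith
  have hEp : 0 < E := by positivity
  refine ⟨N.σ ^ 2 * Mx / c0, ?_⟩
  filter_upwards [S.ev_b, hmax, hC, hL, pointwise N hEp, S.ev_θ (show 0 < (S.β - 1) / 4 by linarith)] with
    B hBb hmax hC hL hpw hθ hB
  obtain ⟨hlow, hhi, hret⟩ := hpw
  have hl : (top hB.le).l = -S.β := rfl
  have hr : (top hB.le).r = B := rfl
  have hc : (top hB.le).c = -1 := rfl
  have hd : (top hB.le).d = 1 := rfl
  have hv : (top hB.le).v = S.v B := rfl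
  have hFF : (top hB.le).F = S.F B := rfl
  have hvB : S.v B ≤ B := (top hB.le).vr
  have hv1 : (S.β - 1) / 2 ≤ S.v B - 1 := by
    unfold v
    linarith [(abs_le.1 hθ).1]
  have low : ∀ x y, -S.β ≤ x → x ≤ y → y ≤ B → c1 * (y - x) ≤ S.Φ B y - S.Φ B x := by
    intro x y h1 h2 h3
    apply S.Φ_low hB h1 h2 h3
    intro z hz
    unfold ρ
    have g1 : 0 < z + S.β := by linarith [hz.1]
    have g2 : 0 < B - z := by linarith [hz.2]
    apply Real.rpow_le_rpow_of_nonpos (by positivity) _ (by linarith)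
    rw [sq]
    apply mul_le_mul _ _ g2.le (by linarith)
    · linarith [hz.2, hBb.2]
    · linarith [hz.1, hBb.2]
  refine ⟨{ Φ := S.Φ B, lo := N.lo, hi := N.hi, m := N.m, Mx := Mx, E := E, c0 := c0, a := S.a, σ0 := N.σ,
            Tot := Tot, mono := S.Φ_mono hB, LO := ?_, HI := ?_, GLip := ?_, RET := ?_, TOT := ?_, g1 := ?_,
            g2 := ?_, g3 := ?_, g4 := ?_, m1 := N.m1, lo_m := N.lo_m, hi1 := N.hi1, lohi := N.lohi,
            σ1 := N.σ1, a0 := S.a0, a1 := S.a1.le, c0p := hc0p, c01 := min_le_left _ _, Mx1 := hMx,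
            Tot1 := hTot1, hE := le_rfl }, ?_⟩
  · intro i j x y hij hx hy hFx hFy
    rcases ratio hB hx hy with rfl | ⟨z, z1, z2, z3, z4, z5, z6⟩
    · simp
    · rw [hFF, z6]
      have := hlow hB i j z hij z1 z2 z3 z4 (lap_uIcc hFx hFy z5)
      gcongr
  · intro i j x y hij hx hy hFx hFy
    rcases ratio hB hx hy with rfl | ⟨z, z1, z2, z3, z4, z5, z6⟩
    · simp
    · rw [hFF, z6]
      have := hhi hB i j z hij z1 z2 z3 z4 (lap_uIcc hFx hFy z5)
      gcongr
  · intro i x y hx hy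
    rcases ratio hB hx hy with rfl | ⟨z, z1, z2, z3, z4, z5, z6⟩
    · simp
    · rw [hFF, z6]
      have := hmax z z2 z3 z4
      gcongr
  · intro i x y τ hi hx hy hFx hFy hτ hτ1 hτ2
    rcases ratio hB hx hy with rfl | ⟨z, z1, z2, z3, z4, z5, z6⟩
    · simp
    · rw [hFF, z6]
      have hFz := lap_uIcc hFx hFy z5
      have hz1 : z < 1 := by
        refine lt_of_le_of_ne ?_ z4
        have g := inl_of hB.le z1
        rcases Top.fin3 i with rfl | rfl | rfl
        · linarith [g.1 rfl]
        · exact (g.2.1 rfl).2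
        · exact absurd rfl hi
      have hτ3 : τ ≤ S.Φ B (S.v B) - S.Φ B (S.F B z) := by
        have hm := (S.Φ_mono hB).monotoneOn
        have mz : S.F B z ∈ Icc (-S.β) B := (top hB.le).lap_sub _ hFz
        have mx : S.F B x ∈ Icc (-S.β) B := (top hB.le).lap_sub _ hFx
        have my : S.F B y ∈ Icc (-S.β) B := (top hB.le).lap_sub _ hFy
        rw [hFF, hv] at hτ1 hτ2
        rcases mem_uIcc.1 z5 with h | h
        · have := hm mz my h.2; linarith
        · have := hm mz mx h.2; linarith
      have h1 : 1 ≤ S.F B z := by rw [Top.lap2] at hFz; exact hFz.1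
      have := hret z τ z2 hz1 h1 hτ hτ3
      gcongr
  · intro i x y hi hx hy hFx hFy
    have hside : ∀ x, x ∈ (top hB.le).lap i → (top hB.le).F x ∈ (top hB.le).lap 2 → -S.β + e1 ≤ x ∧ x ≤ 1 := by
      intro x hx hFx
      have hxl := (top hB.le).lap_sub _ hx
      rw [Top.lap2, hFF, hd] at hFx
      constructor
      · by_contra hc
        push Not at hc
        have := hL x hxl hc
        linarith [hFx.1]
      · have g := inl_of hB.le hx
        rcases Top.fin3 i with rfl | rfl | rfl
        · linarith [g.1 rfl]
        · exact (g.2.1 rfl).2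
        · exact absurd rfl hi
    have key : ∀ x y, -S.β + e1 ≤ x → x ≤ y → y ≤ 1 → |S.Φ B x - S.Φ B y| ≤ Tot := by
      intro x y h1 h2 h3
      have hb := S.Φ_up hB (x := x) (y := y) (C := (e1 * (S.β - 1)) ^ (-S.a)) (by linarith) h2 (by linarith) (by
        intro z hz
        unfold ρ
        have g3 : 0 < S.β - 1 := by linarith
        apply Real.rpow_le_rpow_of_nonpos (by positivity) _ (by linarith)
        apply mul_le_mul _ _ (by linarith) (by linarith [hz.1])
        · linarith [hz.1]
        · linarith [hz.2])
      have h0 : 0 ≤ S.Φ B y - S.Φ B x := by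
        have := low x y (by linarith) h2 (by linarith)
        have : 0 ≤ c1 * (y - x) := mul_nonneg hc1p.le (by linarith)
        linarith
      rw [abs_sub_comm, abs_of_nonneg h0]
      refine hb.trans (le_trans ?_ (le_max_right _ _))
      have g3 : 0 < S.β - 1 := by linarith
      gcongr
      linarith
    have hx' := hside x hx hFx
    have hy' := hside y hy hFy
    rcases le_total x y with h | h
    · exact key x y hx'.1 h hy'.2
    · rw [abs_sub_comm]; exact key y x hy'.1 h hx'.2
  · rw [hc, hl]
    have := low (-S.β) (-1) le_rfl (by linarith) (by linarith)
    nlinarith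
  · rw [hc, hd]
    have := low (-1) 1 (by linarith) (by linarith) (by linarith)
    show c0 ≤ _
    have h2 : c1 * ((S.β - 1) / 6) ≤ c1 * (S.β * 2) := by gcongr; linarith
    have h3 : c0 ≤ 2 * c1 := by
      -- the bound `β ≤ 13` is not available, use the definition of `e0` instead
      rcases le_total e0 2 with h | h
      · calc c0 ≤ c1 * e0 := hc0e
          _ ≤ c1 * 2 := by gcongr
          _ = _ := by ring
      · exfalso
        -- `e0 ≥ 2` would give `1 < F 1`
        have h5 := hC 0 ⟨by linarith, by linarith⟩ (by norm_num; linarith)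
        rcases eq_or_lt_of_le h with h | h
        · have h6 : ∀ n : ℕ, 1 < S.F B (1 - 1 / ((n:ℝ) + 1)) := by
            intro n
            have : 0 < 1 / ((n:ℝ) + 1) := by positivity
            have h7 : 1 / ((n:ℝ) + 1) ≤ 1 := by
              rw [div_le_one (by positivity)]; linarith [(Nat.cast_nonneg n : (0:ℝ) ≤ n)]
            refine hC _ ⟨by linarith, by linarith⟩ ?_
            rw [abs_lt]; constructor <;> linarith
          have hFc : Continuous (S.F B) := continuous_iff_continuousAt.2 fun z => (S.hF B z).continuousAt
          have t : Tendsto (fun n : ℕ => S.F B (1 - 1 / ((n:ℝ) + 1))) atTop (𝓝 (S.F B (1 - 0))) :=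
            (hFc.tendsto _).comp (tendsto_const_nhds.sub tendsto_one_div_add_atTop_nhds_zero_nat)
          have := ge_of_tendsto' t (fun n => (h6 n).le)
          rw [sub_zero] at this
          have h8 : S.F B 1 = -S.β := (top hB.le).Fd
          linarith
        · have := hC 1 ⟨by linarith, by linarith⟩ (by norm_num; linarith)
          have h8 : S.F B 1 = -S.β := (top hB.le).Fd
          linarith
    linarith
  · rw [hv, hd]
    have := low 1 (S.v B) (by linarith) (by linarith) hvB
    have : c1 * ((S.β - 1) / 2) ≤ c1 * (S.v B - 1) := by gcongr
    show 3 * c0 ≤ _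
    linarith
  · intro x hx hFx
    rw [hc]
    rw [hl, hd] at hx
    have he : e0 ≤ |x + 1| := by
      by_contra h
      push Not at h
      have := hC x ⟨hx.1, by linarith [hx.2]⟩ h
      rw [hFF, hd] at hFx
      linarith
    have hlo : c1 * |x + 1| ≤ |S.Φ B x - S.Φ B (-1)| := by
      rcases le_total x (-1) with h | h
      · have := low x (-1) hx.1 h (by linarith)
        rw [abs_of_nonpos (by linarith), abs_sub_comm]
        refine le_trans ?_ (le_abs_self _)
        linarith
      · have := low (-1) x (by linarith) h (by linarith [hx.2])
        rw [abs_of_nonneg (by linarith)]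
        refine le_trans ?_ (le_abs_self _)
        linarith
    show c0 ≤ _
    have : c1 * e0 ≤ c1 * |x + 1| := by gcongr
    linarith
  · exact ⟨rfl, rfl, rfl, rfl, rfl, rfl, hlow, hhi, hret⟩

end Fam
end RCE

namespace RCE

/-! ### Part 10 : the cubic family -/

def fF : Fam where
  e := 2
  p Y := (Y ^ 3 - 3 * Y) / 2
  q _ := 1 / 2
  k := 3 / 2
  β := 2
  Q B z := (B ^ 2 + B * z + z ^ 2 - 3) / 2
  K := 4
  he := by decide
  e2 := le_rfl
  hp := by
    intro Y
    have h := (((hasDerivAt_id Y).pow 3).sub ((hasDerivAt_id Y).const_mul 3)).div_const 2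
    refine HasDerivAt.congr_deriv (h.congr_of_eventuallyEq ?_) ?_
    · filter_upwards with x; simp
    · simp; ring
  kp := by norm_num
  β1 := by norm_num
  fac1 := by intro Y; ring
  fac2 := by intro Y; ring
  qc := continuous_const
  qpos := by intro Y; norm_num
  hQ := by intro B z; ring
  Kp := by norm_num
  QLip := by
    rintro B z ⟨h1, h2⟩ ⟨h3, h4⟩
    rw [show (B ^ 2 + B * z + z ^ 2 - 3) / 2 - (z + 1) ^ 2 * (1 / 2) = ((B + 2 + z) / 2) * (B - 2) by ring,
      abs_of_nonneg (mul_nonneg (by linarith) (by linarith))]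
    exact mul_le_mul_of_nonneg_right (by linarith) (by linarith)
  bend := by norm_num

lemma fRs (z : ℝ) : fF.Rs z = 9 := by
  unfold Fam.Rs; norm_num [fF]

lemma fa : fF.a = 1 / 2 := by unfold Fam.a; norm_num [fF]

def fN : Fam.Num fF where
  γ := 1 / 20
  lo _ _ := 5 / 2
  hi _ _ := 31 / 10
  m := 2
  σ := 11 / 10
  γ0 := by norm_num
  nlo := by intros; rw [fRs]; norm_num [fF]
  nhi := by intros; rw [fRs]; norm_num [fF]
  nm := by intros; rw [fRs]; norm_num [fF]
  m1 := by norm_num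
  lo_m := by intros; norm_num
  hi1 := by intros; norm_num
  lohi := by
    intros
    rw [fa, ← Real.sqrt_eq_rpow]
    have : Real.sqrt (31 / 10) ≤ 2 := by
      rw [Real.sqrt_le_left (by norm_num)]; norm_num
    linarith
  σ1 := by norm_num

end RCE

namespace RCE

/-! ### Part 11 : the family of degree seven -/

lemma exists_gβ : ∃ b : ℝ, 168476 / 100000 ≤ b ∧ b ≤ 168478 / 100000 ∧
    5 * b ^ 3 - 20 * b ^ 2 + 29 * b - 16 = 0 := by
  have h := intermediate_value_Icc (show (168476 / 100000 : ℝ) ≤ 168478 / 100000 by norm_num)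
    (f := fun b : ℝ => 5 * b ^ 3 - 20 * b ^ 2 + 29 * b - 16) (by fun_prop)
  obtain ⟨b, hb, h0⟩ := h (show (0 : ℝ) ∈ _ by constructor <;> norm_num)
  exact ⟨b, hb.1, hb.2, h0⟩

def gβ : ℝ := exists_gβ.choose
lemma gβ1 : 168476 / 100000 ≤ gβ := exists_gβ.choose_spec.1
lemma gβ2 : gβ ≤ 168478 / 100000 := exists_gβ.choose_spec.2.1
lemma gβ0 : 5 * gβ ^ 3 - 20 * gβ ^ 2 + 29 * gβ - 16 = 0 := exists_gβ.choose_spec.2.2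

lemma pow_sub_bd {b B : ℝ} (hb : 0 ≤ b) (hB : b ≤ B) (hB3 : B ≤ 3) (n : ℕ) :
    0 ≤ B ^ n - b ^ n ∧ B ^ n - b ^ n ≤ n * 3 ^ n * (B - b) := by
  refine ⟨by have := pow_le_pow_left₀ hb hB n; linarith, ?_⟩
  induction n with
  | zero => simp
  | succ n ih =>
    have h1 : B ^ n ≤ 3 ^ n := pow_le_pow_left₀ (by linarith) hB3 n
    have h2 : B ^ (n + 1) - b ^ (n + 1) = (B - b) * B ^ n + b * (B ^ n - b ^ n) := by ring
    have h3 : (B - b) * B ^ n ≤ (B - b) * 3 ^ n := mul_le_mul_of_nonneg_left h1 (by linarith)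
    have h5 : 0 ≤ (n : ℝ) * 3 ^ n * (B - b) := mul_nonneg (by positivity) (by linarith)
    have h4 : b * (B ^ n - b ^ n) ≤ 3 * (n * 3 ^ n * (B - b)) :=
      (mul_le_mul_of_nonneg_left ih hb).trans (mul_le_mul_of_nonneg_right (by linarith) h5)
    have h6 : 0 ≤ (B - b) * 3 ^ n := mul_nonneg (by linarith) (by positivity)
    rw [h2]; push_cast; rw [pow_succ]; nlinarith

lemma gterm {b B z : ℝ} (hb : 0 ≤ b) (hB : b ≤ B) (hB3 : B ≤ 3) (hz : |z| ≤ 3) (n m : ℕ) :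
    |(B ^ n - b ^ n) * z ^ m| ≤ n * 3 ^ n * 3 ^ m * (B - b) := by
  obtain ⟨h1, h2⟩ := pow_sub_bd hb hB hB3 n
  rw [abs_mul, abs_pow, abs_of_nonneg h1]
  have h3 : |z| ^ m ≤ 3 ^ m := pow_le_pow_left₀ (abs_nonneg _) hz m
  calc _ ≤ (n * 3 ^ n * (B - b)) * 3 ^ m := mul_le_mul h2 h3 (by positivity) (h1.trans h2)
    _ = _ := by ring

def gQ (B z : ℝ) : ℝ := (5 * (B ^ 6 + B ^ 5 * z + B ^ 4 * z ^ 2 + B ^ 3 * z ^ 3 + B ^ 2 * z ^ 4 +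
  B * z ^ 5 + z ^ 6) - 21 * (B ^ 4 + B ^ 3 * z + B ^ 2 * z ^ 2 + B * z ^ 3 + z ^ 4) +
  35 * (B ^ 2 + B * z + z ^ 2) - 35) / 16

def gq (Y : ℝ) : ℝ := (5 * Y ^ 2 + (20 - 5 * gβ) * Y + (29 - 20 * gβ + 5 * gβ ^ 2)) / 16

lemma gq_pos (Y : ℝ) : 0 < gq Y := by
  unfold gq
  have h1 := gβ1
  have h2 := gβ2
  nlinarith [sq_nonneg (10 * Y + (20 - 5 * gβ)), mul_nonneg (sub_nonneg.2 h1) (sub_nonneg.2 h2)]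

def gp (Y : ℝ) : ℝ := (5 * Y ^ 7 - 21 * Y ^ 5 + 35 * Y ^ 3 - 35 * Y) / 16

lemma gfac1 (Y : ℝ) : 1 + gp Y = (Y - 1) ^ 4 * (Y + gβ) * gq Y := by
  unfold gp gq
  linear_combination (- (Y - 1) ^ 4 / 16) * gβ0

lemma gQβ (z : ℝ) : gQ gβ z = (z + 1) ^ 4 * gq (-z) := by
  unfold gQ gq
  linear_combination ((z ^ 3 + (gβ + 4) * z ^ 2 + (gβ ^ 2 + 4 * gβ + 6) * z +
    (gβ ^ 3 + 4 * gβ ^ 2 + 6 * gβ + 4)) / 16) * gβ0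

lemma gQLip (B z : ℝ) (hB : B ∈ Icc gβ (gβ + 1 / 2)) (hz : z ∈ Icc (-gβ) (gβ + 1 / 2)) :
    |gQ B z - (z + 1) ^ 4 * gq (-z)| ≤ 100000 * (B - gβ) := by
  have h1 := gβ1
  have h2 := gβ2
  have hb : 0 ≤ gβ := by linarith
  have hB3 : B ≤ 3 := by linarith [hB.2]
  have hz3 : |z| ≤ 3 := abs_le.2 ⟨by linarith [hz.1], by linarith [hz.2]⟩
  have t := fun n m => abs_le.1 (gterm hb hB.1 hB3 hz3 n m)
  have a1 := t 6 0
  have a2 := t 5 1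
  have a3 := t 4 2
  have a4 := t 3 3
  have a5 := t 2 4
  have a6 := t 1 5
  have a7 := t 4 0
  have a8 := t 3 1
  have a9 := t 2 2
  have a10 := t 1 3
  have a11 := t 2 0
  have a12 := t 1 1
  clear t
  norm_num at a1 a2 a3 a4 a5 a6 a7 a8 a9 a10 a11 a12
  have hB0 : 0 ≤ B - gβ := by linarith [hB.1]
  rw [← gQβ]
  have : gQ B z - gQ gβ z = (5 * ((B ^ 6 - gβ ^ 6) + (B ^ 5 - gβ ^ 5) * z + (B ^ 4 - gβ ^ 4) * z ^ 2 +
    (B ^ 3 - gβ ^ 3) * z ^ 3 + (B ^ 2 - gβ ^ 2) * z ^ 4 + (B - gβ) * z ^ 5) - 21 * ((B ^ 4 - gβ ^ 4) +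
    (B ^ 3 - gβ ^ 3) * z + (B ^ 2 - gβ ^ 2) * z ^ 2 + (B - gβ) * z ^ 3) + 35 * ((B ^ 2 - gβ ^ 2) +
    (B - gβ) * z)) / 16 := by unfold gQ; ring
  rw [this, abs_le]
  constructor <;> linarith

def gF : Fam where
  e := 4
  p := gp
  q := gq
  k := 35 / 16
  β := gβ
  Q := gQ
  K := 100000
  he := by decide
  e2 := by norm_num
  hp := by
    intro Y
    have h := ((((((hasDerivAt_id Y).pow 7).const_mul 5).sub (((hasDerivAt_id Y).pow 5).const_mul 21)).add
      (((hasDerivAt_id Y).pow 3).const_mul 35)).sub ((hasDerivAt_id Y).const_mul 35)).div_const 16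
    refine HasDerivAt.congr_deriv (h.congr_of_eventuallyEq ?_) ?_
    · filter_upwards with x; simp [gp]
    · simp; ring
  kp := by norm_num
  β1 := by linarith [gβ1]
  fac1 := gfac1
  fac2 := by
    intro Y
    have := gfac1 (-Y)
    rw [show gp (-Y) = - gp Y by unfold gp; ring] at this
    linear_combination this
  qc := by unfold gq; fun_prop
  qpos := gq_pos
  hQ := by intro B z; unfold gQ gp; ring
  Kp := by norm_num
  QLip := gQLip
  bend := by
    have h1 := gβ1
    have h2 := gβ2
    have h3 : 2 ≤ gq (gβ + 1 / 2) := by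
      unfold gq; nlinarith
    have h4 : 1 ≤ (gβ + 1 / 2 - 1) ^ 4 := one_le_pow₀ (by linarith)
    rw [gfac1]
    have h5 : 1 * 3 * 2 ≤ (gβ + 1 / 2 - 1) ^ 4 * (gβ + 1 / 2 + gβ) * gq (gβ + 1 / 2) := by
      gcongr
      linarith
    nlinarith

@[simp] lemma gF_β : gF.β = gβ := rfl
@[simp] lemma gF_e : gF.e = 4 := rfl
@[simp] lemma gF_p : gF.p = gp := rfl

lemma ga : gF.a = 3 / 4 := by unfold Fam.a; norm_num [gF]

def gS (y : ℝ) : ℝ := 25 * y ^ 2 - ((20 - 5 * gβ) ^ 2 - 10 * (29 - 20 * gβ + 5 * gβ ^ 2)) * y +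
  (29 - 20 * gβ + 5 * gβ ^ 2) ^ 2

lemma gsq : 90188 / 1000 ≤ (29 - 20 * gβ + 5 * gβ ^ 2) ^ 2 ∧ (29 - 20 * gβ + 5 * gβ ^ 2) ^ 2 ≤ 90192 / 1000 := by
  have h1 := gβ1
  have h2 := gβ2
  have a : 94967 / 10000 ≤ 29 - 20 * gβ + 5 * gβ ^ 2 := by nlinarith
  have b : 29 - 20 * gβ + 5 * gβ ^ 2 ≤ 94969 / 10000 := by nlinarith
  constructor <;> nlinarith

lemma gPb : 39035 / 1000 ≤ (20 - 5 * gβ) ^ 2 - 10 * (29 - 20 * gβ + 5 * gβ ^ 2) ∧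
    (20 - 5 * gβ) ^ 2 - 10 * (29 - 20 * gβ + 5 * gβ ^ 2) ≤ 39043 / 1000 := by
  have h1 := gβ1
  have h2 := gβ2
  constructor <;> nlinarith

lemma gβsq : 28384 / 10000 ≤ gβ ^ 2 ∧ gβ ^ 2 ≤ 28386 / 10000 := by
  have h1 := gβ1
  have h2 := gβ2
  constructor <;> nlinarith

lemma gS_le {y : ℝ} (hy : 0 ≤ y) : gS y ≤ 25 * y ^ 2 - 39035 / 1000 * y + 90192 / 1000 := by
  unfold gS
  have := mul_le_mul_of_nonneg_right gPb.1 hy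
  linarith [gsq.2]

lemma gS_ge {y : ℝ} (hy : 0 ≤ y) : 25 * y ^ 2 - 39043 / 1000 * y + 90188 / 1000 ≤ gS y := by
  unfold gS
  have := mul_le_mul_of_nonneg_right gPb.2 hy
  linarith [gsq.1]

lemma gS_pos {y : ℝ} (hy : 0 ≤ y) : 0 < gS y := by
  have := gS_ge hy
  nlinarith [sq_nonneg (y - 4 / 5)]

lemma gqq (z : ℝ) : gq z * gq (-z) = gS (z ^ 2) / 256 := by unfold gq gS; ring

lemma gRs (z : ℝ) : gF.Rs z = 140 ^ 4 / (gβ ^ 2 * gS (z ^ 2) ^ 3) := by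
  unfold Fam.Rs
  change (35 / 16 : ℝ) ^ 4 / (gβ ^ (4 - 2) * (gq z * gq (-z)) ^ (4 - 1)) = _
  rw [gqq]
  have h1 := gβ1
  have h2 := gS_pos (sq_nonneg z)
  have h3 : gβ ≠ 0 := by linarith
  norm_num
  field_simp
  norm_num

lemma gRs_lo {z L U : ℝ} (hS : gS (z ^ 2) ≤ U) (_hL : 0 ≤ L)
    (h : L ^ 4 * (28386 / 10000 * U ^ 3) ≤ (1 - 1 / 1000) * 140 ^ 4) :
    L ^ 4 ≤ (1 - 1 / 1000) * gF.Rs z := by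
  have h2 := gS_pos (sq_nonneg z)
  have h3 := gβsq
  rw [gRs, ← mul_div_assoc, le_div_iff₀ (by have := gβ1; positivity)]
  refine le_trans ?_ h
  gcongr
  exact h3.2

lemma gRs_hi {z H U : ℝ} (hU : 0 ≤ U) (hS : U ≤ gS (z ^ 2))
    (h : (1 + 1 / 1000) * 140 ^ 4 ≤ H ^ 4 * (28384 / 10000 * U ^ 3)) (_hH : 0 ≤ H) :
    (1 + 1 / 1000) * gF.Rs z ≤ H ^ 4 := by
  have h2 := gS_pos (sq_nonneg z)
  have h3 := gβsq
  rw [gRs, ← mul_div_assoc, div_le_iff₀ (by have := gβ1; positivity)]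
  refine le_trans h ?_
  gcongr
  exact h3.1

lemma gp_odd (z : ℝ) : gp (-z) = - gp z := by unfold gp; ring
lemma gRs_even (z : ℝ) : gF.Rs (-z) = gF.Rs z := by rw [gRs, gRs, neg_sq]

lemma gp_lt {x y : ℝ} (hx : 1 ≤ x) (hy : x < y) : gp x < gp y :=
  gF.mono2 (mem_Ici.2 hx) (mem_Ici.2 (hx.trans hy.le)) hy

lemma gz22 {z : ℝ} (hz : 1 ≤ z) (h : 1 - 1 / 1000 ≤ gβ * gp z) : 164 / 100 ≤ z := by
  by_contra hc
  push Not at hc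
  have := gp_lt hz hc
  have h2 : gp (164 / 100) ≤ 47 / 100 := by norm_num [gp]
  have h3 := gβ2
  have h4 := gβ1
  have : gβ * gp z ≤ gβ * (47 / 100) := mul_le_mul_of_nonneg_left (by linarith) (by linarith)
  linarith

lemma gz21u {z : ℝ} (hz : 1 ≤ z) (h : gβ * gp z ≤ 1 + 1 / 1000) : z ≤ 1655 / 1000 := by
  by_contra hc
  push Not at hc
  have := gp_lt (by norm_num) hc
  have h2 : 62 / 100 ≤ gp (1655 / 1000) := by norm_num [gp]
  have h3 := gβ2
  have h4 := gβ1
  have : gβ * (62 / 100) ≤ gβ * gp z := mul_le_mul_of_nonneg_left (by linarith) (by linarith)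
  linarith

lemma gz21l {z : ℝ} (hz : 1 ≤ z) (h : -1 - 1 / 1000 ≤ gβ * gp z) : 148 / 100 ≤ z := by
  by_contra hc
  push Not at hc
  have := gp_lt hz hc
  have h2 : gp (148 / 100) ≤ - (60 / 100) := by norm_num [gp]
  have h3 := gβ2
  have h4 := gβ1
  have : gβ * gp z ≤ gβ * (- (60 / 100)) := mul_le_mul_of_nonneg_left (by linarith) (by linarith)
  linarith

lemma gS_up {z a : ℝ} (hz : |z| ≤ a) (ha : 156 / 100 ≤ a ^ 2 * 1) :
    gS (z ^ 2) ≤ max (90192 / 1000) (25 * (a ^ 2) ^ 2 - 39035 / 1000 * a ^ 2 + 90192 / 1000) := by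
  have h1 : z ^ 2 ≤ a ^ 2 := by rw [← sq_abs]; exact pow_le_pow_left₀ (abs_nonneg _) hz 2
  have h0 := sq_nonneg z
  refine (gS_le h0).trans ?_
  rcases le_total (z ^ 2) (156 / 100) with h | h
  · apply le_max_of_le_left
    nlinarith
  · apply le_max_of_le_right
    nlinarith

lemma gS_lw {z a : ℝ} (ha : 1 ≤ a) (hz : a ≤ z) :
    25 * (a ^ 2) ^ 2 - 39043 / 1000 * a ^ 2 + 90188 / 1000 ≤ gS (z ^ 2) := by
  have h1 : a ^ 2 ≤ z ^ 2 := pow_le_pow_left₀ (by linarith) hz 2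
  have h0 : 1 ≤ a ^ 2 := one_le_pow₀ ha
  refine le_trans ?_ (gS_ge (sq_nonneg z))
  nlinarith

lemma glo_all {z : ℝ} (hz : |z| ≤ gβ + 1 / 1000) : (43 / 20 : ℝ) ^ 4 ≤ (1 - 1 / 1000) * gF.Rs z := by
  have h2 := gβ2
  refine gRs_lo (gS_up (a := 168578 / 100000) (by linarith) (by norm_num)) (by norm_num) ?_
  rw [max_eq_right (by norm_num)]
  norm_num

lemma glo_21 {z : ℝ} (hz : 1 ≤ z) (h : gβ * gp z ≤ 1 + 1 / 1000) :
    (91 / 40 : ℝ) ^ 4 ≤ (1 - 1 / 1000) * gF.Rs z := by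
  have := gz21u hz h
  refine gRs_lo (gS_up (a := 1655 / 1000) (abs_le.2 ⟨by linarith, this⟩) (by norm_num)) (by norm_num) ?_
  rw [max_eq_right (by norm_num)]
  norm_num

lemma glo_1 {z : ℝ} (hz : |z| ≤ 1) : (18 / 5 : ℝ) ^ 4 ≤ (1 - 1 / 1000) * gF.Rs z := by
  refine gRs_lo (gS_up (a := 5 / 4) (by linarith) (by norm_num)) (by norm_num) ?_
  rw [max_eq_right (by norm_num)]
  norm_num

lemma ghi_22 {z : ℝ} (hz : 1 ≤ z) (h : 1 - 1 / 1000 ≤ gβ * gp z) :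
    (1 + 1 / 1000) * gF.Rs z ≤ (117 / 50 : ℝ) ^ 4 := by
  refine gRs_hi ?_ (gS_lw (a := 164 / 100) (by norm_num) (gz22 hz h)) ?_ (by norm_num) <;> norm_num

lemma ghi_21 {z : ℝ} (hz : 1 ≤ z) (h : -1 - 1 / 1000 ≤ gβ * gp z) :
    (1 + 1 / 1000) * gF.Rs z ≤ (29 / 10 : ℝ) ^ 4 := by
  refine gRs_hi ?_ (gS_lw (a := 148 / 100) (by norm_num) (gz21l hz h)) ?_ (by norm_num) <;> norm_num

lemma ghi_1 (z : ℝ) : (1 + 1 / 1000) * gF.Rs z ≤ (43 / 10 : ℝ) ^ 4 := by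
  refine gRs_hi (U := 74944 / 1000) (by norm_num) ?_ (by norm_num) (by norm_num)
  refine le_trans ?_ (gS_ge (sq_nonneg z))
  nlinarith [sq_nonneg (z ^ 2 - 39043 / 50000)]

def glo (i j : Fin 3) : ℝ := if i = 1 then 18 / 5 else if i = j then 43 / 20 else if j = 1 then 91 / 40 else 2
def ghi (i j : Fin 3) : ℝ := if i = 1 then 43 / 10 else if i = j then 117 / 50 else 29 / 10

lemma gσ {L H : ℝ} (hL : 0 ≤ L) (hH : 0 ≤ H) (h : (101 / 100 : ℝ) ^ 8 * H ^ 3 ≤ L ^ 4) :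
    (101 / 100 : ℝ) ^ 2 * H ^ (3 / 4 : ℝ) ≤ L := by
  have h1 : (H ^ (3 / 4 : ℝ)) ^ 4 = H ^ 3 := by
    rw [← Real.rpow_natCast, ← Real.rpow_mul hH, ← Real.rpow_natCast]; norm_num
  have h2 : 0 ≤ H ^ (3 / 4 : ℝ) := Real.rpow_nonneg hH _
  refine le_of_pow_le_pow_left₀ (n := 4) (by norm_num) hL ?_
  rw [mul_pow, h1, ← pow_mul]
  exact h

def gN : Fam.Num gF where
  γ := 1 / 1000
  lo := glo
  hi := ghi
  m := 2
  σ := 101 / 100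
  γ0 := by norm_num
  nlo := by
    intro i j z hij hz hi hj
    change _ ^ 4 ≤ _
    simp only [gF_β, gF_p] at hz hj
    have hza : |z| ≤ gβ + 1 / 1000 := abs_le.2 ⟨by linarith [hz.1], by linarith [hz.2]⟩
    have hall := glo_all hza
    have h2 : (2 : ℝ) ^ 4 ≤ (1 - 1 / 1000) * gF.Rs z := le_trans (by norm_num) hall
    rcases Top.fin3 i with rfl | rfl | rfl
    · have hz1 := hi.1 rfl
      rcases Top.fin3 j with rfl | rfl | rfl
      · simpa [glo] using hall
      · have hj1 := (hj.2.1 rfl).1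
        have := glo_21 (z := -z) (by linarith) (by rw [gp_odd]; linarith)
        rw [gRs_even] at this
        simpa [glo] using this
      · exact absurd ⟨by decide, rfl⟩ hij
    · have := glo_1 (abs_le.2 (hi.2.1 rfl))
      simpa [glo] using this
    · have hz1 := hi.2.2 rfl
      rcases Top.fin3 j with rfl | rfl | rfl
      · simpa [glo] using h2
      · have hj1 := (hj.2.1 rfl).2
        have := glo_21 hz1 hj1
        simpa [glo] using this
      · simpa [glo] using hall
  nhi := by
    intro i j z hij hz hi hj
    change _ ≤ _ ^ 4
    simp only [gF_β, gF_p] at hz hj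
    rcases Top.fin3 i with rfl | rfl | rfl
    · have hz1 := hi.1 rfl
      rcases Top.fin3 j with rfl | rfl | rfl
      · have := ghi_22 (z := -z) (by linarith) (by rw [gp_odd]; linarith [hj.1 rfl])
        rw [gRs_even] at this
        simpa [ghi] using this
      · have := ghi_21 (z := -z) (by linarith) (by rw [gp_odd]; linarith [(hj.2.1 rfl).2])
        rw [gRs_even] at this
        simpa [ghi] using this
      · exact absurd hij (by unfold okp; decide)
    · simpa [ghi] using ghi_1 z
    · have hz1 := hi.2.2 rfl
      rcases Top.fin3 j with rfl | rfl | rfl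
      · exact absurd hij (by unfold okp; decide)
      · have := ghi_21 hz1 (hj.2.1 rfl).1
        simpa [ghi] using this
      · have := ghi_22 hz1 (hj.2.2 rfl)
        simpa [ghi] using this
  nm := by
    intro z hz
    have := gβ1
    simp only [gF_β] at hz
    exact le_trans (by norm_num) (glo_all (z := z) (abs_le.2 ⟨by linarith [hz.1], by linarith [hz.2]⟩))
  m1 := by norm_num
  lo_m := by intro i j _; unfold glo; split_ifs <;> norm_num
  hi1 := by intro i j _; unfold ghi; split_ifs <;> norm_num
  lohi := by
    intro i j hij
    rw [ga]
    rcases Top.fin3 i with rfl | rfl | rfl <;> rcases Top.fin3 j with rfl | rfl | rfl <;>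
    first
      | exact absurd hij (by unfold okp; decide)
      | (apply gσ <;> norm_num [glo, ghi, show (2 : Fin 3) ≠ 1 by decide])
  σ1 := by norm_num

end RCE

namespace RCE

/-! ### Part 12 : the Collet–Eckmann condition for the cubic map -/

namespace Fam
variable {S : Fam} {κ : ℕ → Fin 3} {wt : ℕ → ℕ} {M q : ℕ} {B : ℝ}

lemma hF_iter (S : Fam) (B x : ℝ) (n : ℕ) :
    HasDerivAt ((S.F B)^[n]) (∏ i ∈ Finset.range n, S.F' B ((S.F B)^[i] x)) x := by
  induction n with
  | zero => simpa using hasDerivAt_id x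
  | succ n ih =>
    rw [Function.iterate_succ', Finset.prod_range_succ, mul_comm]
    exact (S.hF B _).comp x ih

section
variable (hB : S.β < B) (hk : Kn M q κ wt) (ho : (top hB.le).Orb κ (S.v B))
include hB hk ho

lemma w_mem (i : ℕ) : (S.F B)^[i] (S.v B) ∈ Icc (-S.β) B :=
  (top hB.le).maps_iter (top hB.le).v_mem i

omit hk ho in
lemma w_lt (i : ℕ) : (S.F B)^[i] (S.v B) < B := by
  induction i with
  | zero =>
    have h : S.F B (-1) = S.v B := (top hB.le).Fc
    have := S.F_lt hB (z := -1) (by linarith [S.β1])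
    rw [h] at this
    exact this
  | succ n ih => rw [Function.iterate_succ_apply']; exact S.F_lt hB ih

lemma w_gt (i : ℕ) : -S.β < (S.F B)^[i] (S.v B) := by
  refine lt_of_le_of_ne (w_mem hB hk ho i).1 fun h => ?_
  obtain ⟨j, hj, -, hj0⟩ := hk.zero i
  have h1 : (S.F B)^[j] (S.v B) = -S.β := by
    obtain ⟨t, rfl⟩ := Nat.exists_eq_add_of_le hj
    rw [add_comm, Function.iterate_add_apply, ← h]
    exact (top hB.le).iter_l t
  have h2 := ho j
  change (S.F B)^[j] (S.v B) ∈ _ at h2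
  rw [h1] at h2
  rcases Top.fin3 (κ j) with h3 | h3 | h3
  · exact hj0 h3
  · rw [h3, Top.lap1] at h2; have := h2.1; change (-1 : ℝ) ≤ _ at this; linarith [S.β1]
  · rw [h3, Top.lap2] at h2; have := h2.1; change (1 : ℝ) ≤ _ at this; linarith [S.β1]

lemma w_ne (i : ℕ) : (S.F B)^[i] (S.v B) ≠ 1 := by
  intro h
  have := w_gt hB hk ho (i + 1)
  rw [Function.iterate_succ_apply', h] at this
  have h2 : S.F B 1 = -S.β := (top hB.le).Fd
  linarith

lemma Rw_ret (μ : Met (top hB.le)) (ha : μ.a = S.a) (hΦ : μ.Φ = S.Φ B) (hR : PRet S μ.m μ.E B) {i A : ℕ}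
    (hi : wt i = A + 1) : μ.c0 / μ.Mx ^ A ≤ S.R B ((S.F B)^[i] (S.v B)) := by
  have hr := hk.ret i A hi
  set z := (S.F B)^[i] (S.v B) with hz
  have hz1 : z ∈ (top hB.le).lap (κ i) := ho i
  have hz2 : S.F B z ∈ (top hB.le).lap (κ (i + 1)) := by
    have := ho (i + 1)
    change (S.F B)^[i + 1] (S.v B) ∈ _ at this
    rwa [Function.iterate_succ_apply'] at this
  rw [hr.h1] at hz1
  have hle := ((top hB.le).maps_le (by decide) hz1).2
  rw [hr.h2, Top.lap2] at hz2
  rw [Top.lap1] at hz1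
  have hzl : z < 1 := lt_of_le_of_ne hz1.2 (w_ne hB hk ho i)
  have hτ0 : 0 < μ.c0 / μ.Mx ^ A := div_pos μ.c0p (pow_pos μ.Mxp _)
  have hτ1 : μ.c0 / μ.Mx ^ A ≤ 1 := by
    rw [div_le_one (pow_pos μ.Mxp _)]
    exact μ.c01.trans (one_le_pow₀ μ.Mx1)
  have hd := μ.depth hk ho hi (z := S.F B z) (by
    intro t _
    have := ho (i + 1 + t)
    change (S.F B)^[i + 1 + t] (S.v B) ∈ _ at this
    rw [add_comm (i + 1) t, Function.iterate_add_apply, Function.iterate_succ_apply', add_comm t] at this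
    exact this)
  have hm := μ.monoL ((top hB.le).lap_sub 2 (by rw [Top.lap2]; exact hz2)) (top hB.le).v_mem hle
  change μ.Φ (S.F B z) ≤ _ at hm
  rw [abs_of_nonneg (by linarith), ← div_le_iff₀' (pow_pos μ.Mxp _), hΦ] at hd
  have := hR z _ (w_gt hB hk ho i) hzl hz2.1 hτ0.le hd
  refine le_trans (le_min (hτ1.trans μ.m1.le) ?_) this
  have h1 := μ.pow_rpow_le_one hτ0.le hτ1
  rw [ha] at h1
  have h2 : 0 ≤ (μ.c0 / μ.Mx ^ A) ^ S.a := Real.rpow_nonneg hτ0.le _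
  nlinarith [μ.E1]

lemma Rw (μ : Met (top hB.le)) (ha : μ.a = S.a) (hΦ : μ.Φ = S.Φ B) (hR : PRet S μ.m μ.E B)
    (hlo : PLow S μ.lo B) {L : ℝ} (hL1 : 1 ≤ L) (hL : ∀ i j, L ≤ μ.lo i j) (i : ℕ) :
    L / (L * μ.C2) ^ (wt i) ≤ S.R B ((S.F B)^[i] (S.v B)) := by
  have hC := μ.C2p
  by_cases hi : wt i = 0
  · rw [hi, pow_zero, div_one]
    refine (hL _ _).trans (hlo hB (κ i) (κ (i + 1)) _ (Met.okp_nr (hk.nr i hi)) (ho i)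
      (w_gt hB hk ho i) (w_lt hB i) (w_ne hB hk ho i) ?_)
    have := ho (i + 1)
    change (S.F B)^[i + 1] (S.v B) ∈ _ at this
    rwa [Function.iterate_succ_apply'] at this
  · obtain ⟨A, hA⟩ := Nat.exists_eq_succ_of_ne_zero hi
    refine le_trans ?_ (Rw_ret hB hk ho μ ha hΦ hR hA)
    rw [hA, div_le_div_iff₀ (by positivity) (pow_pos μ.Mxp _), mul_pow, Nat.succ_eq_add_one]
    have h1 : L ≤ L ^ (A + 1) := le_self_pow₀ hL1 (by omega)
    have h2 : μ.Mx ^ A ≤ μ.C2 ^ A := pow_le_pow_left₀ μ.Mxp.le μ.Mx_le_C2 A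
    have h3 : 1 ≤ μ.c0 * μ.C2 := by
      unfold Met.C2
      have := μ.c0p
      rw [mul_div_cancel₀ _ this.ne']
      have h4 : 1 ≤ μ.σ0 ^ 2 := one_le_pow₀ μ.σ1.le
      nlinarith [μ.Mx1]
    have h5 : μ.c0 * (L ^ (A + 1) * μ.C2 ^ (A + 1)) = (L ^ (A + 1) * μ.C2 ^ A) * (μ.c0 * μ.C2) := by ring
    rw [h5]
    calc L * μ.Mx ^ A ≤ L ^ (A + 1) * μ.C2 ^ A := by gcongr; exact pow_nonneg μ.Mxp.le _
      _ ≤ _ := le_mul_of_one_le_right (by positivity) h3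

lemma Rw_prod (μ : Met (top hB.le)) (ha : μ.a = S.a) (hΦ : μ.Φ = S.Φ B) (hR : PRet S μ.m μ.E B)
    (hlo : PLow S μ.lo B) {L : ℝ} (hL1 : 1 ≤ L) (hL : ∀ i j, L ≤ μ.lo i j)
    (hq : (L * μ.C2) ^ 4 ≤ μ.σ0 ^ q) (n : ℕ) :
    (L ^ 4 / μ.σ0) ^ n ≤ (∏ i ∈ Finset.range n, S.R B ((S.F B)^[i] (S.v B))) ^ 4 := by
  have hC := μ.C2p
  have hσ := μ.σ1
  have h1 : L ^ n / (L * μ.C2) ^ (Met.X wt n) ≤ ∏ i ∈ Finset.range n, S.R B ((S.F B)^[i] (S.v B)) := by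
    have := Finset.prod_le_prod (s := Finset.range n) (f := fun i => L / (L * μ.C2) ^ (wt i))
      (fun i _ => by positivity) (fun i _ => Rw hB hk ho μ ha hΦ hR hlo hL1 hL i)
    rwa [Finset.prod_div_distrib, Finset.prod_const, Finset.card_range, Finset.prod_pow_eq_pow_sum] at this
  have h2 : q * Met.X wt n ≤ n := by
    have h3 := hk.qX (n - 2)
    have h4 : q * Met.X wt n ≤ q * Met.X wt (n - 2 + 2) :=
      Nat.mul_le_mul_left _ (Met.X_mono wt (by omega))
    exact (h4.trans h3).trans (by omega)
  have h3 : ((L * μ.C2) ^ (Met.X wt n)) ^ 4 ≤ μ.σ0 ^ n := by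
    rw [← pow_mul, mul_comm (Met.X wt n), pow_mul]
    calc ((L * μ.C2) ^ 4) ^ (Met.X wt n) ≤ (μ.σ0 ^ q) ^ (Met.X wt n) := by gcongr
      _ = μ.σ0 ^ (q * Met.X wt n) := by rw [pow_mul]
      _ ≤ _ := pow_le_pow_right₀ hσ.le h2
  refine le_trans ?_ (pow_le_pow_left₀ (by positivity) h1 4)
  rw [div_pow, div_pow, ← pow_mul, ← pow_mul, mul_comm 4 n]
  gcongr

lemma deriv_prod (n : ℕ) : |∏ i ∈ Finset.range n, S.F' B ((S.F B)^[i] (S.v B))| =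
    (∏ i ∈ Finset.range n, S.R B ((S.F B)^[i] (S.v B))) * S.ρ B (S.v B) /
      S.ρ B ((S.F B)^[n] (S.v B)) := by
  induction n with
  | zero =>
    have h0 := S.ρpos (w_gt hB hk ho 0) (w_lt hB 0)
    simp only [Function.iterate_zero, id_eq] at h0
    simp [h0.ne']
  | succ n ih =>
    have h0 := S.ρpos (w_gt hB hk ho n) (w_lt hB n)
    have h1 := S.ρpos (w_gt hB hk ho (n + 1)) (w_lt hB (n + 1))
    rw [Finset.prod_range_succ, abs_mul, ih, Finset.prod_range_succ]
    unfold R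
    rw [Function.iterate_succ_apply'] at h1 ⊢
    field_simp
end

end Fam

lemma fθ {B : ℝ} (hB : 2 < B) : fF.θ B = 2 / (B - 1) ^ 2 := by
  unfold Fam.θ
  change (B + 2) / (1 + (B ^ 3 - 3 * B) / 2) = _
  have h1 : (1 + (B ^ 3 - 3 * B) / 2) = (B - 1) ^ 2 * (B + 2) / 2 := by ring
  have : B - 1 ≠ 0 := by linarith
  have : B + 2 ≠ 0 := by linarith
  rw [h1]; field_simp

section
variable {κ : ℕ → Fin 3} {wt : ℕ → ℕ} {M q : ℕ} {B : ℝ} (hB : fF.β < B) (hB2 : B ≤ 5 / 2)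
  (hk : Kn M q κ wt) (ho : (Fam.top hB.le).Orb κ (fF.v B))
include hB hB2 hk ho

omit hB2 hk ho in
lemma fid {z : ℝ} (hz : 1 ≤ z) (hzB : z ≤ B) : fF.F B z ≤ z := by
  have hB' : 2 < B := hB
  have h := fF.F_up (z := z) hB.le
  rw [fθ hB'] at h
  change _ = 2 / (B - 1) ^ 2 * ((B - z) * ((B ^ 2 + B * z + z ^ 2 - 3) / 2)) at h
  have h0 : 0 < (B - 1) ^ 2 := by have : 0 < B - 1 := by linarith
                                  positivity
  have h2 : 1 ≤ 2 / (B - 1) ^ 2 * ((B ^ 2 + B * z + z ^ 2 - 3) / 2) := by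
    rw [div_mul_eq_mul_div, le_div_iff₀ h0]; nlinarith
  have h3 : 2 / (B - 1) ^ 2 * ((B - z) * ((B ^ 2 + B * z + z ^ 2 - 3) / 2)) =
    (B - z) * (2 / (B - 1) ^ 2 * ((B ^ 2 + B * z + z ^ 2 - 3) / 2)) := by ring
  nlinarith

omit hB2 hk in
lemma fw_le (i : ℕ) : (fF.F B)^[i] (fF.v B) ≤ fF.v B := by
  induction i with
  | zero => simp
  | succ n ih =>
    have h := ho n
    rw [Function.iterate_succ_apply']
    change (fF.F B)^[n] (fF.v B) ∈ _ at h
    by_cases h2 : κ n = 2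
    · rw [h2, Top.lap2] at h
      exact (fid hB h.1 h.2).trans ih
    · exact ((Fam.top hB.le).maps_le h2 h).2

lemma fw_step (i : ℕ) : (fF.F B)^[i + 1] (fF.v B) + 2 ≤ 9 * ((fF.F B)^[i] (fF.v B) + 2) := by
  have hB' : 2 < B := hB
  rw [Function.iterate_succ_apply']
  have h0 := fF.F_low B ((fF.F B)^[i] (fF.v B))
  have hm := Fam.w_mem hB hk ho i
  set z := (fF.F B)^[i] (fF.v B)
  rw [fθ hB'] at h0
  change fF.F B z + 2 = 2 / (B - 1) ^ 2 * ((z - 1) ^ 2 * (z + 2) * (1 / 2)) at h0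
  have hz1 : -2 ≤ z := hm.1
  have hz2 : z ≤ B := hm.2
  have h1 : (z - 1) ^ 2 ≤ 9 := by nlinarith
  have h2 : 2 / (B - 1) ^ 2 ≤ 2 := by
    rw [div_le_iff₀ (by have : 0 < B - 1 := by linarith
                        positivity)]
    nlinarith
  rw [h0]
  have h3 : (z - 1) ^ 2 * (z + 2) * (1 / 2) ≤ 9 * (z + 2) * (1 / 2) := by gcongr; linarith
  have h4 : 0 ≤ (z - 1) ^ 2 * (z + 2) * (1 / 2) := by
    have : 0 ≤ z + 2 := by linarith
    positivity
  calc _ ≤ 2 * ((z - 1) ^ 2 * (z + 2) * (1 / 2)) := by gcongr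
    _ ≤ _ := by linarith

lemma fw_steps (i t : ℕ) : (fF.F B)^[i + t] (fF.v B) + 2 ≤ 9 ^ t * ((fF.F B)^[i] (fF.v B) + 2) := by
  induction t with
  | zero => simp
  | succ t ih =>
    have := fw_step hB hB2 hk ho (i + t)
    rw [← add_assoc, pow_succ]
    linarith

lemma fw_low (n : ℕ) : 1 ≤ 3 ^ (3 * n + 4) * ((fF.F B)^[n] (fF.v B) + 2) ^ 2 := by
  obtain ⟨i, hi, h4, h0⟩ := hk.zero n
  obtain ⟨t, rfl⟩ := Nat.exists_eq_add_of_le hi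
  have h1 : 1 ≤ (fF.F B)^[n + t] (fF.v B) + 2 := by
    have h2 := ho (n + t)
    change (fF.F B)^[n + t] (fF.v B) ∈ _ at h2
    rcases Top.fin3 (κ (n + t)) with h3 | h3 | h3
    · exact absurd h3 h0
    · rw [h3, Top.lap1] at h2; have := h2.1; change (-1 : ℝ) ≤ _ at this; linarith
    · rw [h3, Top.lap2] at h2; have := h2.1; change (1 : ℝ) ≤ _ at this; linarith
  have h2 := h1.trans (fw_steps hB hB2 hk ho n t)
  have h3 := one_le_pow₀ (n := 2) h2
  refine h3.trans ?_
  rw [mul_pow]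
  gcongr
  rw [show (9 : ℝ) = 3 ^ 2 by norm_num, ← pow_mul, ← pow_mul]
  exact pow_le_pow_right₀ (by norm_num) (by omega)

lemma fCE (μ : Met (Fam.top hB.le)) (ha : μ.a = fF.a) (hΦ : μ.Φ = fF.Φ B) (hR : Fam.PRet fF μ.m μ.E B)
    (hlo : Fam.PLow fF μ.lo B) (hL : ∀ i j, 5 / 2 ≤ μ.lo i j) (hσ : μ.σ0 = 11 / 10)
    (hq : (5 / 2 * μ.C2) ^ 4 ≤ μ.σ0 ^ q) :
    ∃ C > (0 : ℝ), ∃ lam > (1 : ℝ), ∀ n : ℕ, C * lam ^ n < |deriv ((fF.F B)^[n]) (fF.v B)| := by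
  have hv : 0 < fF.ρ B (fF.v B) := fF.ρpos (Fam.w_gt hB hk ho 0) (Fam.w_lt hB 0)
  have hBv : 0 < B - fF.v B := by have := Fam.w_lt hB 0; exact sub_pos.2 this
  set c : ℝ := fF.ρ B (fF.v B) ^ 4 * (B - fF.v B) ^ 2 / 81 with hc
  have hc0 : 0 < c := by positivity
  refine ⟨min 1 c / 2, by positivity, 105 / 100, by norm_num, fun n => ?_⟩
  have hd : |deriv ((fF.F B)^[n]) (fF.v B)| = (∏ i ∈ Finset.range n, fF.R B ((fF.F B)^[i] (fF.v B))) *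
      fF.ρ B (fF.v B) / fF.ρ B ((fF.F B)^[n] (fF.v B)) := by
    rw [(fF.hF_iter B (fF.v B) n).deriv, Fam.deriv_prod hB hk ho]
  have hP := Fam.Rw_prod hB hk ho μ ha hΦ hR hlo (by norm_num) hL hq n
  rw [hσ] at hP
  set P := ∏ i ∈ Finset.range n, fF.R B ((fF.F B)^[i] (fF.v B))
  have hw := fw_low hB hB2 hk ho n
  have hwv := fw_le hB ho n
  have hw1 := Fam.w_gt hB hk ho n
  set w := (fF.F B)^[n] (fF.v B)
  have hw2 : 0 < w + 2 := by change -2 < w at hw1; linarith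
  have hρ : (1 / fF.ρ B w) ^ 4 = ((w + 2) * (B - w)) ^ 2 := by
    unfold Fam.ρ
    change (1 / ((w + 2) * (B - w)) ^ (-fF.a)) ^ 4 = _
    have h0 : 0 ≤ (w + 2) * (B - w) := mul_nonneg hw2.le (by linarith)
    rw [Real.rpow_neg h0, one_div, inv_inv, ← Real.rpow_natCast, ← Real.rpow_mul h0, fa,
      ← Real.rpow_natCast]
    norm_num
  have hD : c * (13 / 10) ^ n ≤ |deriv ((fF.F B)^[n]) (fF.v B)| ^ 4 := by
    rw [hd, div_eq_mul_one_div (P * _), mul_pow (P * _), mul_pow P, hρ]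
    have h1 : (1 : ℝ) / 81 ≤ 27 ^ n * (w + 2) ^ 2 := by
      rw [pow_add, pow_mul] at hw
      norm_num at hw ⊢
      linarith
    have h2 : (13 / 10 : ℝ) ^ n * 27 ^ n ≤ P ^ 4 := by
      refine le_trans ?_ hP
      rw [← mul_pow]
      gcongr
      norm_num
    calc c * (13 / 10) ^ n = (13 / 10) ^ n * (1 / 81) * fF.ρ B (fF.v B) ^ 4 * (B - fF.v B) ^ 2 := by
          rw [hc]; ring
      _ ≤ (13 / 10) ^ n * (27 ^ n * (w + 2) ^ 2) * fF.ρ B (fF.v B) ^ 4 * (B - w) ^ 2 := by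
          gcongr
      _ = ((13 / 10) ^ n * 27 ^ n) * (fF.ρ B (fF.v B) ^ 4 * ((w + 2) * (B - w)) ^ 2) := by ring
      _ ≤ P ^ 4 * (fF.ρ B (fF.v B) ^ 4 * ((w + 2) * (B - w)) ^ 2) := by gcongr
      _ = _ := by ring
  refine lt_of_pow_lt_pow_left₀ 4 (abs_nonneg _) (lt_of_lt_of_le ?_ hD)
  rw [mul_pow, ← pow_mul, mul_comm n 4, pow_mul]
  have h1 : (min 1 c / 2) ^ 4 < c := by
    have h2 : 0 < min 1 c := by positivity
    have h3 : min 1 c ≤ 1 := min_le_left _ _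
    have h4 : min 1 c ≤ c := min_le_right _ _
    have h5 : (min 1 c / 2) ^ 4 ≤ (min 1 c / 2) ^ 1 :=
      pow_le_pow_of_le_one (by positivity) (by linarith) (by norm_num)
    rw [pow_one] at h5
    linarith
  calc _ ≤ (min 1 c / 2) ^ 4 * (13 / 10) ^ n := by gcongr; norm_num
    _ < _ := by gcongr

end
end RCE

namespace RCE

/-! ### Part 13 : failure of the Collet–Eckmann condition in degree seven -/

section
variable {B : ℝ} (hB : gF.β < B) (hB2 : B ≤ gβ + 1 / 100)
include hB hB2

lemma gθ : 3 / 2 ≤ gF.θ B ∧ gF.θ B ≤ 1695 / 1000 := by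
  have h1 := gβ1
  have h2 := gβ2
  have hB' : gβ < B := hB
  have hm : gF.θ B * (1 + gp B) = B + gβ := Fam.θmul hB.le
  have hp1 : 1 ≤ gp B := by
    have := gp_lt (x := gβ) (y := B) (by linarith) hB'
    have h3 : gp gβ = 1 := gF.pβ
    linarith
  have hp2 : gp B ≤ 116 / 100 := by
    have := gp_lt (x := B) (y := 1695 / 1000) (by linarith) (by linarith)
    have h3 : gp (1695 / 1000) ≤ 116 / 100 := by norm_num [gp]
    linarith
  have h0 := Fam.θpos (S := gF) hB.le
  constructor <;> nlinarith

lemma gF'_abs (z : ℝ) : |gF.F' B z| = gF.θ B * (35 / 16) * |z ^ 2 - 1| ^ 3 := by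
  have h0 := Fam.θpos (S := gF) hB.le
  change |gF.θ B * (35 / 16 * (z ^ 2 - 1) ^ 3)| = _
  rw [abs_mul, abs_mul, abs_of_pos h0, abs_of_pos (by norm_num : (0:ℝ) < 35 / 16), abs_pow]
  ring

lemma gF'_max {z : ℝ} (hz : z ∈ Icc (-gβ) B) : |gF.F' B z| ≤ 120 := by
  rw [gF'_abs hB hB2]
  have h := gθ hB hB2
  have h2 := gβ2
  have h1 : |z ^ 2 - 1| ≤ 3 := by rw [abs_le]; constructor <;> nlinarith [hz.1, hz.2]
  calc _ ≤ 1695 / 1000 * (35 / 16) * (3 : ℝ) ^ 3 := by gcongr; exact h.2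
    _ ≤ _ := by norm_num

lemma gF'_1 {z : ℝ} (h1 : -1 ≤ z) (h2 : z ≤ 1) : |gF.F' B z| ≤ 38 / 10 := by
  rw [gF'_abs hB hB2]
  have h := gθ hB hB2
  have h1 : |z ^ 2 - 1| ≤ 1 := by rw [abs_le]; constructor <;> nlinarith
  calc _ ≤ 1695 / 1000 * (35 / 16) * (1 : ℝ) ^ 3 := by gcongr; exact h.2
    _ ≤ _ := by norm_num

lemma gF'_c {z : ℝ} (h1 : -1 ≤ z) (h2 : z ≤ 1) :
    |gF.F' B z| ^ 4 ≤ 10 ^ 9 * (gF.F B z + gβ) ^ 3 := by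
  have h := gθ hB hB2
  have hb1 := gβ1
  have hb2 := gβ2
  have hθ1 := h.1
  have hθ2 := h.2
  have hθ0 : 0 ≤ gF.θ B := by linarith
  have hl : gF.F B z + gβ = gF.θ B * ((z - 1) ^ 4 * (z + gβ) * gq z) := gF.F_low B z
  have hq : 17 / 100 ≤ gq z := by
    unfold gq
    nlinarith [sq_nonneg (10 * z + (20 - 5 * gβ)), mul_nonneg (sub_nonneg.2 hb1) (sub_nonneg.2 hb2)]
  rw [gF'_abs hB hB2, hl]
  have h3 : |z ^ 2 - 1| ≤ 2 * |z - 1| := by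
    rw [show z ^ 2 - 1 = (z + 1) * (z - 1) by ring, abs_mul]
    gcongr
    rw [abs_le]; constructor <;> linarith
  have h4 : (z - 1) ^ 4 = |z - 1| ^ 4 := by rw [← abs_pow, abs_of_nonneg (by positivity)]
  rw [h4]
  set y := |z - 1|
  have hy : 0 ≤ y := abs_nonneg _
  calc _ ≤ (1695 / 1000 * (35 / 16) * (2 * y) ^ 3) ^ 4 := by
        gcongr
    _ = (1695 / 1000 * (35 / 16) * 8) ^ 4 * y ^ 12 := by ring
    _ ≤ 10 ^ 9 * (3 / 2 * (68 / 100) * (17 / 100)) ^ 3 * y ^ 12 := by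
        gcongr; norm_num
    _ = 10 ^ 9 * (3 / 2 * (y ^ 4 * (68 / 100) * (17 / 100))) ^ 3 := by ring
    _ ≤ _ := by
        have hzb : 68 / 100 ≤ z + gβ := by linarith
        have hzb0 : 0 ≤ y ^ 4 * (z + gβ) := mul_nonneg (by positivity) (by linarith)
        gcongr

lemma gF_00 {z : ℝ} (h1 : -gβ ≤ z) (h2 : z ≤ -1) (h3 : gF.F B z ≤ -1) :
    15 * (z + gβ) ≤ gF.F B z + gβ := by
  have h := gθ hB hB2
  have hb1 := gβ1
  have hb2 := gβ2
  have hθ1 := h.1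
  have hθ2 := h.2
  have hθ0 : 0 ≤ gF.θ B := by linarith
  have hl : gF.F B z + gβ = gF.θ B * ((z - 1) ^ 4 * (z + gβ) * gq z) := gF.F_low B z
  have hz : z ≤ -(164 / 100) := by
    by_contra hc
    push Not at hc
    have h4 := gp_lt (x := -z) (y := 164 / 100) (by linarith) (by linarith)
    rw [gp_odd] at h4
    have h5 : gp (164 / 100) ≤ 47 / 100 := by norm_num [gp]
    have h6 : gF.F B z = -gβ + gF.θ B * (1 + gp z) := rfl
    nlinarith
  have hq : 24 / 100 ≤ gq z := by
    unfold gq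
    nlinarith
  have h4 : (264 / 100) ^ 4 ≤ (z - 1) ^ 4 := by
    rw [show (z - 1) ^ 4 = (1 - z) ^ 4 by ring]
    exact pow_le_pow_left₀ (by norm_num) (by linarith) 4
  have hz0 : 0 ≤ z + gβ := by linarith
  rw [hl]
  calc 15 * (z + gβ) ≤ 3 / 2 * ((264 / 100) ^ 4 * (z + gβ) * (24 / 100)) := by nlinarith
    _ ≤ _ := by
      gcongr
end

section
variable {κ : ℕ → Fin 3} {wt : ℕ → ℕ} {M q : ℕ} {B : ℝ} (hB : gF.β < B) (hB2 : B ≤ gβ + 1 / 100)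
  (hk : Kn M q κ wt) (ho : (Fam.top hB.le).Orb κ (gF.v B))
include hB hB2 hk ho

lemma g_bound {n j : ℕ} (hj : 1 ≤ j) (h1 : ∀ i, n ≤ i → i < n + 4 * j + 1 → κ i = 1)
    (h0 : ∀ i, n + 4 * j + 1 ≤ i → i < n + 7 * j + 1 → κ i = 0) :
    |deriv ((gF.F B)^[n + 4 * j + 1]) (gF.v B)| ^ 4 * 20 ^ j ≤ 10 ^ 9 * 15 ^ 3 * (120 ^ 4) ^ n := by
  set w : ℕ → ℝ := fun i => (gF.F B)^[i] (gF.v B) with hw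
  have hs : ∀ i, w (i + 1) = gF.F B (w i) := fun i => Function.iterate_succ_apply' _ _ _
  have hm : ∀ i, w i ∈ Icc (-gβ) B := Fam.w_mem hB hk ho
  have hl1 : ∀ i, κ i = 1 → -1 ≤ w i ∧ w i ≤ 1 := by
    intro i hi
    have := ho i
    rw [hi, Top.lap1] at this
    exact this
  have hl0 : ∀ i, κ i = 0 → w i ≤ -1 := by
    intro i hi
    have := ho i
    rw [hi, Top.lap0] at this
    exact this.2
  have hd : |deriv ((gF.F B)^[n + 4 * j + 1]) (gF.v B)| = (∏ i ∈ Finset.range n, |gF.F' B (w i)|) *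
      (∏ i ∈ Finset.range (4 * j), |gF.F' B (w (n + i))|) * |gF.F' B (w (n + 4 * j))| := by
    rw [(gF.hF_iter B (gF.v B) _).deriv, Finset.abs_prod, Finset.prod_range_succ, Finset.prod_range_add]
  have p1 : ∏ i ∈ Finset.range n, |gF.F' B (w i)| ≤ 120 ^ n := by
    have := Finset.prod_le_prod (s := Finset.range n) (g := fun _ => (120 : ℝ))
      (fun i _ => abs_nonneg _) (fun i _ => gF'_max hB hB2 (hm i))
    simpa using this
  have p2 : ∏ i ∈ Finset.range (4 * j), |gF.F' B (w (n + i))| ≤ (38 / 10) ^ (4 * j) := by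
    have := Finset.prod_le_prod (s := Finset.range (4 * j)) (g := fun _ => (38 / 10 : ℝ))
      (fun i _ => abs_nonneg (gF.F' B (w (n + i)))) (fun i hi => by
        have hi' := Finset.mem_range.1 hi
        have := hl1 (n + i) (h1 _ (by omega) (by omega))
        exact gF'_1 hB hB2 this.1 this.2)
    rwa [Finset.prod_const, Finset.card_range] at this
  have p3 : |gF.F' B (w (n + 4 * j))| ^ 4 ≤ 10 ^ 9 * (w (n + 4 * j + 1) + gβ) ^ 3 := by
    have := hl1 (n + 4 * j) (h1 _ (by omega) (by omega))
    rw [hs]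
    exact gF'_c hB hB2 this.1 this.2
  have p4 : ∀ t, t < 3 * j → 15 ^ t * (w (n + 4 * j + 1) + gβ) ≤ w (n + 4 * j + 1 + t) + gβ := by
    intro t
    induction t with
    | zero => intro _; simp
    | succ t ih =>
      intro ht
      have h3 := ih (by omega)
      have a0 := hl0 (n + 4 * j + 1 + t) (h0 _ (by omega) (by omega))
      have a1 := hl0 (n + 4 * j + 1 + t + 1) (h0 _ (by omega) (by omega))
      rw [hs] at a1
      have h4 := gF_00 hB hB2 (hm _).1 a0 a1
      rw [← add_assoc, hs (n + 4 * j + 1 + t), pow_succ]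
      linarith
  have hy0 : 0 ≤ w (n + 4 * j + 1) + gβ := by linarith [(hm (n + 4 * j + 1)).1]
  set y := w (n + 4 * j + 1) + gβ
  have p5 : 15 ^ (3 * j) * y ≤ 15 := by
    have h3 := p4 (3 * j - 1) (by omega)
    have a0 := hl0 (n + 4 * j + 1 + (3 * j - 1)) (h0 _ (by omega) (by omega))
    have h5 : 15 ^ (3 * j - 1) * y ≤ 1 := by linarith [gβ2]
    have h6 : (15 : ℝ) ^ (3 * j) = 15 ^ (3 * j - 1) * 15 := by rw [← pow_succ]; congr 1; omega
    rw [h6]; linarith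
  have p6 : (15 ^ 9) ^ j * y ^ 3 ≤ 15 ^ 3 := by
    have := pow_le_pow_left₀ (by positivity) p5 3
    rw [mul_pow, ← pow_mul, show 3 * j * 3 = 9 * j by ring] at this
    rw [← pow_mul]
    exact this
  have p7 : ((38 / 10 : ℝ) ^ (4 * j)) ^ 4 * 20 ^ j ≤ (15 ^ 9) ^ j := by
    rw [← pow_mul, show 4 * j * 4 = 16 * j by ring, pow_mul, ← mul_pow]
    gcongr
    norm_num
  rw [hd, mul_pow, mul_pow]
  have q1 : 0 ≤ ∏ i ∈ Finset.range n, |gF.F' B (w i)| := Finset.prod_nonneg fun i _ => abs_nonneg _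
  have q2 : 0 ≤ ∏ i ∈ Finset.range (4 * j), |gF.F' B (w (n + i))| := Finset.prod_nonneg fun i _ => abs_nonneg _
  calc _ ≤ (120 ^ n) ^ 4 * ((38 / 10) ^ (4 * j)) ^ 4 * (10 ^ 9 * y ^ 3) * 20 ^ j := by gcongr
    _ = 10 ^ 9 * (120 ^ n) ^ 4 * (((38 / 10) ^ (4 * j)) ^ 4 * 20 ^ j * y ^ 3) := by ring
    _ ≤ 10 ^ 9 * (120 ^ n) ^ 4 * ((15 ^ 9) ^ j * y ^ 3) := by gcongr
    _ ≤ 10 ^ 9 * (120 ^ n) ^ 4 * 15 ^ 3 := by gcongr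
    _ = _ := by rw [← pow_mul, ← pow_mul, mul_comm n 4]; ring

lemma gNCE : ¬ ∃ C > (0 : ℝ), ∃ lam > (1 : ℝ), ∀ n : ℕ, C * lam ^ n < |deriv ((gF.F B)^[n]) (gF.v B)| := by
  rintro ⟨C, hC, lam, hl, h⟩
  obtain ⟨b, hb⟩ := pow_unbounded_of_one_lt (10 ^ 9 * 15 ^ 3 / C ^ 4) (show (1 : ℝ) < 20 by norm_num)
  obtain ⟨n, j, hj, hj1, h1, h0⟩ := hk.blk (b + 7)
  have hg := g_bound hB hB2 hk ho hj1 (fun i a c => h1 i a c) (fun i a c => h0 i a c)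
  have h2 : C < |deriv ((gF.F B)^[n + 4 * j + 1]) (gF.v B)| := by
    refine lt_of_le_of_lt ?_ (h _)
    exact le_mul_of_one_le_right hC.le (one_le_pow₀ hl.le)
  set D := |deriv ((gF.F B)^[n + 4 * j + 1]) (gF.v B)|
  have h3 : C ^ 4 ≤ D ^ 4 := pow_le_pow_left₀ hC.le h2.le 4
  rw [div_lt_iff₀ (by positivity)] at hb
  have h4 : (20 : ℝ) ^ b * (120 ^ 4) ^ n ≤ 20 ^ j := by
    calc (20 : ℝ) ^ b * (120 ^ 4) ^ n ≤ 20 ^ b * (20 ^ 7) ^ n := by gcongr; norm_num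
      _ = 20 ^ (b + 7 * n) := by rw [pow_add, pow_mul]
      _ ≤ 20 ^ j := pow_le_pow_right₀ (by norm_num) (by nlinarith)
  have h5 : C ^ 4 * (20 ^ b * (120 ^ 4) ^ n) ≤ D ^ 4 * 20 ^ j := by gcongr
  have h6 : 0 < ((120 : ℝ) ^ 4) ^ n := by positivity
  have h7 := mul_lt_mul_of_pos_right hb h6
  linarith
end
end RCE

namespace RCE

/-! ### Part 14 : choice of the parameters -/

lemma ev_right {b : ℝ} {P : ℝ → Prop} (h : ∀ᶠ B in nhdsWithin b (Ioi b), P B) :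
    ∃ ε > 0, ∀ B, b < B → B < b + ε → P B := by
  obtain ⟨u, hu, hs⟩ := mem_nhdsGT_iff_exists_Ioo_subset.1 h
  exact ⟨u - b, sub_pos.2 hu, fun B h1 h2 => hs ⟨h1, by linarith⟩⟩

lemma exists_q (C s : ℝ) (hs : 1 < s) : ∃ q0 : ℕ, ∀ q ≥ q0, C ≤ s ^ q := by
  obtain ⟨n, hn⟩ := pow_unbounded_of_one_lt C hs
  exact ⟨n, fun q hq => hn.le.trans (pow_le_pow_right₀ hs.le hq)⟩

lemma exists_M (S : Fam) (ε : ℝ) (hε : 0 < ε) : ∃ M0 : ℕ, ∀ M ≥ M0, ∀ B, (B - S.β) * 2 ^ M ≤ S.Cs →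
    B < S.β + ε := by
  obtain ⟨n, hn⟩ := pow_unbounded_of_one_lt (S.Cs / ε) (show (1 : ℝ) < 2 by norm_num)
  refine ⟨n, fun M hM B h => ?_⟩
  by_contra hc
  push Not at hc
  have h1 : (2 : ℝ) ^ n ≤ 2 ^ M := pow_le_pow_right₀ (by norm_num) hM
  rw [div_lt_iff₀ hε] at hn
  have h2 : (2 : ℝ) ^ M * ε ≤ (B - S.β) * 2 ^ M := by
    rw [mul_comm]; gcongr; linarith
  have h3 : (2 : ℝ) ^ n * ε ≤ 2 ^ M * ε := by gcongr
  linarith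

theorem main_dyn : ∃ Bf Bg : ℝ, fF.β < Bf ∧ gF.β < Bg ∧
    (∃ φ : ℝ → ℝ, StrictMonoOn φ (Icc (-fF.β) Bf) ∧ φ '' Icc (-fF.β) Bf = Icc (-gF.β) Bg ∧
      ∀ x ∈ Icc (-fF.β) Bf, φ (fF.F Bf x) = gF.F Bg (φ x)) ∧
    (∀ ε > 0, ∀ N : ℕ, ∃ n, N ≤ n ∧ 1 ≤ n ∧ |(gF.F Bg)^[n] (-1) - (-1)| < ε) ∧
    (∃ C > (0 : ℝ), ∃ lam > (1 : ℝ), ∀ n : ℕ, C * lam ^ n < |deriv ((fF.F Bf)^[n]) (fF.v Bf)|) ∧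
    ¬ (∃ C > (0 : ℝ), ∃ lam > (1 : ℝ), ∀ n : ℕ, C * lam ^ n < |deriv ((gF.F Bg)^[n]) (gF.v Bg)|) := by
  obtain ⟨Cf, hCf⟩ := Fam.metric fN
  obtain ⟨Cg, hCg⟩ := Fam.metric gN
  obtain ⟨ef, hef, hf⟩ := ev_right hCf
  obtain ⟨eg, heg, hg⟩ := ev_right hCg
  obtain ⟨q1, hq1⟩ := exists_q ((5 / 2 * Cf) ^ 4) fN.σ fN.σ1
  obtain ⟨q2, hq2⟩ := exists_q (Cf ^ 4) fN.σ fN.σ1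
  obtain ⟨q3, hq3⟩ := exists_q (Cg ^ 4) gN.σ gN.σ1
  obtain ⟨M1, hM1⟩ := exists_M fF ef hef
  obtain ⟨M2, hM2⟩ := exists_M gF (min eg (1 / 100)) (by positivity)
  set q := max q1 (max q2 q3) with hq
  set M := max 2 (max M1 M2) with hM
  have hMge : 2 ≤ M := le_max_left _ _
  obtain ⟨κ, w, hk⟩ := exists_kn M q (by omega)
  obtain ⟨Bf, f1, f2, f3, f4⟩ := Fam.realize fF hk (by omega)
  obtain ⟨Bg, g1, g2, g3, g4⟩ := Fam.realize gF hk (by omega)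
  have f5 := hM1 M (by simp [hM]) Bf f3
  have g5 := hM2 M (by simp [hM]) Bg g3
  obtain ⟨μf, a1, a2, a3, a4, a5, a6, a7, a8, a9⟩ := hf Bf f1 f5 f1
  obtain ⟨μg, b1, b2, b3, b4, b5, b6, b7, b8, b9⟩ :=
    hg Bg g1 (lt_of_lt_of_le g5 (by gcongr; exact min_le_left _ _)) g1
  have of := f4 f1.le
  have og := g4 g1.le
  have Ef := μf.expansive hk (by omega) of (by rw [a1, a2]; exact hq2 q (by simp [hq]))
  have Eg := μg.expansive hk (by omega) og (by rw [b1, b2]; exact hq3 q (by simp [hq]))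
  refine ⟨Bf, Bg, f1, g1, ?_, ?_, ?_, ?_⟩
  · exact Top.conj (hk.knd hMge of) (hk.knd hMge og) Ef Eg
  · intro ε hε N
    exact hk.rec_c og Eg ε hε N
  · refine fCE f1 (f2.trans (by norm_num [fF])) hk of μf a5 a6 (by rw [a4]; exact a9) (by rw [a3]; exact a7) ?_ a2 ?_
    · intro i j; rw [a3]; exact le_rfl
    · rw [a1, a2]; exact hq1 q (by simp [hq])
  · refine gNCE g1 ?_ hk og
    have : min eg (1 / 100) ≤ 1 / 100 := min_le_right _ _
    have g6 : Bg < gβ + min eg (1 / 100) := g5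
    linarith

end RCE

namespace RCE

namespace Fam
variable (S : Fam)

/-- affine coordinate -/
def L (B x : ℝ) : ℝ := -S.β + (B + S.β) * x

/-- the map in the coordinate of the unit interval -/
def G (B x : ℝ) : ℝ := (S.F B (S.L B x) + S.β) / (B + S.β)

variable {S} {B : ℝ}

lemma Λpos (hB : S.β < B) : 0 < B + S.β := by have := S.β1; linarith

lemma hL (B x : ℝ) : HasDerivAt (S.L B) (B + S.β) x := by
  have h : HasDerivAt (S.L B) ((B + S.β) * 1) x :=
    ((hasDerivAt_id x).const_mul (B + S.β)).const_add (-S.β)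
  simpa using h

lemma L_inv (hB : S.β < B) (y : ℝ) : S.L B ((y + S.β) / (B + S.β)) = y := by
  have := Λpos hB
  unfold L; field_simp; ring

lemma inv_L (hB : S.β < B) (x : ℝ) : (S.L B x + S.β) / (B + S.β) = x := by
  have := Λpos hB
  unfold L; field_simp; ring

lemma L_mem (hB : S.β < B) {x : ℝ} (hx : x ∈ Icc (0:ℝ) 1) : S.L B x ∈ Icc (-S.β) B := by
  have := Λpos hB
  unfold L; constructor <;> nlinarith [hx.1, hx.2]

lemma inv_mem (hB : S.β < B) {y : ℝ} (hy : y ∈ Icc (-S.β) B) :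
    (y + S.β) / (B + S.β) ∈ Icc (0:ℝ) 1 := by
  have := Λpos hB
  refine ⟨div_nonneg (by linarith [hy.1]) this.le, ?_⟩
  rw [div_le_one this]; linarith [hy.2]

lemma F_mem (hB : S.β < B) {y : ℝ} (hy : y ∈ Icc (-S.β) B) : S.F B y ∈ Icc (-S.β) B :=
  (S.top hB.le).maps hy

lemma G_mem (hB : S.β < B) {x : ℝ} (hx : x ∈ Icc (0:ℝ) 1) : S.G B x ∈ Icc (0:ℝ) 1 :=
  inv_mem hB (F_mem hB (L_mem hB hx))

lemma L_G (hB : S.β < B) (x : ℝ) : S.L B (S.G B x) = S.F B (S.L B x) := L_inv hB _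

lemma L_G_iter (hB : S.β < B) (n : ℕ) (x : ℝ) :
    S.L B ((S.G B)^[n] x) = (S.F B)^[n] (S.L B x) := by
  induction n generalizing x with
  | zero => rfl
  | succ n ih => rw [Function.iterate_succ_apply, Function.iterate_succ_apply, ih, L_G hB]

lemma G_iter (hB : S.β < B) (n : ℕ) (x : ℝ) :
    (S.G B)^[n] x = ((S.F B)^[n] (S.L B x) + S.β) / (B + S.β) := by
  rw [← L_G_iter hB, inv_L hB]

lemma deriv_G_iter (hB : S.β < B) (n : ℕ) (x : ℝ) :
    deriv ((S.G B)^[n]) x = deriv ((S.F B)^[n]) (S.L B x) := by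
  have h0 := Λpos hB
  have h1 := (Fam.hF_iter S B (S.L B x) n)
  have h2 := ((h1.comp x (hL B x)).add_const S.β).div_const (B + S.β)
  have e : (S.G B)^[n] = fun x => ((S.F B)^[n] (S.L B x) + S.β) / (B + S.β) :=
    funext (G_iter hB n)
  rw [h1.deriv, e]
  refine (h2.deriv.trans ?_)
  field_simp

lemma hG (hB : S.β < B) (x : ℝ) :
    HasDerivAt (S.G B) (S.θ B * S.k * ((S.L B x) ^ 2 - 1) ^ (S.e - 1)) x := by
  have h0 := Λpos hB
  have h2 := (((S.hF B (S.L B x)).comp x (hL B x)).add_const S.β).div_const (B + S.β)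
  refine h2.congr_deriv ?_
  unfold F'
  field_simp

lemma G_c (hB : S.β < B) : S.L B (S.G B ((S.β - 1) / (B + S.β))) = S.v B := by
  rw [L_G hB]
  have : S.L B ((S.β - 1) / (B + S.β)) = -1 := by
    rw [show S.β - 1 = -1 + S.β by ring]; exact L_inv hB _
  rw [this]; exact (S.top hB.le).Fc

lemma CE_iff (hB : S.β < B) : ColletEckmann (S.G B) ((S.β - 1) / (B + S.β)) ↔
    ∃ C > (0:ℝ), ∃ lam > (1:ℝ), ∀ n : ℕ, C * lam ^ n < |deriv ((S.F B)^[n]) (S.v B)| := by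
  unfold ColletEckmann
  simp only [deriv_G_iter hB, G_c hB]

lemma rec_of (hB : S.β < B)
    (h : ∀ ε > (0:ℝ), ∀ N : ℕ, ∃ n : ℕ, N ≤ n ∧ 1 ≤ n ∧ |(S.F B)^[n] (-1) - (-1)| < ε) :
    Recurrent (S.G B) ((S.β - 1) / (B + S.β)) := by
  intro ε hε N
  have h0 := Λpos hB
  obtain ⟨n, n1, n2, n3⟩ := h (ε * (B + S.β)) (by positivity) N
  refine ⟨n, n1, n2, ?_⟩
  have : S.L B ((S.β - 1) / (B + S.β)) = -1 := by
    rw [show S.β - 1 = -1 + S.β by ring]; exact L_inv hB _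
  rw [G_iter hB, this, ← sub_div, abs_div, abs_of_pos h0, div_lt_iff₀ h0]
  rw [show (S.F B)^[n] (-1) + S.β - (S.β - 1) = (S.F B)^[n] (-1) - (-1) by ring]
  exact n3

lemma G_zero (hB : S.β < B) : S.G B 0 = 0 := by
  have : S.L B 0 = -S.β := by simp [L]
  unfold G
  rw [this, show S.F B (-S.β) = -S.β from (S.top hB.le).Fl]; simp

lemma not_rec (hB : S.β < B) : ¬ Recurrent (S.G B) ((S.β + 1) / (B + S.β)) := by
  have h0 := Λpos hB
  have b1 := S.β1
  intro h
  have hc : 0 < (S.β + 1) / (B + S.β) := div_pos (by linarith) h0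
  obtain ⟨n, -, n2, n3⟩ := h _ hc 0
  have hL1 : S.L B ((S.β + 1) / (B + S.β)) = 1 := by
    rw [show S.β + 1 = 1 + S.β by ring]; exact L_inv hB _
  have hz : S.G B ((S.β + 1) / (B + S.β)) = 0 := by
    unfold G; rw [hL1, show S.F B 1 = -S.β from (S.top hB.le).Fd]; simp
  obtain ⟨m, rfl⟩ : ∃ m, n = m + 1 := ⟨n - 1, by omega⟩
  rw [Function.iterate_succ_apply, hz, Function.iterate_fixed (G_zero hB)] at n3
  simp only [zero_sub, abs_neg, abs_of_pos hc] at n3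
  exact lt_irrefl _ n3

lemma c_order (hB : S.β < B) : 0 < (S.β - 1) / (B + S.β) ∧
    (S.β - 1) / (B + S.β) < (S.β + 1) / (B + S.β) ∧ (S.β + 1) / (B + S.β) < 1 := by
  have h0 := Λpos hB
  have b1 := S.β1
  refine ⟨div_pos (by linarith) h0, by gcongr; linarith, ?_⟩
  rw [div_lt_one h0]; linarith

lemma sq_ne (hB : S.β < B) {x : ℝ} (h1 : x ≠ (S.β - 1) / (B + S.β))
    (h2 : x ≠ (S.β + 1) / (B + S.β)) : (S.L B x) ^ 2 - 1 ≠ 0 := by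
  intro h
  have : (S.L B x - 1) * (S.L B x + 1) = 0 := by linarith
  have h3 := inv_L hB x
  rcases mul_eq_zero.1 this with h | h
  · apply h2; rw [← h3, show S.L B x = 1 by linarith]; ring
  · apply h1; rw [← h3, show S.L B x = -1 by linarith]; ring

lemma A_pos (hB : S.β < B) : 0 < S.θ B * S.k := mul_pos (S.θpos hB.le) S.kp

lemma crit (hB : S.β < B) :
    {x : ℝ | x ∈ Ioo (0:ℝ) 1 ∧ deriv (S.G B) x = 0} =
      {(S.β - 1) / (B + S.β), (S.β + 1) / (B + S.β)} := by
  have he := S.e2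
  obtain ⟨o1, o2, o3⟩ := c_order hB
  have h0 := A_pos hB
  have hm : S.e - 1 ≠ 0 := by omega
  ext x
  simp only [mem_ofPred_eq, mem_insert_iff, mem_singleton_iff]
  rw [(hG hB x).deriv]
  constructor
  · rintro ⟨-, h⟩
    by_contra hc
    push Not at hc
    exact (mul_ne_zero h0.ne' (pow_ne_zero _ (sq_ne hB hc.1 hc.2))) h
  · have hL1 : S.L B ((S.β + 1) / (B + S.β)) = 1 := by
      rw [show S.β + 1 = 1 + S.β by ring]; exact L_inv hB _
    have hL2 : S.L B ((S.β - 1) / (B + S.β)) = -1 := by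
      rw [show S.β - 1 = -1 + S.β by ring]; exact L_inv hB _
    rintro (rfl | rfl)
    · exact ⟨⟨o1, by linarith⟩, by rw [hL2]; simp [hm]⟩
    · exact ⟨⟨by linarith, o3⟩, by rw [hL1]; simp [hm]⟩

lemma L_c1 (hB : S.β < B) : S.L B ((S.β - 1) / (B + S.β)) = -1 := by
  rw [show S.β - 1 = -1 + S.β by ring]; exact L_inv hB _

lemma L_c2 (hB : S.β < B) : S.L B ((S.β + 1) / (B + S.β)) = 1 := by
  rw [show S.β + 1 = 1 + S.β by ring]; exact L_inv hB _

lemma deriv_comp_L (P P' : ℝ → ℝ) (hP : ∀ y, HasDerivAt P (P' y) y) (a : ℝ) :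
    deriv (fun x => a * P (S.L B x)) = fun x => (a * (B + S.β)) * P' (S.L B x) := by
  funext x
  have h : HasDerivAt (fun x => a * P (S.L B x)) (a * (P' (S.L B x) * (B + S.β))) x :=
    ((hP (S.L B x)).comp x (hL B x)).const_mul a
  rw [h.deriv]
  ring

lemma iter1 (hB : S.β < B) : deriv (S.G B) =
    fun x => (S.θ B * S.k) * (fun y : ℝ => (y ^ 2 - 1) ^ (S.e - 1)) (S.L B x) :=
  funext fun x => (hG hB x).deriv

lemma f_iters (he : S.e = 2) (hB : S.β < B) :
    iteratedDeriv 2 (S.G B) = (fun x => (S.θ B * S.k * (B + S.β)) * (2 * S.L B x)) ∧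
    iteratedDeriv 3 (S.G B) = (fun _ => (S.θ B * S.k * (B + S.β) * (B + S.β)) * 2) := by
  have h2 : iteratedDeriv 2 (S.G B) = (fun x => (S.θ B * S.k * (B + S.β)) * (2 * S.L B x)) := by
    rw [iteratedDeriv_succ, iteratedDeriv_one, iter1 hB]
    refine deriv_comp_L (fun y : ℝ => (y ^ 2 - 1) ^ (S.e - 1)) (fun y => 2 * y) ?_ _
    intro y
    rw [he]
    simpa using ((hasDerivAt_id y).pow 2).sub_const 1
  refine ⟨h2, ?_⟩
  rw [iteratedDeriv_succ, h2]
  refine deriv_comp_L (fun y => 2 * y) (fun y => 2) ?_ _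
  intro y
  simpa using (hasDerivAt_id y).const_mul 2

lemma g_iters (he : S.e = 4) (hB : S.β < B) :
    iteratedDeriv 2 (S.G B) = (fun x => (S.θ B * S.k * (B + S.β)) *
      (fun y : ℝ => 6 * y ^ 5 - 12 * y ^ 3 + 6 * y) (S.L B x)) ∧
    iteratedDeriv 3 (S.G B) = (fun x => (S.θ B * S.k * (B + S.β) * (B + S.β)) *
      (fun y : ℝ => 30 * y ^ 4 - 36 * y ^ 2 + 6) (S.L B x)) ∧
    iteratedDeriv 4 (S.G B) = (fun x => (S.θ B * S.k * (B + S.β) * (B + S.β) * (B + S.β)) *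
      (fun y : ℝ => 120 * y ^ 3 - 72 * y) (S.L B x)) := by
  have h2 : iteratedDeriv 2 (S.G B) = (fun x => (S.θ B * S.k * (B + S.β)) *
      (fun y : ℝ => 6 * y ^ 5 - 12 * y ^ 3 + 6 * y) (S.L B x)) := by
    rw [iteratedDeriv_succ, iteratedDeriv_one, iter1 hB]
    refine deriv_comp_L (fun y : ℝ => (y ^ 2 - 1) ^ (S.e - 1)) (fun y : ℝ => 6 * y ^ 5 - 12 * y ^ 3 + 6 * y) ?_ _
    intro y
    rw [he]
    have h : HasDerivAt (fun y : ℝ => (y ^ 2 - 1) ^ 3) _ y :=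
      ((hasDerivAt_pow 2 y).sub_const 1).pow 3
    refine h.congr_deriv ?_
    norm_num; ring
  have h3 : iteratedDeriv 3 (S.G B) = (fun x => (S.θ B * S.k * (B + S.β) * (B + S.β)) *
      (fun y : ℝ => 30 * y ^ 4 - 36 * y ^ 2 + 6) (S.L B x)) := by
    rw [iteratedDeriv_succ, h2]
    refine deriv_comp_L (fun y : ℝ => 6 * y ^ 5 - 12 * y ^ 3 + 6 * y) (fun y : ℝ => 30 * y ^ 4 - 36 * y ^ 2 + 6) ?_ _
    intro y
    have h : HasDerivAt (fun y : ℝ => 6 * y ^ 5 - 12 * y ^ 3 + 6 * y) _ y :=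
      (((hasDerivAt_pow 5 y).const_mul 6).sub ((hasDerivAt_pow 3 y).const_mul 12)).add
        ((hasDerivAt_id y).const_mul 6)
    refine h.congr_deriv ?_
    norm_num; ring
  refine ⟨h2, h3, ?_⟩
  rw [iteratedDeriv_succ, h3]
  refine deriv_comp_L (fun y : ℝ => 30 * y ^ 4 - 36 * y ^ 2 + 6) (fun y : ℝ => 120 * y ^ 3 - 72 * y) ?_ _
  intro y
  have h : HasDerivAt (fun y : ℝ => 30 * y ^ 4 - 36 * y ^ 2 + 6) _ y :=
    (((hasDerivAt_pow 4 y).const_mul 30).sub ((hasDerivAt_pow 2 y).const_mul 36)).add_const 6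
  refine h.congr_deriv ?_
  norm_num; ring

lemma f_schw (he : S.e = 2) (hB : S.β < B) {x : ℝ} (h1 : x ≠ (S.β - 1) / (B + S.β))
    (h2 : x ≠ (S.β + 1) / (B + S.β)) : schwarzian (S.G B) x < 0 := by
  have hs := sq_ne hB h1 h2
  have hA := A_pos hB
  have hΛ := Λpos hB
  obtain ⟨i2, i3⟩ := f_iters he hB
  unfold schwarzian
  rw [i2, i3, (hG hB x).deriv, he]
  set y := S.L B x
  set A := S.θ B * S.k
  set Λ := B + S.β
  have hp : 0 < (y ^ 2 - 1) ^ 2 := by positivity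
  have : A * Λ * Λ * 2 / (A * (y ^ 2 - 1) ^ (2 - 1)) -
      3 / 2 * (A * Λ * (2 * y) / (A * (y ^ 2 - 1) ^ (2 - 1))) ^ 2 =
      -(Λ ^ 2 * (4 * y ^ 2 + 2)) / (y ^ 2 - 1) ^ 2 := by
    norm_num
    field_simp
    ring
  rw [this]
  apply div_neg_of_neg_of_pos _ hp
  have : 0 < Λ ^ 2 * (4 * y ^ 2 + 2) := by positivity
  linarith

lemma g_schw (he : S.e = 4) (hB : S.β < B) {x : ℝ} (h1 : x ≠ (S.β - 1) / (B + S.β))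
    (h2 : x ≠ (S.β + 1) / (B + S.β)) : schwarzian (S.G B) x < 0 := by
  have hs := sq_ne hB h1 h2
  have hA := A_pos hB
  have hΛ := Λpos hB
  obtain ⟨i2, i3, -⟩ := g_iters he hB
  unfold schwarzian
  rw [i2, i3, (hG hB x).deriv, he]
  simp only
  set y := S.L B x
  set A := S.θ B * S.k
  set Λ := B + S.β
  have hp : 0 < (y ^ 2 - 1) ^ 2 := by positivity
  have e1 : A * Λ * Λ * (30 * y ^ 4 - 36 * y ^ 2 + 6) / (A * (y ^ 2 - 1) ^ (4 - 1)) =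
      Λ ^ 2 * (30 * y ^ 2 - 6) / (y ^ 2 - 1) ^ 2 := by
    norm_num
    field_simp
    ring
  have e2 : A * Λ * (6 * y ^ 5 - 12 * y ^ 3 + 6 * y) / (A * (y ^ 2 - 1) ^ (4 - 1)) =
      Λ * (6 * y) / (y ^ 2 - 1) := by
    norm_num
    field_simp
    ring
  rw [e1, e2]
  have : Λ ^ 2 * (30 * y ^ 2 - 6) / (y ^ 2 - 1) ^ 2 - 3 / 2 * (Λ * (6 * y) / (y ^ 2 - 1)) ^ 2 =
      -(Λ ^ 2 * (24 * y ^ 2 + 6)) / (y ^ 2 - 1) ^ 2 := by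
    field_simp
    ring
  rw [this]
  apply div_neg_of_neg_of_pos _ hp
  have : 0 < Λ ^ 2 * (24 * y ^ 2 + 6) := by positivity
  linarith

/-- the polynomial with evaluation `G`. -/
lemma poly (hB : S.β < B) (P : Polynomial ℝ) (hP : ∀ y, P.eval y = 1 + S.p y) :
    ∃ R : Polynomial ℝ, R.natDegree = P.natDegree ∧ (fun y => R.eval y) = S.G B := by
  have hΛ := Λpos hB
  have hθ := S.θpos hB.le
  refine ⟨Polynomial.C (S.θ B / (B + S.β)) *
    P.comp (Polynomial.C (B + S.β) * Polynomial.X + Polynomial.C (-S.β)), ?_, ?_⟩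
  · rw [Polynomial.natDegree_C_mul (by positivity), Polynomial.natDegree_comp,
      Polynomial.natDegree_linear hΛ.ne', mul_one]
  · funext y
    simp only [Polynomial.eval_mul, Polynomial.eval_C, Polynomial.eval_comp, Polynomial.eval_add,
      Polynomial.eval_X, hP]
    unfold G F L
    rw [show (B + S.β) * y + -S.β = -S.β + (B + S.β) * y by ring]
    field_simp
    ring

end Fam

lemma conj_unit {S T : Fam} {B D : ℝ} (hB : S.β < B) (hD : T.β < D) {φ : ℝ → ℝ}
    (h1 : StrictMonoOn φ (Icc (-S.β) B)) (h2 : φ '' Icc (-S.β) B = Icc (-T.β) D)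
    (h3 : ∀ x ∈ Icc (-S.β) B, φ (S.F B x) = T.F D (φ x)) :
    ∃ h : ℝ → ℝ,
      ContinuousOn h (Icc (0:ℝ) 1) ∧ StrictMonoOn h (Icc (0:ℝ) 1) ∧
      h '' Icc (0:ℝ) 1 = Icc (0:ℝ) 1 ∧
      ∀ x ∈ Icc (0:ℝ) 1, h (S.G B x) = T.G D (h x) := by
  have hΛ := Fam.Λpos hB
  have hΛ' := Fam.Λpos hD
  set h : ℝ → ℝ := fun x => (φ (S.L B x) + T.β) / (D + T.β) with hh
  have hm : StrictMonoOn h (Icc (0:ℝ) 1) := by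
    intro x hx y hy hxy
    have : φ (S.L B x) < φ (S.L B y) := by
      apply h1 (Fam.L_mem hB hx) (Fam.L_mem hB hy)
      unfold Fam.L; nlinarith
    simp only [hh]
    gcongr
  have hi : h '' Icc (0:ℝ) 1 = Icc (0:ℝ) 1 := by
    ext y
    constructor
    · rintro ⟨x, hx, rfl⟩
      apply Fam.inv_mem hD
      rw [← h2]
      exact mem_image_of_mem _ (Fam.L_mem hB hx)
    · intro hy
      have := Fam.L_mem hD hy
      rw [← h2] at this
      obtain ⟨z, hz, hz2⟩ := this
      refine ⟨(z + S.β) / (B + S.β), Fam.inv_mem hB hz, ?_⟩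
      simp only [hh]
      rw [Fam.L_inv hB, hz2, Fam.inv_L hD]
  refine ⟨h, ?_, hm, hi, ?_⟩
  · intro x hx
    have hs : SurjOn h (Icc 0 1) (Icc 0 1) := hi.ge
    rw [Metric.continuousWithinAt_iff]
    have hmem : ∀ z ∈ Icc (0:ℝ) 1, h z ∈ Icc (0:ℝ) 1 := fun z hz => hi ▸ mem_image_of_mem h hz
    intro ε hε
    -- left and right
    have hleft : ∃ δ > 0, ∀ z ∈ Icc (0:ℝ) 1, x - δ < z → h x - ε < h z := by
      by_cases hc : h x - ε < 0
      · exact ⟨1, one_pos, fun z hz _ => lt_of_lt_of_le hc (hmem z hz).1⟩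
      · push Not at hc
        obtain ⟨w, hw, hw2⟩ := hs (show (h x - ε / 2) ∈ Icc (0:ℝ) 1 from
          ⟨by linarith, by linarith [(hmem x hx).2]⟩)
        have hwx : w < x := (hm.lt_iff_lt hw hx).1 (by linarith)
        refine ⟨x - w, by linarith, fun z hz hzz => ?_⟩
        have := hm hw hz (by linarith)
        linarith
    have hright : ∃ δ > 0, ∀ z ∈ Icc (0:ℝ) 1, z < x + δ → h z < h x + ε := by
      by_cases hc : 1 < h x + ε
      · exact ⟨1, one_pos, fun z hz _ => lt_of_le_of_lt (hmem z hz).2 hc⟩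
      · push Not at hc
        obtain ⟨w, hw, hw2⟩ := hs (show (h x + ε / 2) ∈ Icc (0:ℝ) 1 from
          ⟨by linarith [(hmem x hx).1], by linarith⟩)
        have hwx : x < w := (hm.lt_iff_lt hx hw).1 (by linarith)
        refine ⟨w - x, by linarith, fun z hz hzz => ?_⟩
        have := hm hz hw (by linarith)
        linarith
    obtain ⟨δ1, p1, q1⟩ := hleft
    obtain ⟨δ2, p2, q2⟩ := hright
    refine ⟨min δ1 δ2, lt_min p1 p2, fun {z} hz hd => ?_⟩
    rw [Real.dist_eq, abs_lt] at hd ⊢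
    have m1 := min_le_left δ1 δ2
    have m2 := min_le_right δ1 δ2
    have := q1 z hz (by linarith [hd.1])
    have := q2 z hz (by linarith [hd.2])
    constructor <;> linarith
  · intro x hx
    simp only [hh]
    rw [Fam.L_G hB, h3 _ (Fam.L_mem hB hx)]
    unfold Fam.G
    rw [Fam.L_inv hD]

lemma fpoly : ∃ P : Polynomial ℝ, P.natDegree = 3 ∧ ∀ y, P.eval y = 1 + fF.p y := by
  refine ⟨Polynomial.C (1/2) * Polynomial.X ^ 3 + Polynomial.C (-3/2) * Polynomial.X +
    Polynomial.C 1, ?_, ?_⟩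
  · compute_degree!
  · intro y
    simp [fF]
    ring

lemma gpoly : ∃ P : Polynomial ℝ, P.natDegree = 7 ∧ ∀ y, P.eval y = 1 + gF.p y := by
  refine ⟨Polynomial.C (5/16) * Polynomial.X ^ 7 + Polynomial.C (-21/16) * Polynomial.X ^ 5 +
    Polynomial.C (35/16) * Polynomial.X ^ 3 + Polynomial.C (-35/16) * Polynomial.X +
    Polynomial.C 1, ?_, ?_⟩
  · compute_degree!
  · intro y
    simp [gp]
    ring

end RCE

namespace RCE

theorem main_thm :
    ∃ f g : Polynomial ℝ,
      f.natDegree = 3 ∧ g.natDegree = 7 ∧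
      (∀ x ∈ Icc (0:ℝ) 1, f.eval x ∈ Icc (0:ℝ) 1) ∧
      (∀ x ∈ Icc (0:ℝ) 1, g.eval x ∈ Icc (0:ℝ) 1) ∧
      f.eval 0 = 0 ∧ g.eval 0 = 0 ∧
      ∃ c₁ c₂ d₁ d₂ : ℝ,
        0 < c₁ ∧ c₁ < c₂ ∧ c₂ < 1 ∧
        {x : ℝ | x ∈ Ioo (0:ℝ) 1 ∧ deriv (fun y => f.eval y) x = 0} = {c₁, c₂} ∧
        iteratedDeriv 2 (fun y => f.eval y) c₁ ≠ 0 ∧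
        iteratedDeriv 2 (fun y => f.eval y) c₂ ≠ 0 ∧
        0 < d₁ ∧ d₁ < d₂ ∧ d₂ < 1 ∧
        {x : ℝ | x ∈ Ioo (0:ℝ) 1 ∧ deriv (fun y => g.eval y) x = 0} = {d₁, d₂} ∧
        (∀ d ∈ ({d₁, d₂} : Set ℝ),
          iteratedDeriv 2 (fun y => g.eval y) d = 0 ∧
          iteratedDeriv 3 (fun y => g.eval y) d = 0 ∧
          iteratedDeriv 4 (fun y => g.eval y) d ≠ 0) ∧
        (∀ x ∈ Icc (0:ℝ) 1, x ≠ c₁ → x ≠ c₂ → schwarzian (fun y => f.eval y) x < 0) ∧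
        (∀ x ∈ Icc (0:ℝ) 1, x ≠ d₁ → x ≠ d₂ → schwarzian (fun y => g.eval y) x < 0) ∧
        (∃ h : ℝ → ℝ,
          ContinuousOn h (Icc (0:ℝ) 1) ∧ StrictMonoOn h (Icc (0:ℝ) 1) ∧
          h '' Icc (0:ℝ) 1 = Icc (0:ℝ) 1 ∧
          ∀ x ∈ Icc (0:ℝ) 1, h (f.eval x) = g.eval (h x)) ∧
        (∀ c ∈ ({c₁, c₂} : Set ℝ),
          Recurrent (fun y => f.eval y) c → ColletEckmann (fun y => f.eval y) c) ∧
        (∃ ct ∈ ({d₁, d₂} : Set ℝ),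
          Recurrent (fun y => g.eval y) ct ∧ ¬ ColletEckmann (fun y => g.eval y) ct) := by
  obtain ⟨Bf, Bg, hf, hg, ⟨φ, φ1, φ2, φ3⟩, hrec, hce, hnce⟩ := main_dyn
  obtain ⟨Pf, pf1, pf2⟩ := fpoly
  obtain ⟨Pg, pg1, pg2⟩ := gpoly
  obtain ⟨f, f1, f2⟩ := Fam.poly hf Pf pf2
  obtain ⟨g, g1, g2⟩ := Fam.poly hg Pg pg2
  have f3 : ∀ x, f.eval x = fF.G Bf x := fun x => congrFun f2 x
  have g3 : ∀ x, g.eval x = gF.G Bg x := fun x => congrFun g2 x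
  have ef : fF.e = 2 := rfl
  have eg : gF.e = 4 := gF_e
  obtain ⟨i2, i3⟩ := Fam.f_iters ef hf
  obtain ⟨j2, j3, j4⟩ := Fam.g_iters eg hg
  obtain ⟨oc1, oc2, oc3⟩ := Fam.c_order hf
  obtain ⟨od1, od2, od3⟩ := Fam.c_order hg
  have Af := Fam.A_pos hf
  have Ag := Fam.A_pos hg
  have Λf := Fam.Λpos hf
  have Λg := Fam.Λpos hg
  refine ⟨f, g, f1.trans pf1, g1.trans pg1, ?_⟩
  simp only [f3, g3]
  refine ⟨fun x hx => Fam.G_mem hf hx, fun x hx => Fam.G_mem hg hx, Fam.G_zero hf, Fam.G_zero hg,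
    _, _, _, _, oc1, oc2, oc3, Fam.crit hf, ?_, ?_, od1, od2, od3, Fam.crit hg, ?_,
    fun x _ h1 h2 => Fam.f_schw ef hf h1 h2, fun x _ h1 h2 => Fam.g_schw eg hg h1 h2,
    conj_unit hf hg φ1 φ2 φ3, ?_, ?_⟩
  · change iteratedDeriv 2 (fF.G Bf) _ ≠ 0
    rw [i2]; simp only; rw [Fam.L_c1 hf]
    exact mul_ne_zero (by positivity) (by norm_num)
  · change iteratedDeriv 2 (fF.G Bf) _ ≠ 0
    rw [i2]; simp only; rw [Fam.L_c2 hf]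
    exact mul_ne_zero (by positivity) (by norm_num)
  · change ∀ d ∈ _, iteratedDeriv 2 (gF.G Bg) d = 0 ∧ iteratedDeriv 3 (gF.G Bg) d = 0 ∧
      iteratedDeriv 4 (gF.G Bg) d ≠ 0
    rw [j2, j3, j4]
    simp only
    intro d hd
    have hL : gF.L Bg d = -1 ∨ gF.L Bg d = 1 := by
      rcases hd with h | h
      · left; rw [h]; exact Fam.L_c1 hg
      · right; rw [h]; exact Fam.L_c2 hg
    rcases hL with h | h <;> rw [h] <;>
      exact ⟨by norm_num, by norm_num, mul_ne_zero (by positivity) (by norm_num)⟩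
  · intro c hc hr
    rcases hc with h | h
    · rw [h]; exact (Fam.CE_iff hf).2 hce
    · rw [h] at hr; exact absurd hr (Fam.not_rec hf)
  · exact ⟨_, Or.inl rfl, Fam.rec_of hg hrec, fun h => hnce ((Fam.CE_iff hg).1 h)⟩

end RCE

/-- Theorem B: the Recurrent Collet–Eckmann condition is not invariant under topological
conjugacy for real polynomials on the interval with negative Schwarzian derivative:
there are topologically conjugate polynomials `f` (degree 3) and `g` (degree 7), with
negative Schwarzian derivative, such that `f` is RCE while `g` is not. -/
theorem rce_not_topological :
    ∃ f g : Polynomial ℝ,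
      f.natDegree = 3 ∧ g.natDegree = 7 ∧
      (∀ x ∈ Icc (0:ℝ) 1, f.eval x ∈ Icc (0:ℝ) 1) ∧
      (∀ x ∈ Icc (0:ℝ) 1, g.eval x ∈ Icc (0:ℝ) 1) ∧
      f.eval 0 = 0 ∧ g.eval 0 = 0 ∧
      ∃ c₁ c₂ d₁ d₂ : ℝ,
        -- f has exactly two critical points in (0,1), each of multiplicity 2
        0 < c₁ ∧ c₁ < c₂ ∧ c₂ < 1 ∧
        {x : ℝ | x ∈ Ioo (0:ℝ) 1 ∧ deriv (fun y => f.eval y) x = 0} = {c₁, c₂} ∧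
        iteratedDeriv 2 (fun y => f.eval y) c₁ ≠ 0 ∧
        iteratedDeriv 2 (fun y => f.eval y) c₂ ≠ 0 ∧
        -- g has exactly two critical points in (0,1), each of local degree 4
        0 < d₁ ∧ d₁ < d₂ ∧ d₂ < 1 ∧
        {x : ℝ | x ∈ Ioo (0:ℝ) 1 ∧ deriv (fun y => g.eval y) x = 0} = {d₁, d₂} ∧
        (∀ d ∈ ({d₁, d₂} : Set ℝ),
          iteratedDeriv 2 (fun y => g.eval y) d = 0 ∧
          iteratedDeriv 3 (fun y => g.eval y) d = 0 ∧
          iteratedDeriv 4 (fun y => g.eval y) d ≠ 0) ∧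
        -- negative Schwarzian derivative on [0,1] outside the critical points
        (∀ x ∈ Icc (0:ℝ) 1, x ≠ c₁ → x ≠ c₂ → schwarzian (fun y => f.eval y) x < 0) ∧
        (∀ x ∈ Icc (0:ℝ) 1, x ≠ d₁ → x ≠ d₂ → schwarzian (fun y => g.eval y) x < 0) ∧
        -- an increasing homeomorphism h of [0,1] conjugating f to g
        (∃ h : ℝ → ℝ,
          ContinuousOn h (Icc (0:ℝ) 1) ∧ StrictMonoOn h (Icc (0:ℝ) 1) ∧
          h '' Icc (0:ℝ) 1 = Icc (0:ℝ) 1 ∧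
          ∀ x ∈ Icc (0:ℝ) 1, h (f.eval x) = g.eval (h x)) ∧
        -- f satisfies RCE: every recurrent critical point is Collet–Eckmann
        (∀ c ∈ ({c₁, c₂} : Set ℝ),
          Recurrent (fun y => f.eval y) c → ColletEckmann (fun y => f.eval y) c) ∧
        -- g does not: it has a recurrent critical point that is not Collet–Eckmann
        (∃ ct ∈ ({d₁, d₂} : Set ℝ),
          Recurrent (fun y => g.eval y) ct ∧ ¬ ColletEckmann (fun y => g.eval y) ct) := by
  exact RCE.main_thm
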